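/- Let K be an algebraically closed field of characteristic zero and (X, Γ) a rational finite self-correspondence over K: X an algebraic variety and Γ ⊆ X × X a closed irreducible subvariety such that both coordinate projections π₁, π₂ : Γ → X are dominant and generically finite-to-one. If (X, Γ) has infinitely many totally invariant hypersurfaces (hypersurfaces H on X with π₁*H = π₂*H), then Γ preserves a nonconstant rational function on X, i.e. there exists g ∈ K(X) \ K with g∘π₁ = g∘π₂. -/

import Mathlib

/-!
# Cantat's theorem for rational finite self-correspondences (Corollary 6.2)

The algebraic variety `X` over an algebraically closed field `K` of characteristic zero is
modelled by an (affine model with) coordinate ring `R`: a finitely generated `K`-algebra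
domain.  The correspondence `Γ ⊆ X × X` is a closed irreducible subvariety, modelled by its
coordinate ring `T`: a finitely generated `K`-algebra domain together with the two pullback
maps `p₁, p₂ : R → T` of the coordinate projections, which generate `T` as a `K`-algebra
(so that `Γ` is a closed subvariety of `X × X`).  The projections are dominant (the `pᵢ` are
injective) and generically finite-to-one (every element of `T` is algebraic over `pᵢ(R)`,
i.e. the function field extension `K(Γ)/K(X)` is algebraic for both projections).

A hypersurface `H = V(I)` on `X` is totally invariant when its proper transforms along the
two projections agree.  A preserved nonconstant rational function `g = a/b ∈ K(X) \ K`
with `g∘π₁ = g∘π₂` is expressed denominator-freely by `p₁(a)·p₂(b) = p₂(a)·p₁(b)`.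
-/

/-- A prime ideal `P` of a commutative ring has height one. -/
def HeightOnePrime {R : Type*} [CommRing R] (P : Ideal R) : Prop :=
  P.IsPrime ∧ P ≠ ⊥ ∧ ∀ Q : Ideal R, Q.IsPrime → Q < P → Q = ⊥

/-- `I` is the radical vanishing ideal of a nonempty Zariski closed subset of pure
codimension one. -/
def IsHypersurfaceIdeal {R : Type*} [CommRing R] (I : Ideal R) : Prop :=
  I.IsRadical ∧ I ≠ ⊤ ∧ ∀ P ∈ I.minimalPrimes, HeightOnePrime P

/-- The vanishing ideal of the proper transform of `V(I)` along the dominant map induced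
by `f`. -/
def properTransform {R S : Type*} [CommRing R] [CommRing S] (f : R →+* S) (I : Ideal R) :
    Ideal S :=
  sInf {Q : Ideal S | Q ∈ (I.map f).minimalPrimes ∧ Q.comap f ∈ I.minimalPrimes}

open Polynomial

namespace Correspondence

section Valuations

variable {A Ω Γ : Type*} [CommRing A] [Field Ω] [LinearOrderedCommGroupWithZero Γ]

/-- The valuation `v` is nonnegative on the image of `A` and its center there is generated by
the prime element `π`. -/
structure Dominates (φ : A →+* Ω) (π : A) (v : Valuation Ω Γ) : Prop where
  inj : Function.Injective φ
  prime : Prime π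
  le_one : ∀ a, v (φ a) ≤ 1
  lt_one_iff : ∀ a, v (φ a) < 1 ↔ π ∣ a

theorem eval₂_le_one {v : Valuation Ω Γ} {φ : A →+* Ω} (hφ : ∀ a, v (φ a) ≤ 1) {t : Ω}
    (ht : v t ≤ 1) (p : A[X]) : v (p.eval₂ φ t) ≤ 1 := by
  rw [eval₂_eq_sum, Polynomial.sum]
  refine v.map_sum_le fun i _ => ?_
  rw [map_mul, map_pow]
  exact mul_le_one' (hφ _) (pow_le_one' ht _)

theorem le_of_monic_eval₂_eq_zero {v : Valuation Ω Γ} {φ : A →+* Ω} {t : Ω} {p : A[X]}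
    (hp : p.Monic) (h0 : p.eval₂ φ t = 0) {γ : Γ} (hγ : 1 ≤ γ) (hc : ∀ i, v (φ (p.coeff i)) ≤ γ) :
    v t ≤ γ := by
  by_contra! hlt
  have ht1 : 1 < v t := hγ.trans_lt hlt
  have ht0 : v t ≠ 0 := (zero_lt_one.trans ht1).ne'
  rcases Nat.eq_zero_or_pos p.natDegree with hd | hd
  · rw [Polynomial.eq_one_of_monic_natDegree_zero hp hd] at h0
    simp at h0
  rw [eval₂_eq_sum_range, Finset.sum_range_succ] at h0
  rw [hp.coeff_natDegree, map_one, one_mul] at h0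
  have h1 : v (∑ x ∈ Finset.range p.natDegree, φ (p.coeff x) * t ^ x) < v (t ^ p.natDegree) := by
    refine v.map_sum_lt (by simp [ht0]) fun i hi => ?_
    rw [map_mul, map_pow, map_pow]
    have hi' : i + 1 ≤ p.natDegree := Finset.mem_range.mp hi
    calc v (φ (p.coeff i)) * v t ^ i ≤ γ * v t ^ i := by gcongr; exact hc i
      _ < v t * v t ^ i := by
        exact mul_lt_mul_of_pos_right hlt (pow_pos (zero_lt_iff.mpr ht0) _)
      _ = v t ^ (i + 1) := by rw [pow_succ, mul_comm]
      _ ≤ v t ^ p.natDegree := pow_le_pow_right₀ ht1.le hi'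
  have h2 := v.map_add_eq_of_lt_left h1
  rw [add_comm, h0, map_zero] at h2
  rw [← h2] at h1
  exact not_lt_zero h1

theorem le_one_of_isIntegralElem {v : Valuation Ω Γ} {φ : A →+* Ω} (hφ : ∀ a, v (φ a) ≤ 1) {t : Ω}
    (ht : φ.IsIntegralElem t) : v t ≤ 1 := by
  obtain ⟨p, hp, h0⟩ := ht
  exact le_of_monic_eval₂_eq_zero hp h0 le_rfl fun i => hφ _

namespace Dominates

variable {φ : A →+* Ω} {π : A} {v : Valuation Ω Γ}

theorem eq_one (h : Dominates φ π v) {a : A} (ha : ¬ π ∣ a) : v (φ a) = 1 :=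
  le_antisymm (h.le_one a) (not_lt.mp fun hlt => ha ((h.lt_one_iff a).mp hlt))

theorem lt_one (h : Dominates φ π v) : v (φ π) < 1 := (h.lt_one_iff π).mpr dvd_rfl

theorem ne_zero (h : Dominates φ π v) : φ π ≠ 0 :=
  (map_ne_zero_iff φ h.inj).mpr h.prime.ne_zero

theorem v_ne_zero (h : Dominates φ π v) : v (φ π) ≠ 0 := (v.ne_zero_iff).mpr h.ne_zero

theorem exists_eq_pow [IsDomain A] [WfDvdMonoid A] (h : Dominates φ π v) {a : A} (ha : a ≠ 0) :
    ∃ k : ℕ, v (φ a) = v (φ π) ^ k := by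
  obtain ⟨k, b, hb, rfl⟩ := WfDvdMonoid.max_power_factor ha h.prime.irreducible
  exact ⟨k, by rw [map_mul, map_mul, h.eq_one hb, mul_one, map_pow, map_pow]⟩

/-- Every polynomial with a given root may be divided by a power of `π` so that one of its
coefficients becomes a unit. -/
theorem exists_poly [IsDomain A] [WfDvdMonoid A] (h : Dominates φ π v) {t : Ω} {p : A[X]}
    (hp : p ≠ 0) (h0 : p.eval₂ φ t = 0) :
    ∃ q : A[X], q.eval₂ φ t = 0 ∧ ∃ i, ¬ π ∣ q.coeff i := by
  have hirr : Irreducible (C π : A[X]) := (Polynomial.prime_C_iff.mpr h.prime).irreducible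
  obtain ⟨k, q, hq, rfl⟩ := WfDvdMonoid.max_power_factor hp hirr
  refine ⟨q, ?_, ?_⟩
  · rw [eval₂_mul, eval₂_pow, eval₂_C] at h0
    exact (mul_eq_zero.mp h0).resolve_left (pow_ne_zero _ h.ne_zero)
  · by_contra! hc
    exact hq (C_dvd_iff_dvd_coeff _ _ |>.mpr hc)

theorem exists_simple_residual_root [IsDomain A] [WfDvdMonoid A]
    (hN : ∀ n : ℕ, n ≠ 0 → ¬ π ∣ (n : A)) (h : Dominates φ π v)
    {t : Ω} (ht : v t ≤ 1) {p : A[X]} (hp : p ≠ 0) (h0 : p.eval₂ φ t = 0) :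
    ∃ q : A[X], v (q.eval₂ φ t) < 1 ∧ v (q.derivative.eval₂ φ t) = 1 := by
  classical
  have hex : ∃ d, ∃ q : A[X], q.natDegree = d ∧ v (q.eval₂ φ t) < 1 ∧ ∃ i, ¬ π ∣ q.coeff i := by
    obtain ⟨q, hq, hi⟩ := h.exists_poly hp h0
    exact ⟨_, q, rfl, by rw [hq, map_zero]; exact zero_lt_one, hi⟩
  obtain ⟨q, hqd, hqv, i, hi⟩ := Nat.find_spec hex
  -- the leading coefficient is not divisible by `π`
  have hlead : ¬ π ∣ q.leadingCoeff := by
    intro hdvd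
    have hle := q.eraseLead_natDegree_le
    have hine : i ≠ q.natDegree := by rintro rfl; exact hi hdvd
    have hd : q.natDegree ≠ 0 := by
      intro h00
      apply hi
      rw [Polynomial.coeff_eq_zero_of_natDegree_lt (by omega)]
      exact dvd_zero _
    have hsub : q = q.eraseLead + C q.leadingCoeff * X ^ q.natDegree := by
      exact (q.eraseLead_add_C_mul_X_pow).symm
    refine Nat.find_min hex (m := q.eraseLead.natDegree) (by omega)
      ⟨q.eraseLead, rfl, ?_, i, by rwa [eraseLead_coeff_of_ne _ hine]⟩
    have he : q.eraseLead.eval₂ φ t = q.eval₂ φ t - φ q.leadingCoeff * t ^ q.natDegree := by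
      conv_rhs => rw [hsub]
      rw [eval₂_add, ← hsub]
      simp
    rw [he]
    refine v.map_sub_lt hqv ?_
    rw [map_mul, map_pow]
    exact mul_lt_one_of_lt_of_le ((h.lt_one_iff _).mpr hdvd) (pow_le_one' ht _)
  have hd : q.natDegree ≠ 0 := by
    intro h00
    rw [eq_C_of_natDegree_eq_zero h00, eval₂_C, h.lt_one_iff] at hqv
    rw [leadingCoeff, h00] at hlead
    exact hlead hqv
  refine ⟨q, hqv, le_antisymm (eval₂_le_one h.le_one ht _) (not_lt.mp fun hlt => ?_)⟩
  refine Nat.find_min hex (m := q.derivative.natDegree) ?_ ⟨_, rfl, hlt, q.natDegree - 1, ?_⟩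
  · exact lt_of_lt_of_eq (natDegree_derivative_lt hd) hqd
  · rw [coeff_derivative, Nat.sub_add_cancel (Nat.pos_of_ne_zero hd)]
    intro hdvd
    rcases h.prime.dvd_or_dvd hdvd with h1 | h1
    · exact hlead h1
    · apply hN q.natDegree hd
      have : ((q.natDegree - 1 : ℕ) : A) + 1 = (q.natDegree : A) := by
        exact_mod_cast congrArg (Nat.cast (R := A)) (Nat.sub_add_cancel (Nat.pos_of_ne_zero hd))
      rwa [this] at h1

/-- Values of algebraic elements are commensurable with the value of `π`. -/
theorem exists_pow_eq_zpow [IsDomain A] [WfDvdMonoid A] (h : Dominates φ π v)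
    {t : Ω} (ht : t ≠ 0) {p : A[X]} (hp : p ≠ 0) (h0 : p.eval₂ φ t = 0) :
    ∃ e : ℕ, 0 < e ∧ e ≤ p.natDegree ∧ ∃ a : ℤ, v t ^ e = v (φ π) ^ a := by
  have hvt : v t ≠ 0 := (v.ne_zero_iff).mpr ht
  have key : ∃ i j, i < j ∧ p.coeff i ≠ 0 ∧ p.coeff j ≠ 0 ∧
      v (φ (p.coeff i) * t ^ i) = v (φ (p.coeff j) * t ^ j) := by
    by_contra! hne
    have hne' : ∀ i ∈ p.support, ∀ j ∈ p.support, i ≠ j →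
        v (φ (p.coeff i) * t ^ i) ≠ v (φ (p.coeff j) * t ^ j) := by
      intro i hi j hj hij
      rw [mem_support_iff] at hi hj
      rcases lt_or_gt_of_ne hij with hlt | hlt
      · exact hne i j hlt hi hj
      · exact (hne j i hlt hj hi).symm
    obtain ⟨m, hm, hmax⟩ := Finset.exists_max_image p.support
      (fun i => v (φ (p.coeff i) * t ^ i)) (support_nonempty.mpr hp)
    have hm0 : φ (p.coeff m) * t ^ m ≠ 0 := mul_ne_zero
      ((map_ne_zero_iff φ h.inj).mpr (mem_support_iff.mp hm)) (pow_ne_zero _ ht)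
    rw [eval₂_eq_sum, Polynomial.sum, ← Finset.add_sum_erase _ _ hm] at h0
    have hlt : v (∑ x ∈ p.support.erase m, φ (p.coeff x) * t ^ x) < v (φ (p.coeff m) * t ^ m) := by
      refine v.map_sum_lt ((v.ne_zero_iff).mpr hm0) fun i hi => ?_
      obtain ⟨him, hi⟩ := Finset.mem_erase.mp hi
      exact lt_of_le_of_ne (hmax i hi) (hne' i hi m hm him)
    have := v.map_add_eq_of_lt_left hlt
    rw [h0, map_zero] at this
    exact hm0 ((v.zero_iff).mp this.symm)
  obtain ⟨i, j, hij, hi, hj, heq⟩ := key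
  obtain ⟨k, hk⟩ := h.exists_eq_pow hi
  obtain ⟨l, hl⟩ := h.exists_eq_pow hj
  refine ⟨j - i, by omega, (Nat.sub_le _ _).trans (le_natDegree_of_ne_zero hj), (k : ℤ) - l, ?_⟩
  simp only [map_mul, map_pow, hk, hl] at heq
  rw [zpow_sub₀ h.v_ne_zero, zpow_natCast, zpow_natCast, eq_div_iff (pow_ne_zero _ h.v_ne_zero)]
  apply mul_right_cancel₀ (pow_ne_zero i hvt)
  rw [mul_right_comm, ← pow_add, Nat.sub_add_cancel hij.le, heq, mul_comm]

end Dominates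

end Valuations

section Tame

theorem derivation_eval₂ {A Ω Γ : Type*} [CommRing A] [Field Ω]
    [LinearOrderedCommGroupWithZero Γ] {S : Type*} [CommRing S] [Algebra S Ω]
    (D : Derivation S Ω Ω) {φ : A →+* Ω} {v : Valuation Ω Γ}
    (hD : ∀ a, v (D (φ a)) ≤ 1) {t : Ω} (ht : v t ≤ 1) (p : A[X]) :
    ∃ r, D (p.eval₂ φ t) = r + p.derivative.eval₂ φ t * D t ∧ v r ≤ 1 := by
  induction p using Polynomial.induction_on' with
  | add p q hp hq =>
    obtain ⟨r, hr, hvr⟩ := hp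
    obtain ⟨s, hs, hvs⟩ := hq
    refine ⟨r + s, ?_, v.map_add_le hvr hvs⟩
    rw [eval₂_add, map_add, hr, hs, derivative_add, eval₂_add]
    ring
  | monomial n a =>
    refine ⟨t ^ n * D (φ a), ?_, ?_⟩
    · rw [eval₂_monomial, D.leibniz, D.leibniz_pow, derivative_monomial, eval₂_monomial]
      simp only [smul_eq_mul, nsmul_eq_mul, map_mul, map_natCast]
      ring
    · rw [map_mul, map_pow]
      exact mul_le_one' (pow_le_one' ht _) (hD a)

variable {A Ω Γ k : Type*} [CommRing A] [IsDomain A] [UniqueFactorizationMonoid A]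
  [Field k] [Algebra A k] [IsFractionRing A k] [CharZero k]
  [Field Ω] [Algebra A Ω] [Algebra k Ω] [IsScalarTower A k Ω]
  [LinearOrderedCommGroupWithZero Γ]
  {S : Type*} [CommRing S] [Algebra S Ω] {π : A} {v : Valuation Ω Γ}

omit [Algebra A Ω] in
theorem Dominates.exists_pow_mul_le_one {φ : A →+* Ω} (h : Dominates φ π v)
    {t : Ω} {p : A[X]} (hp : p ≠ 0) (h0 : p.eval₂ φ t = 0) :
    ∃ N : ℕ, v (φ π) ^ N * v t ≤ 1 := by
  rcases eq_or_ne t 0 with rfl | ht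
  · exact ⟨0, by simp⟩
  obtain ⟨e, he, -, a, ha⟩ := h.exists_pow_eq_zpow ht hp h0
  refine ⟨a.natAbs, ?_⟩
  rw [← pow_le_one_iff he.ne', mul_pow, ha, ← pow_mul, ← zpow_natCast, ← zpow_add₀ h.v_ne_zero]
  have : 0 ≤ (a.natAbs * e : ℕ) + a := by
    have h1 : a.natAbs ≤ a.natAbs * e := Nat.le_mul_of_pos_right _ he
    omega
  obtain ⟨m, hm⟩ := Int.eq_ofNat_of_zero_le this
  rw [hm, zpow_natCast]
  exact pow_le_one' h.lt_one.le _

variable (A k) in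
theorem exists_smul_eq_aeval {θ : Ω} (hθ : IsIntegral A θ) :
    ∃ a : A, a ≠ 0 ∧ ∀ z ∈ IntermediateField.adjoin k {θ}, IsIntegral A z →
      ∃ p : A[X], algebraMap A Ω a * z = aeval θ p := by
  have hθk : IsIntegral k θ := hθ.tower_top
  let B := IntermediateField.adjoin.powerBasis hθk
  have : FiniteDimensional k (IntermediateField.adjoin k {θ}) := B.finite
  have hinj : Function.Injective (algebraMap (IntermediateField.adjoin k {θ}) Ω) :=
    Subtype.val_injective
  have : IsScalarTower A (IntermediateField.adjoin k {θ}) Ω :=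
    .of_algebraMap_eq fun a => by
      rw [IsScalarTower.algebraMap_apply A k Ω,
        IsScalarTower.algebraMap_apply A k (IntermediateField.adjoin k {θ})]
      rfl
  have hBgen : algebraMap (IntermediateField.adjoin k {θ}) Ω B.gen = θ := by
    simp [B, IntermediateField.adjoin.powerBasis_gen]
  have hgen : IsIntegral A B.gen := by
    rw [← isIntegral_algebraMap_iff (B := Ω) hinj, hBgen]
    exact hθ
  obtain ⟨a, b, hb, hab⟩ := IsFractionRing.div_surjective A (Algebra.discr k B.basis)
  have hb0 : algebraMap A k b ≠ 0 := IsFractionRing.to_map_ne_zero_of_mem_nonZeroDivisors hb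
  refine ⟨a, ?_, fun z hz hzint => ?_⟩
  · rintro rfl
    rw [map_zero, zero_div] at hab
    exact Algebra.discr_not_zero_of_basis k B.basis hab.symm
  · have hz' : IsIntegral A (⟨z, hz⟩ : IntermediateField.adjoin k {θ}) := by
      rw [← isIntegral_algebraMap_iff (B := Ω) hinj]
      exact hzint
    have := Algebra.discr_mul_isIntegral_mem_adjoin k hgen hz'
    rw [Algebra.adjoin_singleton_eq_range_aeval] at this
    obtain ⟨p, hp⟩ := this
    refine ⟨C b * p, ?_⟩
    have h2 := congrArg (algebraMap (IntermediateField.adjoin k {θ}) Ω) hp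
    erw [← aeval_algebraMap_apply, hBgen] at h2
    rw [map_mul, aeval_C, h2, ← hab, Algebra.smul_def, map_mul,
      ← IsScalarTower.algebraMap_apply k, map_div₀, IsScalarTower.algebraMap_apply A k Ω,
      IsScalarTower.algebraMap_apply A k Ω]
    have : algebraMap k Ω (algebraMap A k b) ≠ 0 := by simpa using hb0
    field_simp
    rfl

omit [IsDomain A] [UniqueFactorizationMonoid A] in
theorem isIntegral_of_forall_valuationSubring {t : Ω}
    (h : ∀ V : ValuationSubring Ω, (∀ a, algebraMap A Ω a ∈ V) → t ∈ V) : IsIntegral A t := by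
  have h1 : t ∈ (integralClosure (Subring.closure (Set.range (algebraMap A Ω))) Ω).toSubring := by
    rw [← iInf_valuationSubring_superset]
    simp only [Subring.mem_iInf, Subtype.forall]
    exact fun V hV => h V fun a => hV ⟨a, rfl⟩
  have h2 : Subring.closure (Set.range (algebraMap A Ω)) = (algebraMap A Ω).range := by
    rw [← RingHom.coe_range, Subring.closure_eq]
  rw [h2] at h1
  obtain ⟨p, hp, h0⟩ := (h1 : IsIntegral (algebraMap A Ω).range t)
  have hlift : p ∈ Polynomial.lifts (algebraMap A Ω).rangeRestrict :=
    (Polynomial.lifts_iff_coeff_lifts p).mpr fun n =>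
      (algebraMap A Ω).rangeRestrict_surjective _
  obtain ⟨q, hq, -, hqm⟩ := Polynomial.lifts_and_natDegree_eq_and_monic hlift hp
  refine ⟨q, hqm, ?_⟩
  rw [← hq, eval₂_map] at h0
  exact h0

/-- An element of nonnegative valuation is a quotient of integral elements with denominator
a unit. -/
theorem Dominates.exists_integral_div (h : Dominates (algebraMap A Ω) π v) {t : Ω} (ht : v t ≤ 1)
    {p : A[X]} (hp : p ≠ 0) (h0 : p.eval₂ (algebraMap A Ω) t = 0) :
    ∃ b ∈ Algebra.adjoin A {t}, IsIntegral A b ∧ IsIntegral A (t * b) ∧ v b = 1 := by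
  classical
  obtain ⟨q, hq0, i, hi⟩ := h.exists_poly hp h0
  have hfin : ∀ m, ¬ π ∣ q.coeff m → m ≤ q.natDegree := fun m hm =>
    le_natDegree_of_ne_zero fun h0 => hm (h0 ▸ dvd_zero _)
  set j := Nat.findGreatest (fun m => ¬ π ∣ q.coeff m) q.natDegree with hj
  have hjp : ¬ π ∣ q.coeff j := Nat.findGreatest_spec (P := fun m => ¬ π ∣ q.coeff m) (hfin i hi) hi
  have hjmax : ∀ m, j < m → π ∣ q.coeff m := by
    intro m hm
    by_contra hc
    exact absurd (Nat.le_findGreatest (P := fun m => ¬ π ∣ q.coeff m) (hfin m hc) hc) (by omega)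
  set b := ∑ i ∈ Finset.range (q.natDegree + 1), algebraMap A Ω (q.coeff (j + i)) * t ^ i with hb
  have hrel : (∑ i ∈ Finset.range j, algebraMap A Ω (q.coeff i) * t ^ i) + t ^ j * b = 0 := by
    rw [← hq0, eval₂_eq_sum_range' _ (show q.natDegree < j + (q.natDegree + 1) by omega),
      Finset.sum_range_add, hb, Finset.mul_sum]
    congr 1
    refine Finset.sum_congr rfl fun i _ => ?_
    rw [pow_add]
    ring
  have hvb : v b = 1 := by
    rw [hb, Finset.sum_range_succ', add_comm]
    have h1 : v (algebraMap A Ω (q.coeff (j + 0)) * t ^ 0) = 1 := by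
      simpa using h.eq_one hjp
    rw [v.map_add_eq_of_lt_left, h1]
    rw [h1]
    refine v.map_sum_lt one_ne_zero fun i _ => ?_
    rw [map_mul, map_pow]
    exact mul_lt_one_of_lt_of_le ((h.lt_one_iff _).mpr (hjmax _ (by omega))) (pow_le_one' ht _)
  have hj0 : j ≠ 0 := by
    intro h00
    rw [h00] at hrel
    rw [Finset.sum_range_zero, zero_add, pow_zero, one_mul] at hrel
    rw [hrel, map_zero] at hvb
    exact zero_ne_one hvb
  have hVtb : ∀ V : ValuationSubring Ω, (∀ a, algebraMap A Ω a ∈ V) → b ∈ V ∧ t * b ∈ V := by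
    intro V hV
    rcases V.mem_or_inv_mem t with htV | htV
    · have hbV : b ∈ V := sum_mem fun i _ => mul_mem (hV _) (pow_mem htV _)
      exact ⟨hbV, mul_mem htV hbV⟩
    · rcases eq_or_ne t 0 with ht0 | ht0
      · have htV : t ∈ V := ht0 ▸ V.zero_mem
        have hbV : b ∈ V := sum_mem fun i _ => mul_mem (hV _) (pow_mem htV _)
        exact ⟨hbV, mul_mem htV hbV⟩
      · have htb : t * b ∈ V := by
          have : t * b = - ∑ i ∈ Finset.range j,
              algebraMap A Ω (q.coeff i) * t⁻¹ ^ (j - 1 - i) := by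
            have hpow : t ^ (j - 1) ≠ 0 := pow_ne_zero _ ht0
            apply mul_left_cancel₀ hpow
            rw [← mul_assoc, ← pow_succ, Nat.sub_add_cancel (Nat.pos_of_ne_zero hj0), mul_neg,
              eq_neg_iff_add_eq_zero, add_comm]
            refine Eq.trans (congrArg (· + t ^ j * b) ?_) hrel
            rw [Finset.mul_sum]
            refine Finset.sum_congr rfl fun i hi => ?_
            have hi' : i ≤ j - 1 := by have := Finset.mem_range.mp hi; omega
            rw [mul_left_comm, inv_pow, ← pow_sub₀ t ht0 (Nat.sub_le _ _),
              Nat.sub_sub_self hi']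
          rw [this]
          exact neg_mem (sum_mem fun i _ => mul_mem (hV _) (pow_mem htV _))
        refine ⟨?_, htb⟩
        have := mul_mem htV htb
        rwa [inv_mul_cancel_left₀ ht0] at this
  refine ⟨b, Subalgebra.sum_mem _ fun i _ => mul_mem (Subalgebra.algebraMap_mem _ _)
    (pow_mem (Algebra.self_mem_adjoin_singleton A t) _),
    isIntegral_of_forall_valuationSubring fun V hV => (hVtb V hV).1,
    isIntegral_of_forall_valuationSubring fun V hV => (hVtb V hV).2, hvb⟩

end Tame
section DLog

variable {S Ω : Type*} [CommRing S] [Field Ω] [Algebra S Ω] (D : Derivation S Ω Ω)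

/-- The logarithmic derivative with respect to a derivation of a field. -/
def dlog (f : Ω) : Ω := D f / f

theorem dlog_mul {f g : Ω} (hf : f ≠ 0) (hg : g ≠ 0) : dlog D (f * g) = dlog D f + dlog D g := by
  simp only [dlog, D.leibniz, smul_eq_mul]
  field_simp
  ring

@[simp] theorem dlog_one : dlog D 1 = 0 := by simp [dlog]

theorem dlog_inv {f : Ω} (hf : f ≠ 0) : dlog D f⁻¹ = - dlog D f := by
  have := dlog_mul D hf (inv_ne_zero hf)
  rw [mul_inv_cancel₀ hf, dlog_one] at this
  exact eq_neg_of_add_eq_zero_right this.symm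

theorem dlog_pow {f : Ω} (hf : f ≠ 0) (n : ℕ) : dlog D (f ^ n) = n * dlog D f := by
  induction n with
  | zero => simp
  | succ n ih => rw [pow_succ, dlog_mul D (pow_ne_zero _ hf) hf, ih]; push_cast; ring

theorem dlog_zpow {f : Ω} (hf : f ≠ 0) (n : ℤ) : dlog D (f ^ n) = n * dlog D f := by
  cases n with
  | ofNat n => simpa using dlog_pow D hf n
  | negSucc n =>
    rw [zpow_negSucc, dlog_inv D (pow_ne_zero _ hf), dlog_pow D hf]
    push_cast
    ring

theorem dlog_multiset_prod (s : Multiset Ω) (hs : (0 : Ω) ∉ s) :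
    dlog D s.prod = (s.map (dlog D)).sum := by
  induction s using Multiset.induction_on with
  | empty => simp
  | cons a s ih =>
    rw [Multiset.mem_cons, not_or] at hs
    rw [Multiset.prod_cons, Multiset.map_cons, Multiset.sum_cons, dlog_mul D (Ne.symm hs.1)
      (Multiset.prod_ne_zero hs.2), ih hs.2]

end DLog

section Tame

variable {A Ω Γ k : Type*} [CommRing A] [IsDomain A] [UniqueFactorizationMonoid A]
  [Field k] [Algebra A k] [IsFractionRing A k] [CharZero k]
  [Field Ω] [Algebra A Ω] [Algebra k Ω] [IsScalarTower A k Ω]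
  [LinearOrderedCommGroupWithZero Γ]
  {S : Type*} [CommRing S] [Algebra S Ω] {π : A} {v : Valuation Ω Γ}

omit [IsDomain A] [UniqueFactorizationMonoid A] [Algebra A Ω] in
theorem Dominates.natCast_eq_one {φ : A →+* Ω} (h : Dominates φ π v)
    (hN : ∀ n : ℕ, n ≠ 0 → ¬ π ∣ (n : A)) {n : ℕ} (hn : n ≠ 0) : v (n : Ω) = 1 := by
  simpa using h.eq_one (hN n hn)

omit [IsDomain A] [UniqueFactorizationMonoid A] [Algebra A Ω] in
theorem Dominates.intCast_le_one {φ : A →+* Ω} (h : Dominates φ π v) (n : ℤ) :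
    v (n : Ω) ≤ 1 := by
  simpa using h.le_one (n : A)

variable [Algebra.IsAlgebraic A Ω]

omit [IsDomain A] [UniqueFactorizationMonoid A] in
variable (A) in
theorem exists_poly_eval₂_eq_zero (t : Ω) : ∃ p : A[X], p ≠ 0 ∧ p.eval₂ (algebraMap A Ω) t = 0 :=
  Algebra.IsAlgebraic.isAlgebraic (R := A) t

variable (k) in
theorem Dominates.exists_pow_mul_derivation_le_one (h : Dominates (algebraMap A Ω) π v)
    (D : Derivation S Ω Ω) (hD : ∀ a, v (D (algebraMap A Ω a)) ≤ 1) {θ : Ω} (hθ : IsIntegral A θ) :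
    ∃ N : ℕ, ∀ t ∈ IntermediateField.adjoin k {θ}, v t ≤ 1 →
      v (algebraMap A Ω π) ^ N * v (D t) ≤ 1 := by
  obtain ⟨a, ha0, ha⟩ := exists_smul_eq_aeval A k hθ
  obtain ⟨m, hm⟩ := h.exists_eq_pow ha0
  obtain ⟨p, hp, hp0⟩ := exists_poly_eval₂_eq_zero A (D θ)
  obtain ⟨N, hN⟩ := h.exists_pow_mul_le_one hp hp0
  have hπ : v (algebraMap A Ω π) ^ N ≤ 1 := pow_le_one' h.lt_one.le _
  have hint : ∀ z ∈ IntermediateField.adjoin k {θ}, IsIntegral A z →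
      v (algebraMap A Ω π) ^ (N + m) * v (D z) ≤ 1 := by
    intro z hz hzi
    obtain ⟨q, hq⟩ := ha z hz hzi
    have hθ1 : v θ ≤ 1 := le_one_of_isIntegralElem h.le_one hθ
    have hz1 : v z ≤ 1 := le_one_of_isIntegralElem h.le_one hzi
    obtain ⟨r, hr, hr1⟩ := derivation_eval₂ D hD hθ1 q
    rw [← aeval_def, ← hq, D.leibniz] at hr
    simp only [smul_eq_mul] at hr
    have hDz : algebraMap A Ω a * D z =
        (r - z * D (algebraMap A Ω a)) + eval₂ (algebraMap A Ω) θ (derivative q) * D θ := by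
      rw [sub_add_eq_add_sub, ← hr]; ring
    rw [pow_add, mul_assoc, ← hm, ← map_mul, hDz]
    have h1 : v (r - z * D (algebraMap A Ω a)) ≤ 1 :=
      v.map_sub_le hr1 (by rw [map_mul]; exact mul_le_one' hz1 (hD a))
    rw [← map_pow, ← map_mul, mul_add]
    refine v.map_add_le ?_ ?_
    · rw [map_mul, map_pow]
      exact mul_le_one' hπ h1
    · rw [mul_left_comm, map_mul, map_mul, map_pow]
      exact mul_le_one' (eval₂_le_one h.le_one hθ1 _) hN
  refine ⟨N + m, fun t ht ht1 => ?_⟩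
  obtain ⟨p, hp, hp0⟩ := exists_poly_eval₂_eq_zero A t
  obtain ⟨b, hb, hbi, htbi, hvb⟩ := h.exists_integral_div ht1 hp hp0
  have hbE : b ∈ IntermediateField.adjoin k {θ} := by
    have : Algebra.adjoin A {t} ≤ (IntermediateField.adjoin k {θ}).toSubalgebra.restrictScalars A :=
      Algebra.adjoin_le (by simpa using ht)
    exact this hb
  have h1 := hint b hbE hbi
  have h2 := hint _ (mul_mem ht hbE) htbi
  have h3 : v (D t) = v (D (t * b) - t * D b) := by
    rw [D.leibniz, smul_eq_mul, smul_eq_mul, add_sub_cancel_left, map_mul, hvb, one_mul]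
  rw [h3, ← map_pow, ← map_mul, mul_sub]
  refine v.map_sub_le ?_ ?_
  · rwa [map_mul, map_pow]
  · rw [mul_left_comm, map_mul, map_mul, map_pow]
    exact mul_le_one' ht1 h1

omit [CharZero k] [Algebra.IsAlgebraic A Ω] in
variable (k) in
theorem Dominates.exists_uniform_exponent (h : Dominates (algebraMap A Ω) π v) {θ : Ω}
    (hθ : IsIntegral A θ) :
    ∃ e : ℕ, 0 < e ∧ ∀ t ∈ IntermediateField.adjoin k {θ}, t ≠ 0 →
      ∃ a : ℤ, v t ^ e = v (algebraMap A Ω π) ^ a := by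
  have hθk : IsIntegral k θ := hθ.tower_top
  have : FiniteDimensional k (IntermediateField.adjoin k {θ}) :=
    IntermediateField.adjoin.finiteDimensional hθk
  set d := Module.finrank k (IntermediateField.adjoin k {θ})
  refine ⟨d.factorial, Nat.factorial_pos _, fun t ht ht0 => ?_⟩
  have hdep : ¬ LinearIndependent k
      fun i : Fin (d + 1) => (⟨t, ht⟩ : IntermediateField.adjoin k {θ}) ^ (i : ℕ) := by
    intro hli
    have := hli.fintype_card_le_finrank
    simp [d] at this
  have hdepΩ : ¬ LinearIndependent A fun i : Fin (d + 1) => t ^ (i : ℕ) := by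
    rw [LinearIndependent.iff_fractionRing A k]
    intro hli
    apply hdep
    refine LinearIndependent.of_comp (IntermediateField.adjoin k {θ}).val.toLinearMap ?_
    exact hli
  rw [Fintype.not_linearIndependent_iff] at hdepΩ
  obtain ⟨g, hg, i, hi⟩ := hdepΩ
  set p : A[X] := ∑ i : Fin (d + 1), monomial (i : ℕ) (g i)
  have hcoeff : p.coeff i = g i := by
    simp only [p, finsetSum_coeff, coeff_monomial]
    simp [Fin.val_inj]
  have hp : p ≠ 0 := fun h0 => hi (by rw [← hcoeff, h0, coeff_zero])
  have hp0 : p.eval₂ (algebraMap A Ω) t = 0 := by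
    simp only [p, eval₂_finsetSum, eval₂_monomial]
    simpa [Algebra.smul_def] using hg
  have hdeg : p.natDegree ≤ d := natDegree_sum_le_of_forall_le _ _ fun i _ =>
    (natDegree_monomial_le _).trans (Nat.lt_succ_iff.mp i.2)
  obtain ⟨e, he, hle, a, ha⟩ := h.exists_pow_eq_zpow ht0 hp hp0
  obtain ⟨c, hc⟩ := Nat.dvd_factorial he (hle.trans hdeg)
  refine ⟨a * c, ?_⟩
  rw [hc, pow_mul, ha, ← zpow_natCast, ← zpow_mul]

variable (hN : ∀ n : ℕ, n ≠ 0 → ¬ π ∣ (n : A))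
include hN

omit [IsDomain A] [UniqueFactorizationMonoid A] [Algebra A Ω] [Algebra.IsAlgebraic A Ω] in
theorem Dominates.mul_dlog_le_of_pow_eq {φ : A →+* Ω} (h : Dominates φ π v) (D : Derivation S Ω Ω)
    (hD : ∀ a, v (D (φ a)) ≤ 1) {f u : Ω} (hu : u ≠ 0) {e : ℕ} (he : e ≠ 0)
    {a : ℤ} (hf : f ^ e = φ π ^ a * u) {γ : Γ} (hγ : 1 ≤ γ) (hγu : v (φ π * dlog D u) ≤ γ) :
    v (φ π * dlog D f) ≤ γ := by
  have hf0 : f ≠ 0 := by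
    rintro rfl
    rw [zero_pow he] at hf
    exact mul_ne_zero (zpow_ne_zero _ h.ne_zero) hu hf.symm
  have h1 := congrArg (dlog D) hf
  rw [dlog_pow D hf0, dlog_mul D (zpow_ne_zero _ h.ne_zero) hu, dlog_zpow D h.ne_zero] at h1
  have h2 : (e : Ω) * (φ π * dlog D f) = a * D (φ π) + φ π * dlog D u := by
    rw [mul_left_comm, h1, mul_add, mul_left_comm (φ π), dlog, mul_div_cancel₀ _ h.ne_zero]
  have h3 : v (φ π * dlog D f) = v ((e : Ω) * (φ π * dlog D f)) := by
    rw [map_mul v (e : Ω), h.natCast_eq_one hN he, one_mul]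
  rw [h3, h2]
  refine v.map_add_le (le_trans ?_ hγ) hγu
  rw [map_mul]
  exact mul_le_one' (h.intCast_le_one a) (hD π)

variable (k) in
theorem Dominates.mul_derivation_unit_le_one (h : Dominates (algebraMap A Ω) π v)
    (D : Derivation S Ω Ω) (hD : ∀ a, v (D (algebraMap A Ω a)) ≤ 1) {θ : Ω} (hθ : IsIntegral A θ)
    {u : Ω} (huE : u ∈ IntermediateField.adjoin k {θ}) (hu : v u = 1) :
    v (algebraMap A Ω π * D u) ≤ 1 := by
  set ϖ := algebraMap A Ω π with hϖ
  obtain ⟨N, hNb⟩ := h.exists_pow_mul_derivation_le_one k D hD hθ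
  obtain ⟨e, he, heE⟩ := h.exists_uniform_exponent k hθ
  have hπE : ϖ ∈ IntermediateField.adjoin k {θ} := by
    rw [hϖ, IsScalarTower.algebraMap_apply A k Ω]
    exact IntermediateField.algebraMap_mem _ _
  have hAE : ∀ q : A[X], ∀ t ∈ IntermediateField.adjoin k {θ}, q.eval₂ (algebraMap A Ω) t ∈
      IntermediateField.adjoin k {θ} := by
    intro q t ht
    rw [eval₂_eq_sum_range]
    refine sum_mem fun i _ => mul_mem ?_ (pow_mem ht _)
    rw [IsScalarTower.algebraMap_apply A k Ω]
    exact IntermediateField.algebraMap_mem _ _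
  have key : ∀ γ : ℕ, (∀ u ∈ IntermediateField.adjoin k {θ}, v u = 1 →
      v (ϖ * D u) ^ e * v ϖ ^ γ ≤ 1) → ∀ u ∈ IntermediateField.adjoin k {θ}, v u = 1 →
      v (ϖ * D u) ^ e ≤ 1 := by
    intro γ
    induction γ with
    | zero => intro hB u hu hu1; simpa using hB u hu hu1
    | succ γ ih =>
      intro hB
      apply ih
      intro u hu hu1
      obtain ⟨p, hp, hp0⟩ := exists_poly_eval₂_eq_zero A u
      obtain ⟨q, hq, hq'⟩ := h.exists_simple_residual_root hN hu1.le hp hp0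
      obtain ⟨r, hr, hr1⟩ := derivation_eval₂ D hD hu1.le q
      set g := q.eval₂ (algebraMap A Ω) u with hg
      have hϖγ : v ϖ ^ γ ≤ 1 := pow_le_one' h.lt_one.le _
      have h1 : v (ϖ * D u) = v (ϖ * D g - ϖ * r) := by
        rw [hr, mul_add, add_sub_cancel_left, mul_left_comm, map_mul _ (eval₂ _ _ _), hq', one_mul]
      have h2 : v (ϖ * r) ≤ 1 := by
        rw [map_mul]; exact mul_le_one' h.lt_one.le hr1
      have h3 : v (ϖ * D g) ^ e * v ϖ ^ γ ≤ 1 := by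
        rcases eq_or_ne g 0 with hg0 | hg0
        · rw [hg0]; simp [he.ne']
        obtain ⟨a, ha⟩ := heE g (hAE q u hu) hg0
        have hvg : v g ≠ 0 := (v.ne_zero_iff).mpr hg0
        have ha1 : 1 ≤ a := by
          by_contra! hlt
          have : v g ^ e < 1 := pow_lt_one₀ zero_le hq he.ne'
          rw [ha] at this
          refine absurd this (not_lt.mpr ?_)
          exact one_le_zpow_of_nonpos₀ (zero_lt_iff.mpr h.v_ne_zero) h.lt_one.le (by omega)
        set u₁ := g ^ e / ϖ ^ a
        have hϖa : ϖ ^ a ≠ 0 := zpow_ne_zero _ h.ne_zero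
        have hu₁ : v u₁ = 1 := by
          simp only [u₁, map_div₀, map_pow, map_zpow₀, ha]
          exact div_self (zpow_ne_zero _ h.v_ne_zero)
        have hu₁0 : u₁ ≠ 0 := div_ne_zero (pow_ne_zero _ hg0) hϖa
        have hu₁E : u₁ ∈ IntermediateField.adjoin k {θ} :=
          div_mem (pow_mem (hAE q u hu) _) (zpow_mem hπE _)
        have hge : g ^ e = ϖ ^ a * u₁ := (mul_div_cancel₀ _ hϖa).symm
        have hdl : v (ϖ * dlog D u₁) = v (ϖ * D u₁) := by
          rw [dlog, ← mul_div_assoc, map_div₀, hu₁, div_one]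
        have h4 := h.mul_dlog_le_of_pow_eq hN D hD hu₁0 he.ne' hge (γ := max 1 (v (ϖ * D u₁)))
          (le_max_left _ _) (hdl.le.trans (le_max_right _ _))
        have h5 : v (ϖ * D g) = v g * v (ϖ * dlog D g) := by
          rw [← map_mul, dlog, mul_left_comm, mul_div_cancel₀ _ hg0]
        rw [h5]
        rcases le_total (v (ϖ * D u₁)) 1 with hle | hle
        · rw [max_eq_left hle] at h4
          exact mul_le_one' (pow_le_one' (mul_le_one' hq.le h4) _) hϖγ
        · rw [max_eq_right hle] at h4
          have h6 : v ϖ ^ a ≤ v ϖ := by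
            obtain ⟨m, rfl⟩ := Int.eq_ofNat_of_zero_le (zero_le_one.trans ha1)
            rw [zpow_natCast]
            exact pow_le_of_le_one zero_le h.lt_one.le (by omega)
          calc (v g * v (ϖ * dlog D g)) ^ e * v ϖ ^ γ
              ≤ (v g * v (ϖ * D u₁)) ^ e * v ϖ ^ γ := by gcongr
            _ = v ϖ ^ a * v (ϖ * D u₁) ^ e * v ϖ ^ γ := by rw [mul_pow, ha]
            _ ≤ v ϖ * v (ϖ * D u₁) ^ e * v ϖ ^ γ := by gcongr
            _ = v (ϖ * D u₁) ^ e * v ϖ ^ (γ + 1) := by rw [pow_succ]; ac_rfl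
            _ ≤ 1 := hB u₁ hu₁E hu₁
      have h7 : v (ϖ * D u) ≤ max (v (ϖ * D g)) 1 := by
        rw [h1]
        exact (v.map_sub _ _).trans (max_le_max_left _ h2)
      rcases le_total (v (ϖ * D g)) 1 with hle | hle
      · rw [max_eq_right hle] at h7
        exact mul_le_one' (pow_le_one' h7 _) hϖγ
      · rw [max_eq_left hle] at h7
        exact le_trans (by gcongr) h3
  have := key (N * e) (fun u hu hu1 => by
    rw [pow_mul, ← mul_pow]
    refine pow_le_one' ?_ _
    rw [map_mul, mul_assoc, mul_comm (v (D u))]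
    exact mul_le_one' h.lt_one.le (hNb u hu hu1.le)) u huE hu
  exact (pow_le_one_iff he.ne').mp this

/-- Logarithmic derivatives have at most a simple pole along `π`. -/
theorem Dominates.mul_dlog_le_one [CharZero A] (h : Dominates (algebraMap A Ω) π v)
    (D : Derivation S Ω Ω) (hD : ∀ a, v (D (algebraMap A Ω a)) ≤ 1) (s : Ω) :
    v (algebraMap A Ω π * dlog D s) ≤ 1 := by
  rcases eq_or_ne s 0 with rfl | hs
  · simp [dlog]
  have : FaithfulSMul A Ω := (faithfulSMul_iff_algebraMap_injective A Ω).mpr h.inj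
  let : Algebra (FractionRing A) Ω := FractionRing.liftAlgebra A Ω
  have : CharZero (FractionRing A) :=
    charZero_of_injective_algebraMap (IsFractionRing.injective A (FractionRing A))
  obtain ⟨c, hc0, hθ⟩ :=
    (Algebra.IsAlgebraic.isAlgebraic (R := A) s).exists_integral_multiple
  set θ := c • s
  have hsE : s ∈ IntermediateField.adjoin (FractionRing A) {θ} := by
    have hc : algebraMap A Ω c ≠ 0 := (map_ne_zero_iff _ h.inj).mpr hc0
    have : s = (algebraMap A Ω c)⁻¹ * θ := by
      rw [show θ = algebraMap A Ω c * s from Algebra.smul_def c s, inv_mul_cancel_left₀ hc]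
    rw [this, IsScalarTower.algebraMap_apply A (FractionRing A) Ω]
    exact mul_mem (inv_mem (IntermediateField.algebraMap_mem _ _))
      (IntermediateField.mem_adjoin_simple_self _ _)
  obtain ⟨e, he, heE⟩ := h.exists_uniform_exponent (FractionRing A) hθ
  obtain ⟨a, ha⟩ := heE s hsE hs
  have hϖa : algebraMap A Ω π ^ a ≠ 0 := zpow_ne_zero _ h.ne_zero
  set u := s ^ e / algebraMap A Ω π ^ a
  have hu : v u = 1 := by
    simp only [u, map_div₀, map_pow, map_zpow₀, ha]
    exact div_self (zpow_ne_zero _ h.v_ne_zero)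
  have hu0 : u ≠ 0 := div_ne_zero (pow_ne_zero _ hs) hϖa
  refine h.mul_dlog_le_of_pow_eq hN D hD hu0 he.ne' (mul_div_cancel₀ _ hϖa).symm le_rfl ?_
  rw [dlog, ← mul_div_assoc, map_div₀, hu, div_one]
  refine Dominates.mul_derivation_unit_le_one (FractionRing A) hN h D hD hθ ?_ hu
  refine div_mem (pow_mem hsE _) (zpow_mem ?_ _)
  rw [IsScalarTower.algebraMap_apply A (FractionRing A) Ω]
  exact IntermediateField.algebraMap_mem _ _

theorem Dominates.mul_derivation_lt_one [CharZero A] (h : Dominates (algebraMap A Ω) π v)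
    (D : Derivation S Ω Ω) (hD : ∀ a, v (D (algebraMap A Ω a)) ≤ 1) {u : Ω} (hu : v u ≤ 1) :
    v (algebraMap A Ω π * D u) < 1 := by
  obtain ⟨p, hp, hp0⟩ := exists_poly_eval₂_eq_zero A u
  obtain ⟨q, hq, hq'⟩ := h.exists_simple_residual_root hN hu hp hp0
  obtain ⟨r, hr, hr1⟩ := derivation_eval₂ D hD hu q
  set g := q.eval₂ (algebraMap A Ω) u with hg
  have h1 : v (algebraMap A Ω π * D u) = v (algebraMap A Ω π * D g - algebraMap A Ω π * r) := by
    rw [hr, mul_add, add_sub_cancel_left, mul_left_comm, map_mul _ (eval₂ _ _ _), hq', one_mul]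
  rw [h1]
  refine v.map_sub_lt ?_ ?_
  · rcases eq_or_ne g 0 with hg0 | hg0
    · simp [hg0]
    have h5 : algebraMap A Ω π * D g = g * (algebraMap A Ω π * dlog D g) := by
      rw [dlog, mul_left_comm, mul_div_cancel₀ _ hg0]
    rw [h5, map_mul]
    exact mul_lt_one_of_lt_of_le hq (h.mul_dlog_le_one hN D hD g)
  · rw [map_mul]
    exact mul_lt_one_of_lt_of_le h.lt_one hr1

end Tame

section TameHom

variable {A Ω Γ : Type*} [CommRing A] [IsDomain A] [UniqueFactorizationMonoid A] [CharZero A]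
  [Field Ω] [LinearOrderedCommGroupWithZero Γ]
  {S : Type*} [CommRing S] [Algebra S Ω] {π : A} {v : Valuation Ω Γ} {φ : A →+* Ω}

/-- Logarithmic derivatives have at most a simple pole along `π`. -/
theorem Dominates.mul_dlog_le (hN : ∀ n : ℕ, n ≠ 0 → ¬ π ∣ (n : A)) (h : Dominates φ π v)
    (hφ : ∀ t : Ω, ∃ p : A[X], p ≠ 0 ∧ p.eval₂ φ t = 0)
    (D : Derivation S Ω Ω) (hD : ∀ a, v (D (φ a)) ≤ 1) (s : Ω) :
    v (φ π * dlog D s) ≤ 1 := by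
  let := φ.toAlgebra
  have : Algebra.IsAlgebraic A Ω := ⟨hφ⟩
  exact Dominates.mul_dlog_le_one (A := A) hN h D hD s

/-- A derivation maps units to elements with less than a simple pole along `π`. -/
theorem Dominates.mul_derivation_lt (hN : ∀ n : ℕ, n ≠ 0 → ¬ π ∣ (n : A)) (h : Dominates φ π v)
    (hφ : ∀ t : Ω, ∃ p : A[X], p ≠ 0 ∧ p.eval₂ φ t = 0)
    (D : Derivation S Ω Ω) (hD : ∀ a, v (D (φ a)) ≤ 1) {u : Ω} (hu : v u ≤ 1) :
    v (φ π * D u) < 1 := by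
  let := φ.toAlgebra
  have : Algebra.IsAlgebraic A Ω := ⟨hφ⟩
  exact Dominates.mul_derivation_lt_one (A := A) hN h D hD hu

end TameHom
section Line

variable {K Ω Γ : Type*} [Field K] [Field Ω] [Algebra K Ω] [LinearOrderedCommGroupWithZero Γ]
  {n : ℕ} {v : Valuation Ω Γ}

theorem aeval_le_one (hK : ∀ c : K, v (algebraMap K Ω c) ≤ 1) {z : Fin n → Ω}
    (hz : ∀ i, v (z i) ≤ 1) (p : MvPolynomial (Fin n) K) : v (MvPolynomial.aeval z p) ≤ 1 := by
  induction p using MvPolynomial.induction_on with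
  | C a => simpa using hK a
  | add p q hp hq => rw [map_add]; exact v.map_add_le hp hq
  | mul_X p i hp => rw [map_mul, MvPolynomial.aeval_X, map_mul]; exact mul_le_one' hp (hz i)

theorem mul_sub_mul_lt_one {a b c d : Ω} (ha : v a ≤ 1) (hd : v d ≤ 1) (hac : v (a - c) < 1)
    (hbd : v (b - d) < 1) : v (a * b - c * d) < 1 := by
  have : a * b - c * d = a * (b - d) + (a - c) * d := by ring
  rw [this]
  refine v.map_add_lt ?_ ?_
  · rw [map_mul, mul_comm]; exact mul_lt_one_of_lt_of_le hbd ha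
  · rw [map_mul]; exact mul_lt_one_of_lt_of_le hac hd

theorem aeval_sub_aeval_lt_one (hK : ∀ c : K, v (algebraMap K Ω c) ≤ 1) {z z' : Fin n → Ω}
    (hz : ∀ i, v (z i) ≤ 1) (hz' : ∀ i, v (z' i) ≤ 1) (h : ∀ i, v (z i - z' i) < 1)
    (p : MvPolynomial (Fin n) K) :
    v (MvPolynomial.aeval z p - MvPolynomial.aeval z' p) < 1 := by
  induction p using MvPolynomial.induction_on with
  | C a => simp
  | add p q hp hq => rw [map_add, map_add, add_sub_add_comm]; exact v.map_add_lt hp hq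
  | mul_X p i hp =>
    rw [map_mul, map_mul, MvPolynomial.aeval_X, MvPolynomial.aeval_X]
    exact mul_sub_mul_lt_one (aeval_le_one hK hz p) (hz' i) hp (h i)

theorem aeval_smul_of_isHomogeneous {p : MvPolynomial (Fin n) K} {k : ℕ} (hp : p.IsHomogeneous k)
    (s : Ω) (z : Fin n → Ω) :
    MvPolynomial.aeval (fun i => s * z i) p = s ^ k * MvPolynomial.aeval z p := by
  rw [MvPolynomial.aeval_def, MvPolynomial.aeval_def, MvPolynomial.eval₂_eq',
    MvPolynomial.eval₂_eq', Finset.mul_sum]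
  refine Finset.sum_congr rfl fun d hd => ?_
  have hk : ∑ i, d i = k := by
    rw [← Finsupp.degree_eq_sum, hp.degree_eq_sum_deg_support hd]
    rfl
  simp_rw [mul_pow, Finset.prod_mul_distrib, Finset.prod_pow_eq_pow_sum, hk]
  ring

/-- The homogeneous component of top degree. -/
noncomputable def leadingForm (h : MvPolynomial (Fin n) K) : MvPolynomial (Fin n) K :=
  MvPolynomial.homogeneousComponent h.totalDegree h

theorem exists_eval_leadingForm_ne_zero [Infinite K] {h : MvPolynomial (Fin n) K} (hh : h ≠ 0) :
    ∃ u : Fin n → K, MvPolynomial.eval u (leadingForm h) ≠ 0 := by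
  by_contra! H
  have h0 : leadingForm h = 0 := MvPolynomial.funext fun u => by rw [H u, map_zero]
  obtain ⟨d, hd, hdeg⟩ := Finset.exists_mem_eq_sup h.support
    (MvPolynomial.support_nonempty.mpr hh) fun s => s.sum fun _ e => e
  have h1 := congrArg (MvPolynomial.coeff d) h0
  rw [leadingForm, MvPolynomial.coeff_homogeneousComponent, if_pos, MvPolynomial.coeff_zero] at h1
  · exact MvPolynomial.mem_support_iff.mp hd h1
  · rw [MvPolynomial.totalDegree, hdeg, Finsupp.degree, Finsupp.sum]; rfl

/-- The restriction of a polynomial to the line through `x` with direction `u`. -/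
noncomputable def lineHom (x : Fin n → Ω) (u : Fin n → K) :
    MvPolynomial (Fin n) K →ₐ[K] Polynomial Ω :=
  MvPolynomial.aeval fun i => C (algebraMap K Ω (u i)) * X + C (x i)

/-- The point of parameter `s` on the line through `x` with direction `u`. -/
def linePoint (x : Fin n → Ω) (u : Fin n → K) (s : Ω) : Fin n → Ω :=
  fun i => algebraMap K Ω (u i) * s + x i

theorem eval_lineHom (x : Fin n → Ω) (u : Fin n → K) (h : MvPolynomial (Fin n) K) (s : Ω) :
    (lineHom x u h).eval s = MvPolynomial.aeval (linePoint x u s) h := by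
  have : ((Polynomial.aeval (R := Ω) s).restrictScalars K).comp (lineHom x u) =
      MvPolynomial.aeval (linePoint x u s) := by
    ext i
    simp [lineHom, linePoint]
  rw [← this]
  simp

@[simp] theorem linePoint_zero (x : Fin n → Ω) (u : Fin n → K) : linePoint x u 0 = x := by
  ext i; simp [linePoint]

theorem prod_linear (x u : Fin n → Ω) (d : Fin n → ℕ) (t : Finset (Fin n)) :
    (∏ i ∈ t, (C (u i) * X + C (x i)) ^ d i).natDegree ≤ ∑ i ∈ t, d i ∧
      (∏ i ∈ t, (C (u i) * X + C (x i)) ^ d i).coeff (∑ i ∈ t, d i) = ∏ i ∈ t, u i ^ d i := by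
  induction t using Finset.induction_on with
  | empty => simp
  | insert i t hi ih =>
    have hlin : (C (u i) * X + C (x i)).natDegree ≤ 1 := natDegree_linear_le
    have h1 : ((C (u i) * X + C (x i)) ^ d i).natDegree ≤ d i := by
      simpa using natDegree_pow_le_of_le (d i) hlin
    rw [Finset.prod_insert hi, Finset.sum_insert hi, Finset.prod_insert hi]
    refine ⟨natDegree_mul_le_of_le h1 ih.1, ?_⟩
    rw [coeff_mul_add_eq_of_natDegree_le h1 ih.1, ih.2]
    congr 1
    have := coeff_pow_of_natDegree_le (m := d i) hlin
    rw [mul_one] at this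
    simpa using this

theorem lineHom_eq_sum (x : Fin n → Ω) (u : Fin n → K) (h : MvPolynomial (Fin n) K) :
    lineHom x u h = ∑ d ∈ h.support, C (algebraMap K Ω (h.coeff d)) *
      ∏ i, (C (algebraMap K Ω (u i)) * X + C (x i)) ^ d i := by
  rw [lineHom, MvPolynomial.aeval_def, MvPolynomial.eval₂_eq']
  rfl

theorem natDegree_lineHom_le (x : Fin n → Ω) (u : Fin n → K) (h : MvPolynomial (Fin n) K) :
    (lineHom x u h).natDegree ≤ h.totalDegree := by
  rw [lineHom_eq_sum]
  refine natDegree_sum_le_of_forall_le _ _ fun d hd => (natDegree_C_mul_le _ _).trans ?_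
  refine (prod_linear x _ d _).1.trans ?_
  have := MvPolynomial.le_totalDegree hd
  rwa [Finsupp.sum_fintype _ _ fun _ => rfl] at this

theorem coeff_lineHom_totalDegree (x : Fin n → Ω) (u : Fin n → K) (h : MvPolynomial (Fin n) K) :
    (lineHom x u h).coeff h.totalDegree =
      algebraMap K Ω (MvPolynomial.eval u (leadingForm h)) := by
  rw [lineHom_eq_sum, finsetSum_coeff, leadingForm, MvPolynomial.eval_eq',
    MvPolynomial.support_homogeneousComponent, Finset.sum_filter, map_sum]
  refine Finset.sum_congr rfl fun d hd => ?_
  have hle := MvPolynomial.le_totalDegree hd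
  rw [Finsupp.sum_fintype _ _ fun _ => rfl] at hle
  rw [Finsupp.degree_eq_sum, coeff_C_mul]
  obtain ⟨h1, h2⟩ := prod_linear x (fun i => algebraMap K Ω (u i)) d Finset.univ
  split_ifs with hd'
  · rw [← hd', h2, MvPolynomial.coeff_homogeneousComponent, if_pos (Finsupp.degree_eq_sum d)]
    simp
  · rw [coeff_eq_zero_of_natDegree_lt (h1.trans_lt (lt_of_le_of_ne hle hd')), mul_zero, map_zero]

variable {x : Fin n → Ω} {u : Fin n → K} {h : MvPolynomial (Fin n) K}

theorem leadingCoeff_lineHom (hu : MvPolynomial.eval u (leadingForm h) ≠ 0) :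
    (lineHom x u h).leadingCoeff = algebraMap K Ω (MvPolynomial.eval u (leadingForm h)) := by
  rw [← coeff_lineHom_totalDegree x, leadingCoeff]
  congr 1
  refine le_antisymm (natDegree_lineHom_le x u h) (le_natDegree_of_ne_zero ?_)
  rw [coeff_lineHom_totalDegree]
  simpa using hu

theorem lineHom_ne_zero (hu : MvPolynomial.eval u (leadingForm h) ≠ 0) : lineHom x u h ≠ 0 := by
  rw [← leadingCoeff_ne_zero, leadingCoeff_lineHom hu]
  simpa using hu

theorem aeval_eq_prod_roots_lineHom [IsAlgClosed Ω]
    (hu : MvPolynomial.eval u (leadingForm h) ≠ 0) :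
    MvPolynomial.aeval x h = algebraMap K Ω (MvPolynomial.eval u (leadingForm h)) *
      ((lineHom x u h).roots.map fun s => -s).prod := by
  have h1 := (IsAlgClosed.splits (lineHom x u h)).eq_prod_roots
  have h2 := congrArg (Polynomial.eval 0) h1
  rw [eval_lineHom, linePoint_zero, leadingCoeff_lineHom hu] at h2
  rw [h2, eval_mul, eval_C, eval_multiset_prod, Multiset.map_map]
  simp

theorem valuation_algebraMap_eq_one (hK : ∀ c : K, v (algebraMap K Ω c) ≤ 1) {c : K}
    (hc : c ≠ 0) : v (algebraMap K Ω c) = 1 := by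
  refine le_antisymm (hK c) ?_
  have h1 : v (algebraMap K Ω c) * v (algebraMap K Ω c⁻¹) = 1 := by
    rw [← map_mul, ← map_mul, mul_inv_cancel₀ hc, map_one, map_one]
  by_contra! hlt
  exact (mul_lt_one_of_lt_of_le hlt (hK c⁻¹)).ne h1

theorem valuation_root_lineHom_le (hK : ∀ c : K, v (algebraMap K Ω c) ≤ 1)
    (hu : MvPolynomial.eval u (leadingForm h) ≠ 0) {γ : Γ} (hγ : 1 ≤ γ) (hx : ∀ i, v (x i) ≤ γ)
    {s : Ω} (hs : MvPolynomial.aeval (linePoint x u s) h = 0) : v s ≤ γ := by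
  by_contra! hlt
  have hs1 : 1 < v s := hγ.trans_lt hlt
  have hvs : v s ≠ 0 := (zero_lt_one.trans hs1).ne'
  have hs0 : s ≠ 0 := (v.ne_zero_iff).mp hvs
  set w : Fin n → Ω := fun i => algebraMap K Ω (u i) + x i / s
  have hz : linePoint x u s = fun i => s * w i := by
    ext i
    simp only [linePoint, w]
    field_simp
  have hxs : ∀ i, v (x i / s) < 1 := fun i => by
    rw [map_div₀, div_lt_one₀ (zero_lt_iff.mpr hvs)]
    exact (hx i).trans_lt hlt
  have hw : ∀ i, v (w i) ≤ 1 := fun i => v.map_add_le (hK _) (hxs i).le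
  rw [hz, ← MvPolynomial.sum_homogeneousComponent h, map_sum, Finset.sum_range_succ] at hs
  simp_rw [aeval_smul_of_isHomogeneous (MvPolynomial.homogeneousComponent_isHomogeneous _ _)] at hs
  have h1 : v (MvPolynomial.aeval w (MvPolynomial.homogeneousComponent h.totalDegree h)) = 1 := by
    have h2 := aeval_sub_aeval_lt_one hK hw (z' := fun i => algebraMap K Ω (u i))
      (fun i => hK _) (fun i => by simpa [w] using hxs i)
      (MvPolynomial.homogeneousComponent h.totalDegree h)
    have h3 : MvPolynomial.aeval (fun i => algebraMap K Ω (u i))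
        (MvPolynomial.homogeneousComponent h.totalDegree h) =
        algebraMap K Ω (MvPolynomial.eval u (leadingForm h)) := by
      have := MvPolynomial.aeval_algebraMap_apply Ω u (leadingForm h)
      rw [leadingForm] at this ⊢
      exact this
    rw [h3] at h2
    have h4 := valuation_algebraMap_eq_one hK hu
    rw [← h4]
    exact v.map_eq_of_sub_lt (by rwa [h4])
  have h5 : v (∑ k ∈ Finset.range h.totalDegree,
      s ^ k * MvPolynomial.aeval w (MvPolynomial.homogeneousComponent k h)) <
      v (s ^ h.totalDegree) := by
    refine v.map_sum_lt (by simp [hs0]) fun k hk => ?_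
    rw [map_mul, map_pow, map_pow]
    refine lt_of_le_of_lt (mul_le_of_le_one_right' (aeval_le_one hK hw _)) ?_
    exact pow_lt_pow_right₀ hs1 (Finset.mem_range.mp hk)
  rw [add_eq_zero_iff_eq_neg] at hs
  rw [hs, v.map_neg, map_mul, h1, mul_one] at h5
  exact h5.false

end Line
section Incomparability

theorem eq_of_le_of_comap_eq {A : Type*} [CommRing A] {F : A[X]} (hF : F.Monic)
    {I J : Ideal A[X]} [I.IsPrime] (hIJ : I ≤ J) (hFI : F ∈ I) (hc : J.comap C ≤ I.comap C) :
    I = J := by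
  refine le_antisymm hIJ fun r hr => ?_
  by_contra hrI
  have : Module.Finite A (AdjoinRoot F) := hF.finite_adjoinRoot
  obtain ⟨p, hp, hp0⟩ := Algebra.IsIntegral.isIntegral (R := A) (AdjoinRoot.mk F r)
  have hpI : p.eval₂ C r ∈ I := by
    have h1 : AdjoinRoot.mk F (p.eval₂ C r) = 0 := by
      rw [hom_eval₂]
      exact hp0
    rw [AdjoinRoot.mk_eq_zero] at h1
    exact I.mem_of_dvd h1 hFI
  have hnt : Nontrivial (A ⧸ I.comap C) :=
    Ideal.Quotient.nontrivial_iff.mpr (Ideal.IsPrime.ne_top inferInstance)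
  obtain ⟨i, hi⟩ := Ideal.exists_coeff_mem_comap_sdiff_comap_of_root_mem_sdiff
    (f := (C : A →+* A[X]))
    hIJ ⟨hr, hrI⟩ (p := p) (hp.map _).ne_zero hpI
  exact hi.2 (hc hi.1)

end Incomparability

section Theta

variable {K Ω Γ : Type*} [Field K] [Field Ω] [Algebra K Ω] [LinearOrderedCommGroupWithZero Γ]
  {n : ℕ}

/-- Evaluation of polynomials in `n + 1` variables at a point of affine `(n + 1)`-space. -/
noncomputable def evalPoint (z : Fin n → Ω) (y : Ω) : (MvPolynomial (Fin n) K)[X] →+* Ω :=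
  eval₂RingHom (MvPolynomial.aeval z : MvPolynomial (Fin n) K →ₐ[K] Ω) y

@[simp] theorem evalPoint_C (z : Fin n → Ω) (y : Ω) (p : MvPolynomial (Fin n) K) :
    evalPoint z y (C p) = MvPolynomial.aeval z p := by
  simp [evalPoint]

@[simp] theorem evalPoint_X (z : Fin n → Ω) (y : Ω) :
    evalPoint (K := K) z y X = y := by
  simp [evalPoint]

/-- The fiber over the point `z` of the hypersurface `F = 0`, counted with multiplicity. -/
noncomputable def fiber (F : (MvPolynomial (Fin n) K)[X]) (z : Fin n → Ω) : Multiset Ω :=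
  (F.map ((MvPolynomial.aeval z : MvPolynomial (Fin n) K →ₐ[K] Ω) :
    MvPolynomial (Fin n) K →+* Ω)).roots

variable (K n) in
/-- A prime divisor of a hypersurface in affine `(n + 1)`-space, given by its ideal `I` and the
equation `h` of its image in affine `n`-space, with a direction `u`. -/
structure DivisorDatum where
  h : MvPolynomial (Fin n) K
  I : Ideal (MvPolynomial (Fin n) K)[X]
  u : Fin n → K

open Classical in
/-- The product of the differences of `y` with the points of the fiber over `z` other
than `y₀`. -/
noncomputable def cofactor (F : (MvPolynomial (Fin n) K)[X]) (z : Fin n → Ω) (y₀ : Ω) :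
    Polynomial Ω :=
  (((fiber F z).erase y₀).map fun t => X - C t).prod

open Classical in
/-- The value at `y` of the interpolation polynomial which, on the fiber over the point of
parameter `s`, is the indicator function of the divisor. -/
noncomputable def weight (F : (MvPolynomial (Fin n) K)[X]) (x : Fin n → Ω) (y : Ω)
    (d : DivisorDatum K n) (s : Ω) : Ω :=
  (∑ y₀ ∈ (fiber F (linePoint x d.u s)).toFinset with
    d.I ≤ RingHom.ker (evalPoint (linePoint x d.u s) y₀),
    (cofactor F (linePoint x d.u s) y₀).eval y) / evalPoint x y (derivative F)

/-- The value at a derivation of a differential form with residue one along a divisor. -/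
noncomputable def theta (F : (MvPolynomial (Fin n) K)[X]) (x : Fin n → Ω) (y : Ω)
    (d : DivisorDatum K n) (D : Derivation K Ω Ω) : Ω :=
  ((lineHom x d.u d.h).roots.map fun s => weight F x y d s * dlog D s).sum

variable {F : (MvPolynomial (Fin n) K)[X]} {x : Fin n → Ω} {y : Ω} {d : DivisorDatum K n}

theorem theta_add (D D' : Derivation K Ω Ω) :
    theta F x y d (D + D') = theta F x y d D + theta F x y d D' := by
  simp only [theta, ← Multiset.sum_map_add]
  congr 2
  ext s
  simp [dlog]; ring

theorem theta_smul (c : Ω) (D : Derivation K Ω Ω) :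
    theta F x y d (c • D) = c * theta F x y d D := by
  simp only [theta, ← Multiset.sum_map_mul_left]
  congr 2
  ext s
  simp [dlog]; ring

theorem theta_sum_smul {ι : Type*} (t : Finset ι) (c : ι → Ω) (D : ι → Derivation K Ω Ω) :
    theta F x y d (∑ i ∈ t, c i • D i) = ∑ i ∈ t, c i * theta F x y d (D i) := by
  let f : Derivation K Ω Ω →ₗ[Ω] Ω :=
    { toFun := theta F x y d, map_add' := theta_add, map_smul' := fun c D => theta_smul c D }
  change f _ = ∑ i ∈ t, c i * f (D i)
  simp

/-- Conjugation of derivations by an automorphism. -/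
def conj (σ : Ω ≃ₐ[K] Ω) (D : Derivation K Ω Ω) : Derivation K Ω Ω :=
  Derivation.mk' (σ.toLinearMap ∘ₗ D.toLinearMap ∘ₗ σ.symm.toLinearMap) fun a b => by
    simp

@[simp] theorem conj_apply (σ : Ω ≃ₐ[K] Ω) (D : Derivation K Ω Ω) (t : Ω) :
    conj σ D t = σ (D (σ.symm t)) := rfl

theorem map_dlog (σ : Ω ≃ₐ[K] Ω) (D : Derivation K Ω Ω) (t : Ω) :
    σ (dlog D t) = dlog (conj σ D) (σ t) := by
  simp [dlog]

theorem map_evalPoint (σ : Ω ≃ₐ[K] Ω) (z : Fin n → Ω) (y : Ω)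
    (G : (MvPolynomial (Fin n) K)[X]) :
    σ (evalPoint z y G) = evalPoint (fun i => σ (z i)) (σ y) G := by
  have : (σ : Ω →+* Ω).comp (evalPoint z y) = evalPoint (K := K) (fun i => σ (z i)) (σ y) := by
    ext i <;> simp
  exact RingHom.congr_fun this G

theorem map_linePoint (σ : Ω ≃ₐ[K] Ω) (x : Fin n → Ω) (u : Fin n → K) (s : Ω) :
    (fun i => σ (linePoint x u s i)) = linePoint (fun i => σ (x i)) u (σ s) := by
  ext i
  simp [linePoint]

variable [IsAlgClosed Ω]

theorem roots_map_equiv (σ : Ω ≃ₐ[K] Ω) (p : Polynomial Ω) :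
    (p.map (σ : Ω →+* Ω)).roots = p.roots.map σ :=
  (IsAlgClosed.splits p).roots_map _

theorem map_fiber (σ : Ω ≃ₐ[K] Ω) (z : Fin n → Ω) :
    (fiber F z).map σ = fiber F fun i => σ (z i) := by
  rw [fiber, fiber, ← roots_map_equiv, Polynomial.map_map]
  congr 2
  ext i <;> simp

theorem map_cofactor (σ : Ω ≃ₐ[K] Ω) (z : Fin n → Ω) (y₀ y : Ω) :
    σ ((cofactor F z y₀).eval y) = (cofactor F (fun i => σ (z i)) (σ y₀)).eval (σ y) := by
  classical
  simp only [cofactor, eval_multiset_prod, Multiset.map_map, ← map_fiber σ z]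
  rw [← Multiset.map_erase _ σ.injective, Multiset.map_map, map_multiset_prod, Multiset.map_map]
  simp

theorem map_weight (σ : Ω ≃ₐ[K] Ω) (s : Ω) :
    σ (weight F x y d s) = weight F (fun i => σ (x i)) (σ y) d (σ s) := by
  classical
  simp only [weight, map_div₀, map_sum, map_evalPoint, ← map_linePoint, map_cofactor]
  congr 1
  rw [← map_fiber]
  refine Finset.sum_nbij σ ?_ σ.injective.injOn ?_ fun _ _ => rfl
  · intro y₀
    simp only [Finset.mem_filter, Multiset.mem_toFinset, Multiset.mem_map]
    rintro ⟨h1, h2⟩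
    refine ⟨⟨y₀, h1, rfl⟩, fun G hG => ?_⟩
    have := h2 hG
    rw [RingHom.mem_ker] at this ⊢
    rw [← map_evalPoint, this, map_zero]
  · intro y₀
    simp only [Finset.coe_filter, Multiset.mem_toFinset, Multiset.mem_map, Set.mem_ofPred_eq,
      Set.mem_image]
    rintro ⟨⟨y₁, h1, rfl⟩, h2⟩
    refine ⟨y₁, ⟨h1, fun G hG => ?_⟩, rfl⟩
    have := h2 hG
    rw [RingHom.mem_ker] at this ⊢
    rwa [← map_evalPoint, map_eq_zero_iff _ σ.injective] at this

theorem map_theta (σ : Ω ≃ₐ[K] Ω) (D : Derivation K Ω Ω) :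
    σ (theta F x y d D) = theta F (fun i => σ (x i)) (σ y) d (conj σ D) := by
  have h1 : (lineHom (fun i => σ (x i)) d.u d.h) = (lineHom x d.u d.h).map (σ : Ω →+* Ω) := by
    have : lineHom (fun i => σ (x i)) d.u =
        (Polynomial.mapAlgHom (σ : Ω →ₐ[K] Ω)).comp (lineHom x d.u) := by
      ext i : 1
      simp [lineHom]
    rw [this]
    rfl
  rw [theta, theta, map_multiset_sum, Multiset.map_map, h1, roots_map_equiv, Multiset.map_map]
  simp only [Function.comp_def, map_mul, map_weight, map_dlog]

end Theta
section Bounds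

variable {K Ω Γ : Type*} [Field K] [Field Ω] [Algebra K Ω] [LinearOrderedCommGroupWithZero Γ]
  {n : ℕ} {v : Valuation Ω Γ} {γ : Γ}

theorem aeval_le_pow (hK : ∀ c : K, v (algebraMap K Ω c) ≤ 1) {z : Fin n → Ω} (hγ : 1 ≤ γ)
    (hz : ∀ i, v (z i) ≤ γ) {p : MvPolynomial (Fin n) K} {e : ℕ} (he : p.totalDegree ≤ e) :
    v (MvPolynomial.aeval z p) ≤ γ ^ e := by
  rw [MvPolynomial.aeval_def, MvPolynomial.eval₂_eq']
  refine v.map_sum_le fun d hd => ?_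
  have hle := (MvPolynomial.le_totalDegree hd).trans he
  rw [Finsupp.sum_fintype _ _ fun _ => rfl] at hle
  rw [map_mul, map_prod]
  refine (mul_le_of_le_one_left' (hK _)).trans ?_
  calc ∏ i, v (z i ^ d i) ≤ ∏ i, γ ^ d i := by
        refine Finset.prod_le_prod' fun i _ => ?_
        rw [map_pow]
        exact pow_le_pow_left' (hz i) _
    _ = γ ^ ∑ i, d i := Finset.prod_pow_eq_pow_sum _ _ _
    _ ≤ γ ^ e := pow_le_pow_right' hγ hle

theorem linePoint_le (hK : ∀ c : K, v (algebraMap K Ω c) ≤ 1) {x : Fin n → Ω} {u : Fin n → K}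
    {s : Ω} (hx : ∀ i, v (x i) ≤ γ) (hs : v s ≤ γ) (i : Fin n) : v (linePoint x u s i) ≤ γ := by
  refine v.map_add_le ?_ (hx i)
  rw [map_mul]
  exact (mul_le_of_le_one_left' (hK _)).trans hs

variable {F : (MvPolynomial (Fin n) K)[X]} {x z : Fin n → Ω} {y : Ω} {d : DivisorDatum K n}

theorem mem_fiber (hF : F.Monic) {t : Ω} : t ∈ fiber F z ↔ evalPoint z t F = 0 := by
  rw [fiber, mem_roots (hF.map _).ne_zero, IsRoot, eval_map]
  rfl

theorem valuation_fiber_le (hK : ∀ c : K, v (algebraMap K Ω c) ≤ 1) (hF : F.Monic) {e : ℕ}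
    (he : ∀ i, (F.coeff i).totalDegree ≤ e) (hγ : 1 ≤ γ) (hz : ∀ i, v (z i) ≤ γ) {t : Ω}
    (ht : t ∈ fiber F z) : v t ≤ γ ^ e := by
  rw [mem_fiber hF] at ht
  exact le_of_monic_eval₂_eq_zero hF ht (one_le_pow_of_one_le' hγ e)
    fun i => aeval_le_pow hK hγ hz (he i)

theorem valuation_cofactor_le (hγ : 1 ≤ γ) (hz : ∀ t ∈ fiber F z, v t ≤ γ)
    (hy : v y ≤ γ) (y₀ : Ω) : v ((cofactor F z y₀).eval y) ≤ γ ^ F.natDegree := by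
  classical
  rw [cofactor, eval_multiset_prod, map_multiset_prod, Multiset.map_map, Multiset.map_map]
  refine (Multiset.prod_le_pow_card _ γ ?_).trans (pow_le_pow_right' hγ ?_)
  · intro a ha
    obtain ⟨t, ht, rfl⟩ := Multiset.mem_map.mp ha
    simp only [Function.comp_apply, eval_sub, eval_X, eval_C]
    exact v.map_sub_le hy (hz t (Multiset.mem_of_mem_erase ht))
  · rw [Multiset.card_map]
    refine (Multiset.card_le_card (Multiset.erase_le _ _)).trans ?_
    refine (card_roots' _).trans (natDegree_map_le)

theorem valuation_weight_le (hK : ∀ c : K, v (algebraMap K Ω c) ≤ 1) (hF : F.Monic) {e : ℕ}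
    (he : ∀ i, (F.coeff i).totalDegree ≤ e) (hγ : 1 ≤ γ) (hx : ∀ i, v (x i) ≤ γ) (hy : v y ≤ γ)
    (hFy : v (evalPoint x y (derivative F))⁻¹ ≤ γ) {s : Ω} (hs : v s ≤ γ) :
    v (weight F x y d s) ≤ γ ^ ((e + 1) * F.natDegree + 1) := by
  have hγe : γ ^ e ≤ γ ^ (e + 1) := pow_le_pow_right' hγ (Nat.le_succ e)
  have hγ1 : γ ≤ γ ^ (e + 1) := le_self_pow hγ (Nat.succ_ne_zero e)
  rw [weight, div_eq_mul_inv, map_mul, pow_succ, pow_mul]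
  refine mul_le_mul' (v.map_sum_le fun y₀ hy₀ => ?_) hFy
  exact valuation_cofactor_le (one_le_pow_of_one_le' hγ _) (fun t ht =>
    (valuation_fiber_le hK hF he hγ (linePoint_le hK hx hs) ht).trans hγe) (hy.trans hγ1) y₀

/-- The derivation `ϖ D` has tame behaviour along the valuation `v`. -/
structure Tame (v : Valuation Ω Γ) (D : Derivation K Ω Ω) (ϖ : Ω) : Prop where
  dlog_le : ∀ s, v (ϖ * dlog D s) ≤ 1
  apply_lt : ∀ s, v s ≤ 1 → v (ϖ * D s) < 1

theorem map_multiset_sum_le {ι : Type*} (m : Multiset ι) (f : ι → Ω) (h : ∀ i ∈ m, v (f i) ≤ γ) :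
    v (m.map f).sum ≤ γ := by
  induction m using Multiset.induction_on with
  | empty => simp
  | cons a m ih =>
    rw [Multiset.map_cons, Multiset.sum_cons]
    exact v.map_add_le (h a (Multiset.mem_cons_self _ _)) (ih fun i hi =>
      h i (Multiset.mem_cons_of_mem hi))

theorem map_multiset_sum_lt {ι : Type*} (m : Multiset ι) (f : ι → Ω) (h : ∀ i ∈ m, v (f i) < 1) :
    v (m.map f).sum < 1 := by
  induction m using Multiset.induction_on with
  | empty => simp
  | cons a m ih =>
    rw [Multiset.map_cons, Multiset.sum_cons]
    exact v.map_add_lt (h a (Multiset.mem_cons_self _ _)) (ih fun i hi =>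
      h i (Multiset.mem_cons_of_mem hi))

theorem valuation_theta_le (hK : ∀ c : K, v (algebraMap K Ω c) ≤ 1) (hF : F.Monic) {e : ℕ}
    (he : ∀ i, (F.coeff i).totalDegree ≤ e) (hγ : 1 ≤ γ) (hx : ∀ i, v (x i) ≤ γ) (hy : v y ≤ γ)
    (hFy : v (evalPoint x y (derivative F))⁻¹ ≤ γ)
    (hu : MvPolynomial.eval d.u (leadingForm d.h) ≠ 0) {D : Derivation K Ω Ω} {ϖ : Ω}
    (hD : ∀ s, v (ϖ * dlog D s) ≤ 1) :
    v (ϖ * theta F x y d D) ≤ γ ^ ((e + 1) * F.natDegree + 1) := by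
  rw [theta, ← Multiset.sum_map_mul_left]
  refine map_multiset_sum_le _ _ fun s hs => ?_
  rw [mul_left_comm, map_mul]
  rw [mem_roots (lineHom_ne_zero hu), IsRoot, eval_lineHom] at hs
  rw [← mul_one (γ ^ _)]
  exact mul_le_mul' (valuation_weight_le hK hF he hγ hx hy hFy
    (valuation_root_lineHom_le hK hu hγ hx hs)) (hD s)

end Bounds

section Residue

variable {K Ω Γ : Type*} [Field K] [Field Ω] [Algebra K Ω] [LinearOrderedCommGroupWithZero Γ]
  {n : ℕ} {v : Valuation Ω Γ}

theorem evalPoint_le_one (hK : ∀ c : K, v (algebraMap K Ω c) ≤ 1) {z : Fin n → Ω} {y : Ω}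
    (hz : ∀ i, v (z i) ≤ 1) (hy : v y ≤ 1) (G : (MvPolynomial (Fin n) K)[X]) :
    v (evalPoint z y G) ≤ 1 :=
  eval₂_le_one (fun p => aeval_le_one hK hz p) hy G

theorem evalPoint_sub_lt_one (hK : ∀ c : K, v (algebraMap K Ω c) ≤ 1) {z z' : Fin n → Ω}
    {y y' : Ω} (hz : ∀ i, v (z i) ≤ 1) (hz' : ∀ i, v (z' i) ≤ 1) (h : ∀ i, v (z i - z' i) < 1)
    (hy : v y ≤ 1) (hy' : v y' ≤ 1) (hyy : v (y - y') < 1)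
    (G : (MvPolynomial (Fin n) K)[X]) : v (evalPoint z y G - evalPoint z' y' G) < 1 := by
  induction G using Polynomial.induction_on with
  | C p => simpa using aeval_sub_aeval_lt_one hK hz hz' h p
  | add p q hp hq => rw [map_add, map_add, add_sub_add_comm]; exact v.map_add_lt hp hq
  | monomial k a ih =>
    rw [pow_succ, ← mul_assoc, map_mul, map_mul _ _ X, evalPoint_X, evalPoint_X]
    exact mul_sub_mul_lt_one (evalPoint_le_one hK hz hy _) hy' ih hyy

/-- The center on affine `(n + 1)`-space of the valuation `v`. -/
noncomputable def center (v : Valuation Ω Γ) (z : Fin n → Ω) (y : Ω)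
    (hK : ∀ c : K, v (algebraMap K Ω c) ≤ 1) (hz : ∀ i, v (z i) ≤ 1) (hy : v y ≤ 1) :
    Ideal (MvPolynomial (Fin n) K)[X] where
  carrier := {G | v (evalPoint z y G) < 1}
  zero_mem' := by simp
  add_mem' := fun ha hb => by
    simp only [Set.mem_ofPred_eq, map_add] at *
    exact v.map_add_lt ha hb
  smul_mem' := fun c G hG => by
    simp only [Set.mem_ofPred_eq, smul_eq_mul, map_mul] at *
    rw [mul_comm]
    exact mul_lt_one_of_lt_of_le hG (evalPoint_le_one hK hz hy c)

variable {F : (MvPolynomial (Fin n) K)[X]} {x : Fin n → Ω} {y : Ω} {d : DivisorDatum K n}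

theorem mem_center {hK : ∀ c : K, v (algebraMap K Ω c) ≤ 1} {hx : ∀ i, v (x i) ≤ 1} {hy : v y ≤ 1}
    {G : (MvPolynomial (Fin n) K)[X]} : G ∈ center v x y hK hx hy ↔ v (evalPoint x y G) < 1 :=
  Iff.rfl

/-- A prime divisor of the hypersurface `F = 0`, finite over a prime divisor `h = 0` of affine
`n`-space transversal at infinity to `u`. -/
structure DivisorDatum.Valid (F : (MvPolynomial (Fin n) K)[X]) (d : DivisorDatum K n) : Prop where
  prime : Prime d.h
  isPrime : d.I.IsPrime
  mem : F ∈ d.I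
  comap_eq : d.I.comap C = Ideal.span {d.h}
  direction : MvPolynomial.eval d.u (leadingForm d.h) ≠ 0

variable [IsAlgClosed Ω]

theorem prod_fiber (hF : F.Monic) (z : Fin n → Ω) :
    F.map ((MvPolynomial.aeval z : MvPolynomial (Fin n) K →ₐ[K] Ω) :
    MvPolynomial (Fin n) K →+* Ω) = ((fiber F z).map fun t => X - C t).prod := by
  have := (IsAlgClosed.splits (F.map ((MvPolynomial.aeval z : MvPolynomial (Fin n) K →ₐ[K] Ω) :
    MvPolynomial (Fin n) K →+* Ω))).eq_prod_roots
  rwa [(hF.map _).leadingCoeff, C_1, one_mul] at this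

theorem mul_cofactor (hF : F.Monic) {z : Fin n → Ω} {y₀ : Ω} (hy₀ : y₀ ∈ fiber F z) :
    F.map ((MvPolynomial.aeval z : MvPolynomial (Fin n) K →ₐ[K] Ω) :
      MvPolynomial (Fin n) K →+* Ω) = (X - C y₀) * cofactor F z y₀ := by
  classical
  rw [prod_fiber hF, cofactor, ← Multiset.prod_cons, ← Multiset.map_cons (fun t => X - C t),
    Multiset.cons_erase hy₀]

theorem evalPoint_eq_mul_cofactor (hF : F.Monic) {z : Fin n → Ω} {y₀ : Ω} (hy₀ : y₀ ∈ fiber F z)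
    (y : Ω) : evalPoint z y F = (y - y₀) * (cofactor F z y₀).eval y := by
  have := congrArg (eval y) (mul_cofactor hF hy₀)
  rw [eval_map, eval_mul, eval_sub, eval_X, eval_C] at this
  exact this

theorem evalPoint_derivative (hF : F.Monic) {z : Fin n → Ω} {y₀ : Ω} (hy₀ : y₀ ∈ fiber F z) :
    evalPoint z y₀ (derivative F) = (cofactor F z y₀).eval y₀ := by
  have := congrArg (fun p => eval y₀ (derivative p)) (mul_cofactor hF hy₀)
  simp only [derivative_map, eval_map, derivative_mul] at this
  simp at this
  exact this

omit [IsAlgClosed Ω] in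
theorem cofactor_sub_lt_one {z : Fin n → Ω} {y y' y₀ : Ω} (hy : v y ≤ 1) (hy' : v y' ≤ 1)
    (hyy : v (y - y') < 1) (hz : ∀ t ∈ fiber F z, v t ≤ 1) :
    v ((cofactor F z y₀).eval y - (cofactor F z y₀).eval y') < 1 := by
  classical
  have hz' : ∀ t ∈ (fiber F z).erase y₀, v t ≤ 1 := fun t ht => hz t (Multiset.mem_of_mem_erase ht)
  simp only [cofactor, eval_multiset_prod, Multiset.map_map, Function.comp_def, eval_sub, eval_X,
    eval_C]
  generalize (fiber F z).erase y₀ = m at hz'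
  have hle : ∀ m : Multiset Ω, (∀ t ∈ m, v t ≤ 1) → v (m.map fun t => y' - t).prod ≤ 1 := by
    intro m hm
    rw [map_multiset_prod, Multiset.map_map]
    refine (Multiset.prod_le_pow_card _ 1 ?_).trans (one_pow _).le
    intro a ha
    obtain ⟨t, ht, rfl⟩ := Multiset.mem_map.mp ha
    exact v.map_sub_le hy' (hm t ht)
  induction m using Multiset.induction_on with
  | empty => simp
  | cons a m ih =>
    rw [Multiset.forall_mem_cons] at hz'
    simp only [Multiset.map_cons, Multiset.prod_cons]
    refine mul_sub_mul_lt_one (v.map_sub_le hy hz'.1) (hle m hz'.2) ?_ (ih hz'.2)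
    rwa [sub_sub_sub_cancel_right]

section Specialization

variable (hK : ∀ c : K, v (algebraMap K Ω c) ≤ 1) (hF : F.Monic) (hx : ∀ i, v (x i) ≤ 1)
  (hy : v y ≤ 1) (hroot : evalPoint x y F = 0) (hFy : v (evalPoint x y (derivative F)) = 1)
  {z : Fin n → Ω} (hz : ∀ i, v (z i) ≤ 1) (hzx : ∀ i, v (z i - x i) < 1)

include hK hF hz in
omit [IsAlgClosed Ω] in
theorem valuation_fiber_le_one {t : Ω} (ht : t ∈ fiber F z) : v t ≤ 1 := by
  have := valuation_fiber_le (e := F.support.sup fun i => (F.coeff i).totalDegree) hK hF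
    (fun i => ?_) le_rfl hz ht
  · rwa [one_pow] at this
  · by_cases hi : i ∈ F.support
    · exact Finset.le_sup (f := fun i => (F.coeff i).totalDegree) hi
    · rw [notMem_support_iff.mp hi]; simp

include hK hx hy hz hzx hroot in
omit [IsAlgClosed Ω] in
theorem evalPoint_lt_one : v (evalPoint z y F) < 1 := by
  have := evalPoint_sub_lt_one hK hz hx hzx hy hy (by simp) F
  rwa [hroot, sub_zero] at this

include hK hF hx hy hz hzx in
theorem cofactor_near {t : Ω} (ht : t ∈ fiber F z) (hyt : v (y - t) < 1) :
    v ((cofactor F z t).eval y - evalPoint x y (derivative F)) < 1 := by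
  have ht1 := valuation_fiber_le_one hK hF hz ht
  have h1 := cofactor_sub_lt_one (y₀ := t) hy ht1 hyt fun t ht => valuation_fiber_le_one hK hF hz ht
  have h2 := evalPoint_sub_lt_one hK hz hx hzx ht1 hy (by rwa [v.map_sub_swap]) (derivative F)
  rw [evalPoint_derivative hF ht] at h2
  rw [← sub_add_sub_cancel]
  exact v.map_add_lt h1 h2

include hK hF hx hy hz hzx hroot in
theorem cofactor_far {t : Ω} (ht : t ∈ fiber F z) (hyt : ¬ v (y - t) < 1) :
    v ((cofactor F z t).eval y) < 1 := by
  have h1 := evalPoint_lt_one hK hx hy hroot hz hzx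
  have h2 : v (y - t) = 1 := le_antisymm
    (v.map_sub_le hy (valuation_fiber_le_one hK hF hz ht)) (not_lt.mp hyt)
  rwa [evalPoint_eq_mul_cofactor hF ht, map_mul, h2, one_mul] at h1

include hK hF hx hy hz hzx hroot in
theorem exists_near : ∃ t ∈ fiber F z, v (y - t) < 1 := by
  by_contra! H
  have h1 := evalPoint_lt_one hK hx hy hroot hz hzx
  have h2 : evalPoint z y F = ((fiber F z).map fun t => y - t).prod := by
    have := congrArg (eval y) (prod_fiber hF z)
    rw [eval_map, eval_multiset_prod, Multiset.map_map] at this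
    simp at this
    exact this
  rw [h2, map_multiset_prod, Multiset.map_map] at h1
  refine h1.ne (Multiset.prod_eq_one fun a ha => ?_)
  obtain ⟨t, ht, rfl⟩ := Multiset.mem_map.mp ha
  exact le_antisymm (v.map_sub_le hy (valuation_fiber_le_one hK hF hz ht)) (H t ht)

include hK hF hx hy hz hzx hFy in
theorem near_unique {t t' : Ω} (ht : t ∈ fiber F z) (ht' : t' ∈ fiber F z) (hyt : v (y - t) < 1)
    (hyt' : v (y - t') < 1) : t' = t := by
  classical
  by_contra hne
  have h1 := cofactor_near hK hF hx hy hz hzx ht hyt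
  have hmem : t' ∈ (fiber F z).erase t := (Multiset.mem_erase_of_ne hne).mpr ht'
  have h2 : v ((cofactor F z t).eval y) < 1 := by
    rw [cofactor, eval_multiset_prod, Multiset.map_map, ← Multiset.cons_erase hmem,
      Multiset.map_cons, Multiset.prod_cons, map_mul]
    refine mul_lt_one_of_lt_of_le (by simpa using hyt') ?_
    rw [map_multiset_prod, Multiset.map_map]
    refine (Multiset.prod_le_pow_card _ 1 ?_).trans (one_pow _).le
    intro a ha
    obtain ⟨s, hs, rfl⟩ := Multiset.mem_map.mp ha
    simp only [Function.comp_apply, eval_sub, eval_X, eval_C]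
    exact v.map_sub_le hy (valuation_fiber_le_one hK hF hz
      (Multiset.mem_of_mem_erase (Multiset.mem_of_mem_erase hs)))
  rw [v.map_sub_swap] at h1
  have h3 := v.map_add_lt h1 h2
  rw [sub_add_cancel, hFy] at h3
  exact h3.false

include hK hx hy hz hzx in
omit [IsAlgClosed Ω] in
theorem ker_le_center {t : Ω} (ht : v t ≤ 1) (hyt : v (y - t) < 1) :
    RingHom.ker (evalPoint (K := K) z t) ≤ center v x y hK hx hy := by
  intro G hG
  rw [RingHom.mem_ker] at hG
  have := evalPoint_sub_lt_one hK hz hx hzx ht hy (by rwa [v.map_sub_swap]) G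
  rwa [hG, zero_sub, v.map_neg] at this

end Specialization

section

variable (hK : ∀ c : K, v (algebraMap K Ω c) ≤ 1) (hF : F.Monic) (hx : ∀ i, v (x i) ≤ 1)
  (hy : v y ≤ 1) (hroot : evalPoint x y F = 0) (hFy : v (evalPoint x y (derivative F)) = 1)
  (hd : d.Valid F) {s : Ω}
include hK hF hroot hFy hd

theorem weight_sub_one_lt_one (hs : v s < 1)
    (h0 : MvPolynomial.aeval (linePoint x d.u s) d.h = 0) (hc : d.I = center v x y hK hx hy) :
    v (weight F x y d s - 1) < 1 := by
  classical
  set z := linePoint x d.u s with hzdef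
  have hz : ∀ i, v (z i) ≤ 1 := linePoint_le hK hx hs.le
  have hzx : ∀ i, v (z i - x i) < 1 := fun i => by
    simp only [hzdef, linePoint, add_sub_cancel_right, map_mul]
    rw [mul_comm]
    exact mul_lt_one_of_lt_of_le hs (hK _)
  have hFy0 : evalPoint x y (derivative F) ≠ 0 := fun h => by simp [h] at hFy
  obtain ⟨t, ht, hyt⟩ := exists_near hK hF hx hy hroot hz hzx
  have ht1 := valuation_fiber_le_one hK hF hz ht
  have hmem : t ∈ (fiber F z).toFinset.filter
      fun y₀ => d.I ≤ RingHom.ker (evalPoint z y₀) := by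
    rw [Finset.mem_filter, Multiset.mem_toFinset]
    refine ⟨ht, (Eq.symm ?_).le⟩
    have : (RingHom.ker (evalPoint (K := K) z t)).IsPrime := RingHom.ker_isPrime _
    refine eq_of_le_of_comap_eq hF (hc ▸ ker_le_center hK hx hy hz hzx ht1 hyt) ?_ ?_
    · exact (mem_fiber hF).mp ht
    · rw [hd.comap_eq, Ideal.span_singleton_le_iff_mem, Ideal.mem_comap, RingHom.mem_ker,
        evalPoint_C, h0]
  have h1 : weight F x y d s - 1 = (∑ y₀ ∈ ((fiber F z).toFinset.filter
      fun y₀ => d.I ≤ RingHom.ker (evalPoint z y₀)).erase t, (cofactor F z y₀).eval y +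
      ((cofactor F z t).eval y - evalPoint x y (derivative F))) /
      evalPoint x y (derivative F) := by
    rw [weight, ← hzdef, ← Finset.sum_erase_add _ _ hmem]
    field_simp
    ring
  rw [h1, map_div₀, hFy, div_one]
  refine v.map_add_lt (v.map_sum_lt one_ne_zero fun y₀ hy₀ => ?_)
    (cofactor_near hK hF hx hy hz hzx ht hyt)
  rw [Finset.mem_erase, Finset.mem_filter, Multiset.mem_toFinset] at hy₀
  exact cofactor_far hK hF hx hy hroot hz hzx hy₀.2.1 fun hlt =>
    hy₀.1 (near_unique hK hF hx hy hFy hz hzx ht hy₀.2.1 hyt hlt)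

theorem weight_lt_one (hs : v s < 1) {h' : MvPolynomial (Fin n) K} (hh' : Prime h')
    (hc' : (center v x y hK hx hy).comap C = Ideal.span {h'})
    (hc : d.I ≠ center v x y hK hx hy) : v (weight F x y d s) < 1 := by
  classical
  set z := linePoint x d.u s with hzdef
  have hz : ∀ i, v (z i) ≤ 1 := linePoint_le hK hx hs.le
  have hzx : ∀ i, v (z i - x i) < 1 := fun i => by
    simp only [hzdef, linePoint, add_sub_cancel_right, map_mul]
    rw [mul_comm]
    exact mul_lt_one_of_lt_of_le hs (hK _)
  rw [weight, map_div₀, hFy, div_one]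
  refine v.map_sum_lt one_ne_zero fun y₀ hy₀ => ?_
  rw [Finset.mem_filter, Multiset.mem_toFinset] at hy₀
  refine cofactor_far hK hF hx hy hroot hz hzx hy₀.1 fun hlt => hc ?_
  have hle : d.I ≤ center v x y hK hx hy := hy₀.2.trans
    (ker_le_center hK hx hy hz hzx (valuation_fiber_le_one hK hF hz hy₀.1) hlt)
  have := hd.isPrime
  refine eq_of_le_of_comap_eq hF hle hd.mem ?_
  have h1 := Ideal.comap_mono (f := (C : MvPolynomial (Fin n) K →+* _)) hle
  rw [hd.comap_eq, hc', Ideal.span_singleton_le_span_singleton] at h1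
  rw [hd.comap_eq, hc', Ideal.span_singleton_le_span_singleton]
  exact (hh'.associated_of_dvd hd.prime h1).dvd'

variable {D : Derivation K Ω Ω} {ϖ : Ω} (hD : Tame v D ϖ)
include hD

include hx hy in
omit hd hroot [IsAlgClosed Ω] in
theorem mul_weight_dlog_lt_of_unit (hs : v s = 1) : v (ϖ * (weight F x y d s * dlog D s)) < 1 := by
  have h1 : v (weight F x y d s) ≤ 1 := by
    have := valuation_weight_le (d := d) (e := F.support.sup fun i => (F.coeff i).totalDegree) hK hF
      (fun i => ?_) le_rfl hx hy (by simp [hFy]) hs.le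
    · rwa [one_pow] at this
    · by_cases hi : i ∈ F.support
      · exact Finset.le_sup (f := fun i => (F.coeff i).totalDegree) hi
      · rw [notMem_support_iff.mp hi]; simp
  rw [mul_left_comm, map_mul, mul_comm, dlog, ← mul_div_assoc, map_div₀, hs, div_one]
  exact mul_lt_one_of_lt_of_le (hD.apply_lt s hs.le) h1

/-- Along a divisor other than the given one, the form `theta` has no residue. -/
theorem theta_residue_zero {h' : MvPolynomial (Fin n) K} (hh' : Prime h')
    (hc' : (center v x y hK hx hy).comap C = Ideal.span {h'})
    (hc : d.I ≠ center v x y hK hx hy) : v (ϖ * theta F x y d D) < 1 := by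
  rw [theta, ← Multiset.sum_map_mul_left]
  refine map_multiset_sum_lt _ _ fun s hs => ?_
  rw [mem_roots (lineHom_ne_zero hd.direction), IsRoot, eval_lineHom] at hs
  rcases (valuation_root_lineHom_le hK hd.direction le_rfl hx hs).lt_or_eq with hlt | heq
  · rw [mul_left_comm, map_mul]
    exact mul_lt_one_of_lt_of_le (weight_lt_one hK hF hx hy hroot hFy hd hlt hh' hc' hc)
      (hD.dlog_le s)
  · exact mul_weight_dlog_lt_of_unit hK hF hx hy hFy hD heq

/-- The form `theta` has residue one along the given divisor. -/
theorem theta_residue_one (hc : d.I = center v x y hK hx hy) (hh : MvPolynomial.aeval x d.h ≠ 0) :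
    v (ϖ * theta F x y d D - ϖ * dlog D (MvPolynomial.aeval x d.h)) < 1 := by
  have h1 : dlog D (MvPolynomial.aeval x d.h) =
      ((lineHom x d.u d.h).roots.map fun s => dlog D s).sum := by
    have h2 := aeval_eq_prod_roots_lineHom (x := x) hd.direction
    have h0 : (0 : Ω) ∉ (lineHom x d.u d.h).roots := by
      intro h0
      rw [mem_roots (lineHom_ne_zero hd.direction), IsRoot, eval_lineHom, linePoint_zero] at h0
      exact hh h0
    have h0' : (0 : Ω) ∉ (lineHom x d.u d.h).roots.map fun s => -s := by
      simpa using h0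
    rw [h2, dlog_mul D (by simpa using hd.direction) (Multiset.prod_ne_zero h0'),
      dlog_multiset_prod D _ h0', Multiset.map_map]
    simp [dlog, Function.comp_def]
  rw [h1, theta, ← mul_sub, ← Multiset.sum_map_sub, ← Multiset.sum_map_mul_left]
  refine map_multiset_sum_lt _ _ fun s hs => ?_
  rw [mem_roots (lineHom_ne_zero hd.direction), IsRoot, eval_lineHom] at hs
  rcases (valuation_root_lineHom_le hK hd.direction le_rfl hx hs).lt_or_eq with hlt | heq
  · have : ϖ * (weight F x y d s * dlog D s - dlog D s) =
        (weight F x y d s - 1) * (ϖ * dlog D s) := by ring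
    rw [this, map_mul]
    exact mul_lt_one_of_lt_of_le (weight_sub_one_lt_one hK hF hx hy hroot hFy hd hlt hs hc)
      (hD.dlog_le s)
  · rw [mul_sub]
    refine v.map_sub_lt (mul_weight_dlog_lt_of_unit hK hF hx hy hFy hD heq) ?_
    rw [dlog, ← mul_div_assoc, map_div₀, heq, div_one]
    exact hD.apply_lt s heq.le

end

end Residue
section Derivations

open TensorProduct

theorem formallyEtale_of_isAlgebraic (A Ω : Type*) [CommRing A] [IsDomain A] [CharZero A]
    [Field Ω] [Algebra A Ω] [FaithfulSMul A Ω] [Algebra.IsAlgebraic A Ω] :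
    Algebra.FormallyEtale A Ω := by
  let := FractionRing.liftAlgebra A Ω
  have : CharZero (FractionRing A) :=
    charZero_of_injective_algebraMap (IsFractionRing.injective A (FractionRing A))
  have : Algebra.IsAlgebraic (FractionRing A) Ω :=
    IsFractionRing.comap_isAlgebraic_iff.mp ‹Algebra.IsAlgebraic A Ω›
  have : Algebra.FormallyEtale A (FractionRing A) :=
    .of_isLocalization (nonZeroDivisors A)
  have : Algebra.FormallyEtale (FractionRing A) Ω := .of_isSeparable _ _
  exact .comp A (FractionRing A) Ω

theorem exists_derivation_extension (K A Ω : Type*) [CommRing K] [CommRing A] [Algebra K A]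
    [CommRing Ω] [Algebra A Ω] [Algebra K Ω] [IsScalarTower K A Ω] [Algebra.FormallyEtale A Ω]
    (d : Derivation K A Ω) : ∃ D : Derivation K Ω Ω, ∀ a, D (algebraMap A Ω a) = d a := by
  refine ⟨(LinearMap.liftBaseChange Ω d.liftKaehlerDifferential ∘ₗ
    (KaehlerDifferential.tensorKaehlerEquivOfFormallyEtale K A Ω).symm.toLinearMap).compDer
      (KaehlerDifferential.D K Ω), fun a => ?_⟩
  simp [KaehlerDifferential.tensorKaehlerEquivOfFormallyEtale_symm_D_algebraMap]

theorem derivation_eq_zero (K A Ω : Type*) [CommRing K] [CommRing A] [Algebra K A]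
    [CommRing Ω] [Algebra A Ω] [Algebra K Ω] [IsScalarTower K A Ω] [Algebra.FormallyEtale A Ω]
    (D : Derivation K Ω Ω) (hD : ∀ a, D (algebraMap A Ω a) = 0) : D = 0 := by
  let D' : Derivation A Ω Ω := Derivation.mk'
    { toFun := D, map_add' := map_add D, map_smul' := fun a t => by
        simp [Algebra.smul_def, hD] } fun a b => by simp
  have h : ∀ t, D t = D' t := fun t => rfl
  ext t
  rw [h, ← D'.liftKaehlerDifferential_comp_D,
    Subsingleton.elim (KaehlerDifferential.D A Ω t) 0, map_zero]
  rfl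

variable {K Ω : Type*} [Field K] [CharZero K] [Field Ω] [Algebra K Ω] {n : ℕ}

/-- A transcendence basis. -/
structure IsBase (x : Fin n → Ω) : Prop where
  inj : Function.Injective (MvPolynomial.aeval x : MvPolynomial (Fin n) K →ₐ[K] Ω)
  algebraic : ∀ t : Ω, ∃ p : (MvPolynomial (Fin n) K)[X], p ≠ 0 ∧ evalPoint x t p = 0

theorem IsBase.exists_derivation {x : Fin n → Ω} (hx : IsBase (K := K) x) :
    ∃ D : Fin n → Derivation K Ω Ω, ∀ l j, D l (x j) = if l = j then 1 else 0 := by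
  let := (MvPolynomial.aeval x : MvPolynomial (Fin n) K →ₐ[K] Ω).toRingHom.toAlgebra
  have : IsScalarTower K (MvPolynomial (Fin n) K) Ω := .of_algebraMap_eq fun c =>
    ((MvPolynomial.aeval x : MvPolynomial (Fin n) K →ₐ[K] Ω).commutes c).symm
  have : FaithfulSMul (MvPolynomial (Fin n) K) Ω :=
    (faithfulSMul_iff_algebraMap_injective _ _).mpr hx.inj
  have : Algebra.IsAlgebraic (MvPolynomial (Fin n) K) Ω := ⟨hx.algebraic⟩
  have := formallyEtale_of_isAlgebraic (MvPolynomial (Fin n) K) Ω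
  choose D hD using fun l => exists_derivation_extension K (MvPolynomial (Fin n) K) Ω
    (MvPolynomial.mkDerivation K fun j => if l = j then (1 : Ω) else 0)
  refine ⟨D, fun l j => ?_⟩
  have h := hD l (MvPolynomial.X j)
  rw [MvPolynomial.mkDerivation_X] at h
  rw [← h]
  congr 1
  exact (MvPolynomial.aeval_X x j).symm

theorem IsBase.derivation_ext {x : Fin n → Ω} (hx : IsBase (K := K) x) {D D' : Derivation K Ω Ω}
    (h : ∀ j, D (x j) = D' (x j)) : D = D' := by
  let := (MvPolynomial.aeval x : MvPolynomial (Fin n) K →ₐ[K] Ω).toRingHom.toAlgebra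
  have : IsScalarTower K (MvPolynomial (Fin n) K) Ω := .of_algebraMap_eq fun c =>
    ((MvPolynomial.aeval x : MvPolynomial (Fin n) K →ₐ[K] Ω).commutes c).symm
  have : FaithfulSMul (MvPolynomial (Fin n) K) Ω :=
    (faithfulSMul_iff_algebraMap_injective _ _).mpr hx.inj
  have : Algebra.IsAlgebraic (MvPolynomial (Fin n) K) Ω := ⟨hx.algebraic⟩
  have := formallyEtale_of_isAlgebraic (MvPolynomial (Fin n) K) Ω
  rw [← sub_eq_zero]
  refine derivation_eq_zero K (MvPolynomial (Fin n) K) Ω _ fun a => ?_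
  change (D - D') (MvPolynomial.aeval x a) = 0
  induction a using MvPolynomial.induction_on with
  | C c => simp
  | add p q hp hq => rw [map_add, map_add, hp, hq, add_zero]
  | mul_X p i hp =>
    rw [map_mul, MvPolynomial.aeval_X, Derivation.leibniz, hp, Derivation.sub_apply, h]
    simp

omit [CharZero K] in
theorem derivation_aeval (D : Derivation K Ω Ω) (x : Fin n → Ω) (p : MvPolynomial (Fin n) K) :
    D (MvPolynomial.aeval x p) =
      ∑ k, MvPolynomial.aeval x (MvPolynomial.pderiv k p) * D (x k) := by
  induction p using MvPolynomial.induction_on with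
  | C c => simp
  | add p q hp hq => simp [hp, hq, add_mul, Finset.sum_add_distrib]
  | mul_X p i hp =>
    simp only [map_mul, MvPolynomial.aeval_X, Derivation.leibniz, hp, smul_eq_mul, map_add,
      add_mul, Finset.sum_add_distrib, Finset.mul_sum]
    congr 1
    · rw [Finset.sum_eq_single i]
      · simp
      · intro j _ hj
        simp [MvPolynomial.pderiv_X, hj.symm]
      · simp
    · refine Finset.sum_congr rfl fun j _ => by ring

/-- A dual basis of derivations. -/
def IsDual (x : Fin n → Ω) (D : Fin n → Derivation K Ω Ω) : Prop :=
  ∀ l j, D l (x j) = if l = j then 1 else 0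

omit [CharZero K] in
theorem sum_smul_derivation_apply {ι : Type*} (s : Finset ι) (c : ι → Ω)
    (D : ι → Derivation K Ω Ω) (t : Ω) : (∑ i ∈ s, c i • D i) t = ∑ i ∈ s, c i * D i t := by
  induction s using Finset.cons_induction with
  | empty => simp
  | cons a s ha ih => rw [Finset.sum_cons, Finset.sum_cons, Derivation.add_apply, ih]; simp

theorem IsDual.eq_sum {x : Fin n → Ω} {D : Fin n → Derivation K Ω Ω} (h : IsDual x D)
    (hx : IsBase (K := K) x) (D' : Derivation K Ω Ω) : D' = ∑ k, D' (x k) • D k := by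
  refine hx.derivation_ext fun j => ?_
  have h' : ∀ k, D k (x j) = if k = j then 1 else 0 := fun k => h k j
  rw [sum_smul_derivation_apply]
  simp [h']

omit [CharZero K] in
theorem IsDual.apply_aeval {x : Fin n → Ω} {D : Fin n → Derivation K Ω Ω} (h : IsDual x D)
    (l : Fin n) (p : MvPolynomial (Fin n) K) :
    D l (MvPolynomial.aeval x p) = MvPolynomial.aeval x (MvPolynomial.pderiv l p) := by
  rw [derivation_aeval]
  simp [h l]

omit [CharZero K] in
theorem IsDual.conj {x : Fin n → Ω} {D : Fin n → Derivation K Ω Ω} (h : IsDual x D)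
    (σ : Ω ≃ₐ[K] Ω) : IsDual (fun i => σ (x i)) fun l => conj σ (D l) := by
  intro l j
  simp [h l j]

end Derivations
section Height

variable {A T : Type*} [CommRing A] [IsDomain A] [CommRing T] [IsDomain T] [Algebra A T]

omit [IsDomain A] [IsDomain T] in
theorem comap_lt_comap_of_lt {q : A}
    (hq : ∀ t : T, ∃ N : ℕ, IsIntegral A (algebraMap A T q ^ N * t)) {Q Q' : Ideal T}
    [Q.IsPrime] [Q'.IsPrime] (hqQ : algebraMap A T q ∉ Q) (hlt : Q' < Q) :
    Q'.comap (algebraMap A T) < Q.comap (algebraMap A T) := by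
  obtain ⟨t, htQ, htQ'⟩ := SetLike.exists_of_lt hlt
  obtain ⟨N, hN⟩ := hq t
  refine Ideal.comap_lt_comap_of_integral_mem_sdiff hlt.le ⟨Q.mul_mem_left _ htQ, fun h => ?_⟩ hN
  rcases Ideal.IsPrime.mem_or_mem ‹_› h with h | h
  · exact hqQ (hlt.le (Ideal.IsPrime.mem_of_pow_mem ‹_› _ h))
  · exact htQ' h

theorem comap_ne_bot {q : A}
    (hq : ∀ t : T, ∃ N : ℕ, IsIntegral A (algebraMap A T q ^ N * t)) {Q : Ideal T}
    (hqQ : algebraMap A T q ∉ Q) (hQ : Q ≠ ⊥) : Q.comap (algebraMap A T) ≠ ⊥ := by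
  obtain ⟨t, ht, ht0⟩ := Q.ne_bot_iff.mp hQ
  obtain ⟨N, hN⟩ := hq t
  refine Ideal.comap_ne_bot_of_integral_mem (mul_ne_zero (pow_ne_zero _ ?_) ht0)
    (Q.mul_mem_left _ ht) hN
  rintro h
  exact hqQ (h ▸ Q.zero_mem)

omit [IsDomain A] in
/-- A going-down property for maps which are integral away from `q`. -/
theorem exists_lt_of_lt_comap [IsIntegrallyClosed A] {q : A}
    (hinj : Function.Injective (algebraMap A T))
    (hq : ∀ t : T, ∃ N : ℕ, IsIntegral A (algebraMap A T q ^ N * t))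
    {Q : Ideal T} [Q.IsPrime] (hqQ : algebraMap A T q ∉ Q) {𝔭 : Ideal A} [𝔭.IsPrime]
    (h𝔭 : 𝔭 < Q.comap (algebraMap A T)) :
    ∃ Q' : Ideal T, Q'.IsPrime ∧ Q' < Q ∧ 𝔭 ≤ Q'.comap (algebraMap A T) := by
  let B := integralClosure A T
  have : FaithfulSMul A B := by
    rw [faithfulSMul_iff_algebraMap_injective]
    intro a b hab
    exact hinj (congrArg (algebraMap B T) hab)
  let 𝔮 : Ideal B := Q.comap (algebraMap B T)
  have : 𝔮.LiesOver (Q.comap (algebraMap A T)) := ⟨rfl⟩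
  obtain ⟨J, hlt, hJ, hover⟩ := Ideal.exists_ideal_lt_liesOver_of_lt 𝔮 h𝔭
  let qB : B := algebraMap A B q
  have hqB : qB ∉ J := fun h => hqQ (hlt.le h)
  have hqBT : ((qB : B) : T) = algebraMap A T q := rfl
  have hmem : ∀ {N : ℕ} {b : B}, qB ^ N * b ∈ J → b ∈ J := fun h =>
    (hJ.mem_or_mem h).resolve_left fun h => hqB (hJ.mem_of_pow_mem _ h)
  let Q' : Ideal T :=
    { carrier := {t | ∃ N : ℕ, ∃ b ∈ J, (b : T) = algebraMap A T q ^ N * t}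
      zero_mem' := ⟨0, 0, J.zero_mem, by simp⟩
      add_mem' := by
        rintro s t ⟨N, b, hb, h⟩ ⟨M, c, hc, h'⟩
        refine ⟨N + M, qB ^ M * b + qB ^ N * c,
          J.add_mem (J.mul_mem_left _ hb) (J.mul_mem_left _ hc), ?_⟩
        push_cast
        rw [h, h', hqBT]
        ring
      smul_mem' := by
        rintro s t ⟨N, b, hb, h⟩
        obtain ⟨M, hM⟩ := hq s
        refine ⟨M + N, ⟨_, hM⟩ * b, J.mul_mem_left _ hb, ?_⟩
        push_cast
        rw [h, smul_eq_mul]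
        ring }
  have hQ' : ∀ b : B, (b : T) ∈ Q' → b ∈ J := by
    rintro b ⟨N, c, hc, h⟩
    have : c = qB ^ N * b := Subtype.ext (by push_cast; rw [h, hqBT])
    exact hmem (this ▸ hc)
  have hle : Q' ≤ Q := by
    rintro t ⟨N, b, hb, h⟩
    have : (b : T) ∈ Q := hlt.le hb
    rw [h] at this
    exact (Ideal.IsPrime.mem_or_mem ‹_› this).resolve_left fun h =>
      hqQ (Ideal.IsPrime.mem_of_pow_mem ‹_› _ h)
  refine ⟨Q', ⟨fun h => ?_, fun {s t} hst => ?_⟩, lt_of_le_of_ne hle fun h => ?_, fun a ha => ?_⟩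
  · exact (Ideal.IsPrime.ne_top ‹Q.IsPrime›) (top_le_iff.mp (h ▸ hle))
  · obtain ⟨N, b, hb, h⟩ := hst
    obtain ⟨M, hM⟩ := hq s
    obtain ⟨L, hL⟩ := hq t
    have h1 : (⟨_, hM⟩ : B) * ⟨_, hL⟩ ∈ J := by
      refine hmem (N := N) ?_
      have : qB ^ N * ((⟨_, hM⟩ : B) * ⟨_, hL⟩) = qB ^ M * qB ^ L * b := by
        apply Subtype.ext
        push_cast
        rw [h, hqBT]
        ring
      rw [this]
      exact J.mul_mem_left _ hb
    rcases hJ.mem_or_mem h1 with h1 | h1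
    · exact .inl ⟨M, _, h1, rfl⟩
    · exact .inr ⟨L, _, h1, rfl⟩
  · obtain ⟨b, hb, hb'⟩ := SetLike.exists_of_lt hlt
    exact hb' (hQ' b (h ▸ hb))
  · refine ⟨0, algebraMap A B a, ?_, by simp⟩
    rw [hover.over] at ha
    exact ha

theorem eq_bot_of_lt_span_prime [UniqueFactorizationMonoid A] {p : A} (hp : Prime p)
    {𝔭 : Ideal A} [h𝔭 : 𝔭.IsPrime] (h : 𝔭 < Ideal.span {p}) : 𝔭 = ⊥ := by
  by_contra hne
  obtain ⟨x, hx, hxp⟩ := h𝔭.exists_mem_prime_of_ne_bot hne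
  have h1 := Ideal.mem_span_singleton.mp (h.le hx)
  have h2 : p ∈ 𝔭 := 𝔭.mem_of_dvd (hp.associated_of_dvd hxp h1).symm.dvd hx
  exact h.not_ge ((Ideal.span_singleton_le_iff_mem _).mpr h2)

theorem heightOnePrime_iff [UniqueFactorizationMonoid A] {q : A}
    (hinj : Function.Injective (algebraMap A T))
    (hq : ∀ t : T, ∃ N : ℕ, IsIntegral A (algebraMap A T q ^ N * t))
    {Q : Ideal T} [hQ : Q.IsPrime] (hqQ : algebraMap A T q ∉ Q) :
    HeightOnePrime Q ↔ ∃ p, Prime p ∧ Q.comap (algebraMap A T) = Ideal.span {p} := by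
  constructor
  · rintro ⟨-, hne, hmin⟩
    obtain ⟨p, hpQ, hp⟩ := Ideal.IsPrime.exists_mem_prime_of_ne_bot
      (inferInstance : (Q.comap (algebraMap A T)).IsPrime) (comap_ne_bot hq hqQ hne)
    refine ⟨p, hp, le_antisymm ?_ ((Ideal.span_singleton_le_iff_mem _).mpr hpQ)⟩
    by_contra hle
    have := (Ideal.span_singleton_prime hp.ne_zero).mpr hp
    obtain ⟨Q', hQ', hlt, hpQ'⟩ := exists_lt_of_lt_comap hinj hq hqQ
      (lt_of_le_not_ge ((Ideal.span_singleton_le_iff_mem _).mpr hpQ) hle)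
    have h1 : algebraMap A T p ∈ Q' := hpQ' (Ideal.mem_span_singleton_self p)
    rw [hmin Q' hQ' hlt, Ideal.mem_bot, map_eq_zero_iff _ hinj] at h1
    exact hp.ne_zero h1
  · rintro ⟨p, hp, hpQ⟩
    refine ⟨hQ, ?_, fun Q' hQ' hlt => ?_⟩
    · rintro rfl
      have h1 : p ∈ (⊥ : Ideal T).comap (algebraMap A T) := hpQ ▸ Ideal.mem_span_singleton_self p
      rw [Ideal.mem_comap, Ideal.mem_bot, map_eq_zero_iff _ hinj] at h1
      exact hp.ne_zero h1
    · by_contra hne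
      have hlt' := comap_lt_comap_of_lt hq hqQ hlt
      rw [hpQ] at hlt'
      exact comap_ne_bot hq (fun h => hqQ (hlt.le h)) hne (eq_bot_of_lt_span_prime hp hlt')

end Height

section ProperTransform

variable {R T : Type*} [CommRing R] [CommRing T] [IsDomain R] [IsNoetherianRing T]

theorem comap_mem_minimalPrimes {f₁ f₂ : R →+* T} (hf₁ : Function.Injective f₁)
    (hf₂ : Function.Injective f₂) {I : Ideal R} (hI : IsHypersurfaceIdeal I)
    (h : properTransform f₁ I = properTransform f₂ I) {Q : Ideal T} (hQ : HeightOnePrime Q)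
    (h₁ : Q.comap f₁ ∈ I.minimalPrimes) : Q.comap f₂ ∈ I.minimalPrimes := by
  have hQp := hQ.1
  have hcomap : ∀ {f : R →+* T}, Function.Injective f → ∀ {J : Ideal T},
      J.comap f ∈ I.minimalPrimes → J ≠ ⊥ := by
    rintro f hf J hJ rfl
    exact (hI.2.2 _ hJ).2.1 (by
      rw [← RingHom.ker_eq_comap_bot, (RingHom.injective_iff_ker_eq_bot f).mp hf])
  have hIb : I ≠ ⊥ := by
    rintro rfl
    exact (hI.2.2 _ h₁).2.1 (le_bot_iff.mp (h₁.2 ⟨Ideal.isPrime_bot, le_rfl⟩ bot_le))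
  have hmem : Q ∈ (I.map f₁).minimalPrimes := by
    refine ⟨⟨hQp, Ideal.map_le_iff_le_comap.mpr h₁.1.2⟩, ?_⟩
    rintro Q' ⟨hQ', hle⟩ hQQ'
    by_contra hnot
    have h0 := hQ.2.2 Q' hQ' (lt_of_le_not_ge hQQ' hnot)
    subst h0
    refine hIb (le_bot_iff.mp ?_)
    have := Ideal.map_le_iff_le_comap.mp hle
    rwa [← RingHom.ker_eq_comap_bot, (RingHom.injective_iff_ker_eq_bot f₁).mp hf₁] at this
  have hle : properTransform f₂ I ≤ Q := by
    rw [← h]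
    exact sInf_le ⟨hmem, h₁⟩
  have hfin : {Q : Ideal T | Q ∈ (I.map f₂).minimalPrimes ∧ Q.comap f₂ ∈ I.minimalPrimes}.Finite :=
    (Ideal.finite_minimalPrimes_of_isNoetherianRing T (I.map f₂)).subset fun Q h => h.1
  rw [properTransform, ← hfin.coe_toFinset, ← Finset.inf_id_eq_sInf, hQp.inf_le'] at hle
  obtain ⟨Q₂, hQ₂, hle⟩ := hle
  rw [Set.Finite.mem_toFinset] at hQ₂
  have : Q₂ = Q := by
    by_contra hne
    exact hcomap hf₂ hQ₂.2 (hQ.2.2 Q₂ hQ₂.1.1.1 (lt_of_le_of_ne hle hne))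
  exact this ▸ hQ₂.2

end ProperTransform

section Valuations

universe u

theorem exists_valuation {B : Type*} {Ω : Type u} [CommRing B] [IsDomain B] [Field Ω]
    (f : B →+* Ω) (hf : Function.Injective f) (P : Ideal B) [P.IsPrime] :
    ∃ (Γ : Type u) (_ : LinearOrderedCommGroupWithZero Γ) (v : Valuation Ω Γ),
      (∀ b, v (f b) ≤ 1) ∧ ∀ b, v (f b) < 1 ↔ b ∈ P := by
  have hunit : ∀ b : P.primeCompl, IsUnit (f b) := fun b =>
    IsUnit.mk0 _ fun h => b.2 (by rw [(map_eq_zero_iff f hf).mp h]; exact P.zero_mem)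
  let F : Localization.AtPrime P →+* Ω := IsLocalization.lift hunit
  have hF : ∀ b, F (algebraMap B _ b) = f b := fun b => IsLocalization.lift_eq hunit b
  obtain ⟨V, h, hloc⟩ := IsLocalRing.exists_factor_valuationRing F
  refine ⟨V.ValueGroup, inferInstance, V.valuation, fun b => ?_, fun b => ?_⟩
  · rw [← hF]
    exact (V.valuation_le_one_iff _).mpr (h _)
  · rw [← hF, ← IsLocalization.AtPrime.to_map_mem_maximal_iff (Localization.AtPrime P) P b,
      IsLocalRing.mem_maximalIdeal, mem_nonunits_iff,
      ← isUnit_map_iff (F.codRestrict V.toSubring h), ← mem_nonunits_iff]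
    have := V.valuation_lt_one_iff ((F.codRestrict V.toSubring h) (algebraMap B _ b))
    rw [IsLocalRing.mem_maximalIdeal] at this
    exact this.symm

end Valuations

section Closure

theorem exists_algEquiv {R Ω : Type*} [CommRing R] [IsDomain R] [Field Ω] [IsAlgClosed Ω]
    (f₁ f₂ : R →+* Ω) (hf₁ : Function.Injective f₁) (hf₂ : Function.Injective f₂)
    (h₁ : ∀ t, ∃ p : R[X], p ≠ 0 ∧ p.eval₂ f₁ t = 0)
    (h₂ : ∀ t, ∃ p : R[X], p ≠ 0 ∧ p.eval₂ f₂ t = 0) :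
    ∃ σ : Ω ≃+* Ω, ∀ r, σ (f₁ r) = f₂ r := by
  have key : ∀ (f : R →+* Ω), Function.Injective f →
      letI := f.toAlgebra
      Module.IsTorsionFree R Ω := by
    intro f hf
    let := f.toAlgebra
    have : FaithfulSMul R Ω := (faithfulSMul_iff_algebraMap_injective R Ω).mpr hf
    infer_instance
  have key1 := key f₁ hf₁
  have key2 := key f₂ hf₂
  have c1 : @IsAlgClosure R Ω _ _ f₁.toAlgebra key1 :=
    @IsAlgClosure.mk R Ω _ _ f₁.toAlgebra key1 inferInstance
      (@Algebra.IsAlgebraic.mk _ _ _ _ f₁.toAlgebra h₁)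
  have c2 : @IsAlgClosure R Ω _ _ f₂.toAlgebra key2 :=
    @IsAlgClosure.mk R Ω _ _ f₂.toAlgebra key2 inferInstance
      (@Algebra.IsAlgebraic.mk _ _ _ _ f₂.toAlgebra h₂)
  let e := @IsAlgClosure.equiv R _ _ Ω Ω _ _ f₂.toAlgebra key2 c2 f₁.toAlgebra key1 c1
  exact ⟨@AlgEquiv.toRingEquiv _ _ _ _ _ _ f₁.toAlgebra f₂.toAlgebra e,
    fun r => @AlgEquiv.commutes _ _ _ _ _ _ f₁.toAlgebra f₂.toAlgebra e r⟩

end Closure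
section Flip

variable {K Ω : Type*} [Field K] [Field Ω] [Algebra K Ω] {n : ℕ}

/-- Substitution of `X j` by its inverse, with denominators cleared by the `d`-th power
of `X j`. -/
noncomputable def reflect (j : Fin n) (d : ℕ) (G : MvPolynomial (Fin n) K) :
    MvPolynomial (Fin n) K :=
  ∑ s ∈ G.support, MvPolynomial.monomial (s.update j (d - s j)) (G.coeff s)

theorem coeff_reflect {j : Fin n} {d : ℕ} {G : MvPolynomial (Fin n) K} (hG : G.degreeOf j ≤ d)
    {s : Fin n →₀ ℕ} (hs : s ∈ G.support) :
    (reflect j d G).coeff (s.update j (d - s j)) = G.coeff s := by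
  classical
  rw [reflect, MvPolynomial.coeff_sum, Finset.sum_eq_single_of_mem s hs]
  · simp
  · intro t ht hts
    rw [MvPolynomial.coeff_monomial, if_neg]
    intro h
    refine hts (Finsupp.ext fun i => ?_)
    have hi := DFunLike.congr_fun h i
    have h1 := MvPolynomial.degreeOf_le_iff.mp hG t ht
    have h2 := MvPolynomial.degreeOf_le_iff.mp hG s hs
    by_cases hij : i = j
    · subst hij
      simp only [Finsupp.coe_update, Function.update_self] at hi
      lia
    · simpa [hij] using hi

theorem reflect_ne_zero {j : Fin n} {d : ℕ} {G : MvPolynomial (Fin n) K} (hG : G.degreeOf j ≤ d)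
    (h0 : G ≠ 0) : reflect j d G ≠ 0 := by
  obtain ⟨s, hs⟩ := MvPolynomial.support_nonempty.mpr h0
  intro h
  have := coeff_reflect hG hs
  rw [h, MvPolynomial.coeff_zero] at this
  exact MvPolynomial.mem_support_iff.mp hs this.symm

theorem not_X_dvd_reflect {j : Fin n} {G : MvPolynomial (Fin n) K} (h0 : G ≠ 0) :
    ¬ MvPolynomial.X j ∣ reflect j (G.degreeOf j) G := by
  classical
  rintro ⟨H, hH⟩
  obtain ⟨s, hs, hsj⟩ := Finset.exists_mem_eq_sup G.support
    (MvPolynomial.support_nonempty.mpr h0) fun s => s j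
  rw [← MvPolynomial.degreeOf_eq_sup] at hsj
  have h1 := coeff_reflect (j := j) le_rfl hs
  rw [hH, MvPolynomial.coeff_X_mul', if_neg] at h1
  · exact MvPolynomial.mem_support_iff.mp hs h1.symm
  · simp [hsj]

/-- The point with the `j`-th coordinate inverted. -/
def flip (x : Fin n → Ω) (j : Fin n) : Fin n → Ω := Function.update x j (x j)⁻¹

@[simp] theorem flip_self (x : Fin n → Ω) (j : Fin n) : flip x j j = (x j)⁻¹ := by simp [flip]

theorem flip_of_ne (x : Fin n → Ω) {i j : Fin n} (h : i ≠ j) : flip x j i = x i := by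
  simp [flip, h]

theorem flip_flip (x : Fin n → Ω) (j : Fin n) : flip (flip x j) j = x := by simp [flip]

theorem aeval_flip_reflect {x : Fin n → Ω} {j : Fin n} (hx : x j ≠ 0) {d : ℕ}
    {G : MvPolynomial (Fin n) K} (hG : G.degreeOf j ≤ d) :
    MvPolynomial.aeval (flip x j) (reflect j d G) = (x j)⁻¹ ^ d * MvPolynomial.aeval x G := by
  rw [reflect, map_sum, MvPolynomial.aeval_def x, MvPolynomial.eval₂_eq', Finset.mul_sum]
  refine Finset.sum_congr rfl fun s hs => ?_
  have h2 := MvPolynomial.degreeOf_le_iff.mp hG s hs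
  rw [MvPolynomial.aeval_monomial, Finsupp.prod_fintype _ _ (fun _ => pow_zero _),
    ← Finset.mul_prod_erase _ _ (Finset.mem_univ j),
    ← Finset.mul_prod_erase _ (fun i => x i ^ s i) (Finset.mem_univ j),
    Finset.prod_congr rfl (g := fun i => x i ^ s i)]
  · simp only [flip_self, Finsupp.coe_update, Function.update_self]
    rw [show (x j)⁻¹ ^ d = (x j)⁻¹ ^ (d - s j) * (x j)⁻¹ ^ s j by rw [← pow_add]; congr 1; lia]
    have : (x j)⁻¹ ^ s j * x j ^ s j = 1 := by rw [← mul_pow, inv_mul_cancel₀ hx, one_pow]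
    linear_combination (-(algebraMap K Ω (MvPolynomial.coeff s G)) * (x j)⁻¹ ^ (d - s j) *
      ∏ i ∈ Finset.univ.erase j, x i ^ s i) * this
  · intro i hi
    have := Finset.ne_of_mem_erase hi
    simp [flip_of_ne x this, this]

theorem IsBase.ne_zero {x : Fin n → Ω} (hx : IsBase (K := K) x) (j : Fin n) : x j ≠ 0 := by
  intro h
  refine MvPolynomial.X_ne_zero (R := K) j (hx.inj ?_)
  rw [MvPolynomial.aeval_X, h, map_zero]

theorem IsBase.isBase_flip {x : Fin n → Ω} (hx : IsBase (K := K) x) (j : Fin n) :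
    IsBase (K := K) (flip x j) where
  inj := by
    rw [injective_iff_map_eq_zero]
    intro G hG
    by_contra h0
    have h1 := aeval_flip_reflect (x := flip x j) (j := j)
      (by simp [hx.ne_zero j]) (le_refl (G.degreeOf j))
    rw [flip_flip, hG, mul_zero] at h1
    exact reflect_ne_zero le_rfl h0 (hx.inj (h1.trans (map_zero _).symm))
  algebraic t := by
    obtain ⟨p, hp, h0⟩ := hx.algebraic t
    set d := p.support.sup fun i => (p.coeff i).degreeOf j
    have hd : ∀ i ∈ p.support, (p.coeff i).degreeOf j ≤ d := fun i hi =>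
      Finset.le_sup (f := fun i => (p.coeff i).degreeOf j) hi
    refine ⟨∑ i ∈ p.support, monomial i (reflect j d (p.coeff i)), fun h => ?_, ?_⟩
    · obtain ⟨i, hi⟩ := (Polynomial.nonempty_support_iff (p := p)).mpr hp
      have h1 := congrArg (fun q => Polynomial.coeff q i) h
      simp only [finsetSum_coeff, coeff_monomial, coeff_zero] at h1
      rw [Finset.sum_ite_eq_of_mem' _ _ _ hi] at h1
      exact reflect_ne_zero (hd i hi) (mem_support_iff.mp hi) h1
    · rw [evalPoint, coe_eval₂RingHom, eval₂_eq_sum, Polynomial.sum] at h0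
      rw [map_sum, ← mul_zero ((x j)⁻¹ ^ d), ← h0, Finset.mul_sum]
      refine Finset.sum_congr rfl fun i hi => ?_
      rw [evalPoint, coe_eval₂RingHom, eval₂_monomial, RingHom.coe_coe, RingHom.coe_coe,
        aeval_flip_reflect (hx.ne_zero j) (hd i hi), mul_assoc]

end Flip

section Bounded

universe u

variable {K : Type*} {Ω : Type u} [Field K] [Field Ω] [Algebra K Ω] {n : ℕ}

variable (K) in
/-- The homomorphism from a polynomial ring given by a point. -/
noncomputable abbrev chart (x : Fin n → Ω) : MvPolynomial (Fin n) K →+* Ω :=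
  (MvPolynomial.aeval x : MvPolynomial (Fin n) K →ₐ[K] Ω)

theorem IsBase.exists_dominates {x : Fin n → Ω} (hx : IsBase (K := K) x)
    {π : MvPolynomial (Fin n) K} (hπ : Prime π) :
    ∃ (Γ : Type u) (_ : LinearOrderedCommGroupWithZero Γ) (v : Valuation Ω Γ),
      Dominates (chart K x) π v := by
  have := (Ideal.span_singleton_prime hπ.ne_zero).mpr hπ
  obtain ⟨Γ, _, v, h1, h2⟩ := exists_valuation (chart K x) hx.inj (Ideal.span {π})
  exact ⟨Γ, _, v, hx.inj, hπ, h1, fun a => (h2 a).trans Ideal.mem_span_singleton⟩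

theorem Dominates.algebraMap_le_one {Γ : Type*} [LinearOrderedCommGroupWithZero Γ]
    {v : Valuation Ω Γ} {x : Fin n → Ω} {π : MvPolynomial (Fin n) K}
    (h : Dominates (chart K x) π v) (c : K) : v (algebraMap K Ω c) ≤ 1 := by
  simpa using h.le_one (MvPolynomial.C c)

/-- The poles of `f` are bounded by those of `q` on the affine chart and by those of the `r j`
along the divisors at infinity. -/
structure IsBounded (x : Fin n → Ω) (q : MvPolynomial (Fin n) K)
    (r : Fin n → MvPolynomial (Fin n) K) (f : Ω) : Prop where
  finite : ∀ (π : MvPolynomial (Fin n) K) (Γ : Type u) [LinearOrderedCommGroupWithZero Γ]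
    (v : Valuation Ω Γ), Dominates (chart K x) π v →
      v (MvPolynomial.aeval x (π * q) * f) < 1
  infinite : ∀ (j : Fin n) (Γ : Type u) [LinearOrderedCommGroupWithZero Γ]
    (v : Valuation Ω Γ), Dominates (chart K (flip x j)) (MvPolynomial.X j) v →
      v (MvPolynomial.aeval (flip x j) (MvPolynomial.X j * r j) * f) < 1

theorem IsBase.exists_eq_aeval {x : Fin n → Ω} (hx : IsBase (K := K) x)
    {a b : MvPolynomial (Fin n) K} (hb : b ≠ 0) {s : Ω}
    (hs : MvPolynomial.aeval x b * s = MvPolynomial.aeval x a)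
    (h : ∀ (π : MvPolynomial (Fin n) K) (Γ : Type u) [LinearOrderedCommGroupWithZero Γ]
      (v : Valuation Ω Γ), Dominates (chart K x) π v → v (MvPolynomial.aeval x π * s) < 1) :
    ∃ G : MvPolynomial (Fin n) K, s = MvPolynomial.aeval x G := by
  obtain ⟨b', a', c, hrel, rfl, rfl⟩ := UniqueFactorizationMonoid.exists_reduced_factors b hb a
  have hinj : ∀ p : MvPolynomial (Fin n) K, p ≠ 0 → MvPolynomial.aeval x p ≠ 0 := fun p hp h0 =>
    hp (hx.inj (h0.trans (map_zero _).symm))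
  have hc := left_ne_zero_of_mul hb
  have hb' := right_ne_zero_of_mul hb
  rw [map_mul, map_mul, mul_assoc] at hs
  replace hs := mul_left_cancel₀ (hinj c hc) hs
  by_cases hu : IsUnit b'
  · obtain ⟨b'', hb''⟩ := hu.exists_right_inv
    refine ⟨b'' * a', ?_⟩
    rw [map_mul, ← hs, ← mul_assoc, mul_comm (MvPolynomial.aeval x b''), ← map_mul, hb'',
      map_one, one_mul]
  · obtain ⟨π, hπ, hπb⟩ := WfDvdMonoid.exists_irreducible_factor hu hb'
    obtain ⟨Γ, _, v, hv⟩ := hx.exists_dominates hπ.prime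
    have hπa : ¬ π ∣ a' := fun hπa => hπ.not_isUnit (hrel hπb hπa)
    have h1 : v (MvPolynomial.aeval x a') = 1 := hv.eq_one hπa
    obtain ⟨b₀, rfl⟩ := hπb
    have h2 : v (MvPolynomial.aeval x b₀) ≤ 1 := hv.le_one b₀
    have h3 := h π Γ v hv
    rw [← hs, map_mul (MvPolynomial.aeval x), mul_right_comm, map_mul] at h1
    refine absurd h1 (ne_of_lt ?_)
    exact mul_lt_one_of_lt_of_le h3 h2

theorem Dominates.valuation_aeval_eq {Γ : Type*} [LinearOrderedCommGroupWithZero Γ]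
    {v : Valuation Ω Γ} {x : Fin n → Ω} (hx : IsBase (K := K) x) {j : Fin n}
    (h : Dominates (chart K (flip x j)) (MvPolynomial.X j) v) {G : MvPolynomial (Fin n) K}
    (hG : G ≠ 0) : v (MvPolynomial.aeval x G) = v (x j) ^ G.degreeOf j := by
  have h1 : v (MvPolynomial.aeval (flip x j) (reflect j (G.degreeOf j) G)) = 1 :=
    h.eq_one (not_X_dvd_reflect hG)
  rw [aeval_flip_reflect (hx.ne_zero j) le_rfl, map_mul, map_pow, map_inv₀, inv_pow] at h1
  have h2 : v (x j) ^ G.degreeOf j ≠ 0 := pow_ne_zero _ (v.ne_zero_iff.mpr (hx.ne_zero j))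
  exact (inv_mul_eq_one₀ h2).mp h1 |>.symm

theorem IsBase.exists_degreeOf_le {x : Fin n → Ω} (hx : IsBase (K := K) x) {j : Fin n}
    (q : MvPolynomial (Fin n) K) {r : MvPolynomial (Fin n) K} (hr : r ≠ 0) :
    ∃ N : ℕ, ∀ (G : MvPolynomial (Fin n) K) (s : Ω),
      MvPolynomial.aeval x q * s = MvPolynomial.aeval x G →
      (∀ (Γ : Type u) [LinearOrderedCommGroupWithZero Γ] (v : Valuation Ω Γ),
        Dominates (chart K (flip x j)) (MvPolynomial.X j) v →
        v (MvPolynomial.aeval (flip x j) (MvPolynomial.X j * r) * s) < 1) →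
      G.degreeOf j ≤ N := by
  have hX : Prime (MvPolynomial.X j : MvPolynomial (Fin n) K) := MvPolynomial.X_prime
  obtain ⟨m, r', hr', rfl⟩ := WfDvdMonoid.max_power_factor hr hX.irreducible
  refine ⟨q.totalDegree + (m + 1), fun G s hs h => ?_⟩
  rcases eq_or_ne G 0 with rfl | hG
  · simp
  obtain ⟨Γ, _, v, hv⟩ := (hx.isBase_flip j).exists_dominates hX
  have h1 := h Γ v hv
  have h2 : v (MvPolynomial.aeval (flip x j) r') = 1 := hv.eq_one hr'
  have hxj : 1 < v (x j) := by
    have := hv.lt_one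
    rw [RingHom.coe_coe, MvPolynomial.aeval_X, flip_self, map_inv₀] at this
    exact (inv_lt_one₀ (zero_lt_iff.mpr (v.ne_zero_iff.mpr (hx.ne_zero j)))).mp this
  have hxj0 : v (x j) ≠ 0 := v.ne_zero_iff.mpr (hx.ne_zero j)
  rw [map_mul, map_mul, map_mul, map_mul, map_mul, h2, mul_one, map_pow, MvPolynomial.aeval_X,
    map_pow, flip_self, map_inv₀, ← pow_succ', inv_pow,
    inv_mul_lt_iff₀ (pow_pos (zero_lt_iff.mpr hxj0) _), mul_one] at h1
  have h3 : v (MvPolynomial.aeval x q) ≤ v (x j) ^ q.totalDegree := by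
    refine aeval_le_pow hv.algebraMap_le_one hxj.le (fun i => ?_) le_rfl
    by_cases hi : i = j
    · rw [hi]
    · refine le_trans ?_ hxj.le
      simpa [flip_of_ne x hi] using hv.le_one (MvPolynomial.X i)
  have h4 : v (x j) ^ G.degreeOf j ≤ v (x j) ^ (q.totalDegree + (m + 1)) := by
    rw [← hv.valuation_aeval_eq hx hG, ← hs, map_mul, pow_add]
    gcongr
  exact (pow_le_pow_iff_right₀ hxj).mp h4

theorem IsBase.exists_finiteDimensional {x : Fin n → Ω} (hx : IsBase (K := K) x)
    {q : MvPolynomial (Fin n) K} (hq : q ≠ 0) {r : Fin n → MvPolynomial (Fin n) K}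
    (hr : ∀ j, r j ≠ 0) :
    ∃ V : Submodule K Ω, FiniteDimensional K V ∧ ∀ (a b : MvPolynomial (Fin n) K) (s : Ω),
      b ≠ 0 → MvPolynomial.aeval x b * s = MvPolynomial.aeval x a → IsBounded x q r s →
      s ∈ V := by
  choose N hN using fun j => hx.exists_degreeOf_le (j := j) q (hr j)
  refine ⟨(MvPolynomial.restrictDegree (Fin n) K (Finset.univ.sup N)).map
    (LinearMap.mulLeft K (MvPolynomial.aeval x q)⁻¹ ∘ₗ
      (MvPolynomial.aeval x : MvPolynomial (Fin n) K →ₐ[K] Ω).toLinearMap), inferInstance,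
    fun a b s hb hs h => ?_⟩
  have hq0 : MvPolynomial.aeval x q ≠ 0 := fun h0 => hq (hx.inj (h0.trans (map_zero _).symm))
  obtain ⟨G, hG⟩ := hx.exists_eq_aeval (a := q * a) (s := MvPolynomial.aeval x q * s) hb
    (by rw [map_mul, ← hs]; ring) fun π Γ _ v hv => by
      have := h.finite π Γ v hv
      rwa [map_mul (MvPolynomial.aeval x), mul_assoc] at this
  refine ⟨G, (MvPolynomial.mem_restrictDegree _ _ _).mpr fun d hd j => ?_, ?_⟩
  · exact (MvPolynomial.degreeOf_le_iff.mp (hN j G s hG fun Γ _ v hv => h.infinite j Γ v hv)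
      d hd).trans (Finset.le_sup (Finset.mem_univ j))
  · simp [← hG, inv_mul_cancel_left₀ hq0]

end Bounded

section Trace

universe u

variable {K : Type*} {Ω : Type u} [Field K] [Field Ω] [Algebra K Ω] {n : ℕ}

theorem IsBase.exists_isIntegralElem {z : Fin n → Ω} (hz : IsBase (K := K) z) (s : Finset Ω) :
    ∃ q : MvPolynomial (Fin n) K, q ≠ 0 ∧
      ∀ t ∈ s, (chart K z).IsIntegralElem (MvPolynomial.aeval z q * t) := by
  let := (chart K z).toAlgebra
  have : Algebra.IsAlgebraic (MvPolynomial (Fin n) K) Ω := ⟨fun t => hz.algebraic t⟩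
  have : FaithfulSMul (MvPolynomial (Fin n) K) Ω :=
    (faithfulSMul_iff_algebraMap_injective _ _).mpr hz.inj
  obtain ⟨q, hq, h⟩ := Algebra.IsAlgebraic.exists_integral_multiples (MvPolynomial (Fin n) K) s
  refine ⟨q, hq, fun t ht => ?_⟩
  have := h t ht
  rwa [Algebra.smul_def] at this

theorem aeval_mem_adjoin {x z : Fin n → Ω}
    (hz : ∀ i, z i ∈ IntermediateField.adjoin K (Set.range x)) (p : MvPolynomial (Fin n) K) :
    MvPolynomial.aeval z p ∈ IntermediateField.adjoin K (Set.range x) := by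
  induction p using MvPolynomial.induction_on with
  | C a => simp
  | add p q hp hq => rw [map_add]; exact add_mem hp hq
  | mul_X p i hp => rw [map_mul, MvPolynomial.aeval_X]; exact mul_mem hp (hz i)

theorem mem_adjoin_range (x : Fin n → Ω) (i : Fin n) :
    x i ∈ IntermediateField.adjoin K (Set.range x) :=
  IntermediateField.subset_adjoin _ _ ⟨i, rfl⟩

theorem flip_mem_adjoin_range (x : Fin n → Ω) (j i : Fin n) :
    flip x j i ∈ IntermediateField.adjoin K (Set.range x) := by
  by_cases h : i = j
  · rw [h, flip_self]
    exact inv_mem (mem_adjoin_range x j)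
  · rw [flip_of_ne x h]
    exact mem_adjoin_range x i

theorem IsBase.isAlgebraic {x : Fin n → Ω} (hx : IsBase (K := K) x) :
    Algebra.IsAlgebraic (IntermediateField.adjoin K (Set.range x)) Ω := by
  refine ⟨fun t => ?_⟩
  obtain ⟨p, hp, h0⟩ := hx.algebraic t
  let f : MvPolynomial (Fin n) K →ₐ[K] IntermediateField.adjoin K (Set.range x) :=
    MvPolynomial.aeval fun i => ⟨x i, mem_adjoin_range x i⟩
  have hf : (IntermediateField.val _).comp f = MvPolynomial.aeval x := by
    ext i
    simp [f]
  have hfi : Function.Injective f := by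
    have := hx.inj
    rw [← hf, AlgHom.coe_comp] at this
    exact this.of_comp
  refine ⟨p.map (f : _ →+* _), (Polynomial.map_ne_zero_iff hfi).mpr hp, ?_⟩
  rw [aeval_def, eval₂_map]
  refine Eq.trans (congrArg (fun g => p.eval₂ g t) ?_) h0
  rw [← hf]
  rfl

theorem Dominates.comap {z : Fin n → Ω} {π : MvPolynomial (Fin n) K} {Γ : Type*}
    [LinearOrderedCommGroupWithZero Γ] {v : Valuation Ω Γ} (h : Dominates (chart K z) π v)
    {τ : Ω →+* Ω} (hτ : ∀ p, τ (chart K z p) = chart K z p) :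
    Dominates (chart K z) π (v.comap τ) where
  inj := h.inj
  prime := h.prime
  le_one a := by rw [Valuation.comap_apply, hτ]; exact h.le_one a
  lt_one_iff a := by rw [Valuation.comap_apply, hτ]; exact h.lt_one_iff a

variable [CharZero K] [IsAlgClosed Ω] {x : Fin n → Ω}

theorem valuation_trace_lt_one (hx : IsBase (K := K) x)
    (M : IntermediateField (IntermediateField.adjoin K (Set.range x)) Ω)
    [FiniteDimensional (IntermediateField.adjoin K (Set.range x)) M]
    {z : Fin n → Ω} (hz : ∀ i, z i ∈ IntermediateField.adjoin K (Set.range x))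
    {π q q' : MvPolynomial (Fin n) K} {b f : M}
    (hb : (chart K z).IsIntegralElem (MvPolynomial.aeval z q' * b))
    {Γ : Type*} [LinearOrderedCommGroupWithZero Γ] {v : Valuation Ω Γ}
    (hv : Dominates (chart K z) π v)
    (hf : ∀ v' : Valuation Ω Γ, Dominates (chart K z) π v' →
      v' (MvPolynomial.aeval z (π * q) * f) < 1) :
    v (MvPolynomial.aeval z (π * (q * q')) * algebraMap _ Ω
      (Algebra.trace (IntermediateField.adjoin K (Set.range x)) M (f * b))) < 1 := by
  have := hx.isAlgebraic
  have : IsAlgClosure (IntermediateField.adjoin K (Set.range x)) Ω := ⟨inferInstance, this⟩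
  have : Normal (IntermediateField.adjoin K (Set.range x)) Ω := IsAlgClosure.normal _ Ω
  rw [trace_eq_sum_embeddings Ω, Finset.mul_sum]
  refine v.map_sum_lt one_ne_zero fun σ _ => ?_
  let τ : Ω →ₐ[IntermediateField.adjoin K (Set.range x)] Ω := σ.liftNormal Ω
  have hτ : ∀ m : M, σ m = τ m := fun m => (σ.liftNormal_commutes Ω m).symm
  have hτz : ∀ p, τ (chart K z p) = chart K z p := fun p => τ.commutes ⟨_, aeval_mem_adjoin hz p⟩
  have hv' : Dominates (chart K z) π (v.comap (τ : Ω →+* Ω)) := hv.comap hτz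
  have h1 := hf _ hv'
  have h2 := le_one_of_isIntegralElem hv'.le_one hb
  rw [Valuation.comap_apply] at h1 h2
  have h3 : MvPolynomial.aeval z (π * (q * q')) * σ (f * b) =
      τ (MvPolynomial.aeval z (π * q) * f) * τ (MvPolynomial.aeval z q' * b) := by
    rw [hτ, ← map_mul]
    refine Eq.trans (congrArg (· * _) (hτz _).symm) ?_
    rw [← map_mul]
    congr 1
    simp only [RingHom.coe_coe, map_mul, MulMemClass.coe_mul]
    ring
  rw [h3, map_mul]
  exact mul_lt_one_of_lt_of_le h1 h2

theorem finiteDimensional_of_isBounded (hx : IsBase (K := K) x)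
    (M : IntermediateField (IntermediateField.adjoin K (Set.range x)) Ω)
    [FiniteDimensional (IntermediateField.adjoin K (Set.range x)) M]
    {q : MvPolynomial (Fin n) K} (hq : q ≠ 0) {r : Fin n → MvPolynomial (Fin n) K}
    (hr : ∀ j, r j ≠ 0) (W : Submodule K Ω) (hWM : ∀ f ∈ W, f ∈ M)
    (hW : ∀ f ∈ W, IsBounded x q r f) : FiniteDimensional K W := by
  let k := IntermediateField.adjoin K (Set.range x)
  have : Module.Free k M := Module.Free.of_divisionRing k M
  let b := Module.finBasis k M
  have hV : ∀ i, ∃ V : Submodule K Ω, FiniteDimensional K V ∧ ∀ f : M, IsBounded x q r f →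
      algebraMap k Ω (Algebra.trace k M (f * b i)) ∈ V := by
    intro i
    obtain ⟨q', hq', hqi⟩ := hx.exists_isIntegralElem {(b i : Ω)}
    choose r' hr' hri using fun j => (hx.isBase_flip j).exists_isIntegralElem {(b i : Ω)}
    obtain ⟨V, hV, h⟩ := hx.exists_finiteDimensional (mul_ne_zero hq hq')
      fun j => mul_ne_zero (hr j) (hr' j)
    refine ⟨V, hV, fun f hf => ?_⟩
    obtain ⟨a, c, hac⟩ := (IntermediateField.mem_adjoin_range_iff K x _).mp
      (Algebra.trace k M (f * b i)).2
    have hbd : IsBounded x (q * q') (fun j => r j * r' j)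
        (algebraMap k Ω (Algebra.trace k M (f * b i))) :=
      ⟨fun π Γ _ v hv => valuation_trace_lt_one hx M (mem_adjoin_range x) (hqi _ (by simp)) hv
        fun v' hv' => hf.finite π Γ v' hv',
       fun j Γ _ v hv => valuation_trace_lt_one hx M (flip_mem_adjoin_range x j)
        (hri j _ (by simp)) hv fun v' hv' => hf.infinite j Γ v' hv'⟩
    change algebraMap k Ω (Algebra.trace k M (f * b i)) = _ at hac
    rcases eq_or_ne c 0 with rfl | hc
    · rw [map_zero, div_zero] at hac
      rw [hac]
      exact V.zero_mem
    · refine h a c _ hc ?_ hbd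
      rw [hac, mul_div_cancel₀]
      exact fun h0 => hc (hx.inj (h0.trans (map_zero _).symm))
  choose V hVfin hV using hV
  let e : W →ₗ[K] M := { toFun := fun f => ⟨f, hWM f f.2⟩, map_add' := fun _ _ => rfl,
                         map_smul' := fun _ _ => rfl }
  let tr : Fin (Module.finrank k M) → W →ₗ[K] Ω := fun i =>
    (IsScalarTower.toAlgHom K k Ω).toLinearMap ∘ₗ
      (Algebra.trace k M ∘ₗ LinearMap.mulRight k (b i)).restrictScalars K ∘ₗ e
  let φ : W →ₗ[K] ∀ i, V i := LinearMap.pi fun i =>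
    (tr i).codRestrict (V i) fun f => hV i (e f) (hW f f.2)
  refine FiniteDimensional.of_injective φ ?_
  rw [injective_iff_map_eq_zero]
  intro f hf
  have h1 : ∀ i, Algebra.trace k M (e f * b i) = 0 := fun i => by
    have h2 := congrArg Subtype.val (congrFun hf i)
    exact (map_eq_zero_iff _ (algebraMap k Ω).injective).mp h2
  have h3 : e f = 0 := (traceForm_nondegenerate k M).1 (e f) fun m => by
    have : Algebra.traceForm k M (e f) = 0 := b.ext fun i => h1 i
    rw [this]; rfl
  exact Subtype.ext (show (f : Ω) = 0 from congrArg Subtype.val h3)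

end Trace

section Fixed

variable {K Ω V : Type*} [Field K] [Field Ω] [Algebra K Ω] [AddCommGroup V] [Module K V]
  [Module Ω V] [IsScalarTower K Ω V] [FiniteDimensional Ω V]

theorem finiteDimensional_of_fixed (U : Submodule K V) (S : Set (Ω → Ω))
    (hψ : ∀ s ∈ S, ∃ ψ : V →+ V, (∀ (c : Ω) (w : V), ψ (c • w) = s c • ψ w) ∧ ∀ u ∈ U, ψ u = u)
    (hS : ∀ c : Ω, (∀ s ∈ S, s c = c) → ∃ a : K, algebraMap K Ω a = c) :
    FiniteDimensional K U := by
  obtain ⟨b, hbU, hspan, hli⟩ := exists_linearIndependent Ω (U : Set V)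
  have hfin : Finite b := hli.finite
  have : Fintype b := Fintype.ofFinite b
  have hle : U ≤ Submodule.span K b := by
    intro u hu
    have hu' : u ∈ Submodule.span Ω (Set.range ((↑) : b → V)) := by
      rw [Subtype.range_coe, hspan]
      exact Submodule.subset_span hu
    obtain ⟨c, rfl⟩ := (Submodule.mem_span_range_iff_exists_fun Ω).mp hu'
    refine Submodule.sum_mem _ fun i _ => ?_
    obtain ⟨a, ha⟩ := hS (c i) fun s hs => by
      obtain ⟨ψ, h1, h2⟩ := hψ s hs
      have h3 := h2 _ hu
      rw [map_sum] at h3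
      simp only [h1] at h3
      rw [Finset.sum_congr rfl fun i _ => by rw [h2 _ (hbU i.2)]] at h3
      rw [← sub_eq_zero, ← Finset.sum_sub_distrib] at h3
      simp only [← sub_smul] at h3
      exact sub_eq_zero.mp (Fintype.linearIndependent_iff.mp hli (fun i => s (c i) - c i) h3 i)
    rw [← ha, algebraMap_smul]
    exact Submodule.smul_mem _ _ (Submodule.subset_span i.2)
  have : FiniteDimensional K (Submodule.span K b) := FiniteDimensional.span_of_finite K hfin
  exact Submodule.finiteDimensional_of_le hle

end Fixed

theorem heightOnePrime_iff_of_ringHom {A T : Type*} [CommRing A] [IsDomain A]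
    [UniqueFactorizationMonoid A] [CommRing T] [IsDomain T] {f : A →+* T}
    (hf : Function.Injective f) {q : A}
    (hq : ∀ t : T, ∃ N : ℕ, f.IsIntegralElem (f q ^ N * t)) {Q : Ideal T} [Q.IsPrime]
    (hqQ : f q ∉ Q) :
    HeightOnePrime Q ↔ ∃ p, Prime p ∧ Q.comap f = Ideal.span {p} := by
  let := f.toAlgebra
  exact heightOnePrime_iff hf hq hqQ

section Model

variable (K R : Type*) [Field K] [CommRing R] [Algebra K R] (n : ℕ)

/-- A presentation of an affine domain as a finite extension of a polynomial ring which is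
generically generated by one element. -/
structure Model where
  g : MvPolynomial (Fin n) K →ₐ[K] R
  gen : R
  F : (MvPolynomial (Fin n) K)[X]
  disc : R
  inj : Function.Injective g
  integral : ∀ t, (g : MvPolynomial (Fin n) K →+* R).IsIntegralElem t
  monic : F.Monic
  root : F.eval₂ (g : MvPolynomial (Fin n) K →+* R) gen = 0
  disc_ne_zero : disc ≠ 0
  exists_eval : ∀ t, ∃ G : (MvPolynomial (Fin n) K)[X],
    G.eval₂ (g : MvPolynomial (Fin n) K →+* R) gen = disc * t
  dvd_disc : (derivative F).eval₂ (g : MvPolynomial (Fin n) K →+* R) gen ∣ disc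

namespace Model

variable {K R n} (M : Model K R n)

/-- Evaluation of polynomials in the coordinates and the generator. -/
noncomputable def ev : (MvPolynomial (Fin n) K)[X] →+* R :=
  eval₂RingHom (M.g : MvPolynomial (Fin n) K →+* R) M.gen

theorem ev_apply (G : (MvPolynomial (Fin n) K)[X]) :
    M.ev G = G.eval₂ (M.g : MvPolynomial (Fin n) K →+* R) M.gen := rfl

theorem ev_comp_C : M.ev.comp C = (M.g : MvPolynomial (Fin n) K →+* R) := by
  ext <;> simp [ev]

/-- The prime divisors outside of the zeros of `M.disc`. -/
def Place : Type _ := {P : Ideal R // HeightOnePrime P ∧ M.disc ∉ P}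

variable {M} in
theorem Place.isPrime (P : M.Place) : P.1.IsPrime := P.2.1.1

theorem comap_ev_injective (P P' : M.Place) (h : P.1.comap M.ev = P'.1.comap M.ev) : P = P' := by
  have key : ∀ P P' : M.Place, P.1.comap M.ev = P'.1.comap M.ev → P.1 ≤ P'.1 := by
    intro P P' h t ht
    obtain ⟨G, hG⟩ := M.exists_eval t
    have h1 : G ∈ P.1.comap M.ev := by
      rw [Ideal.mem_comap, ev_apply, hG]
      exact P.1.mul_mem_left _ ht
    rw [h, Ideal.mem_comap, ev_apply, hG] at h1
    exact (P'.isPrime.mem_or_mem h1).resolve_left P'.2.2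
  exact Subtype.ext (le_antisymm (key P P' h) (key P' P h.symm))

variable [IsDomain R]

theorem heightOnePrime_iff (P : Ideal R) [hP : P.IsPrime] :
    HeightOnePrime P ↔
      ∃ p, Prime p ∧ P.comap (M.g : MvPolynomial (Fin n) K →+* R) = Ideal.span {p} :=
  heightOnePrime_iff_of_ringHom (q := 1) M.inj (fun t => ⟨0, by simpa using M.integral t⟩) (by
    rw [map_one]
    exact fun h => hP.ne_top ((Ideal.eq_top_iff_one P).mpr h))

theorem exists_datum [Infinite K] (P : M.Place) : ∃ d : DivisorDatum K n,
    d.Valid M.F ∧ d.I = P.1.comap M.ev := by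
  have := P.isPrime
  obtain ⟨p, hp, hPp⟩ := (M.heightOnePrime_iff P.1).mp P.2.1
  obtain ⟨u, hu⟩ := exists_eval_leadingForm_ne_zero hp.ne_zero
  refine ⟨⟨p, P.1.comap M.ev, u⟩, ⟨hp, inferInstance, ?_, ?_, hu⟩, rfl⟩
  · rw [Ideal.mem_comap, ev_apply, M.root]
    exact P.1.zero_mem
  · rw [Ideal.comap_comap, ev_comp_C, hPp]

/-- The datum of a prime divisor. -/
noncomputable def datum [Infinite K] (P : M.Place) : DivisorDatum K n :=
  (M.exists_datum P).choose

theorem datum_valid [Infinite K] (P : M.Place) : (M.datum P).Valid M.F :=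
  (M.exists_datum P).choose_spec.1

theorem datum_I [Infinite K] (P : M.Place) : (M.datum P).I = P.1.comap M.ev :=
  (M.exists_datum P).choose_spec.2

theorem span_datum_h [Infinite K] (P : M.Place) :
    P.1.comap (M.g : MvPolynomial (Fin n) K →+* R) = Ideal.span {(M.datum P).h} := by
  rw [← (M.datum_valid P).comap_eq, M.datum_I, Ideal.comap_comap, ev_comp_C]

section Point

variable {Ω : Type*} [Field Ω] [Algebra K Ω] (f : R →ₐ[K] Ω)

/-- The coordinates of a point. -/
noncomputable def pt (i : Fin n) : Ω := f (M.g (MvPolynomial.X i))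

omit [IsDomain R] in
theorem map_g (p : MvPolynomial (Fin n) K) : f (M.g p) = MvPolynomial.aeval (M.pt f) p := by
  have : f.comp M.g = MvPolynomial.aeval (M.pt f) := by
    ext i
    simp [pt]
  exact DFunLike.congr_fun this p

omit [IsDomain R] in
theorem map_ev (G : (MvPolynomial (Fin n) K)[X]) :
    f (M.ev G) = evalPoint (M.pt f) (f M.gen) G := by
  have : (f : R →+* Ω).comp M.ev = evalPoint (K := K) (M.pt f) (f M.gen) := by
    ext i
    · simp [ev]
    · simp [ev, pt]
    · simp [ev]
  exact RingHom.congr_fun this G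

/-- The value at a derivation of a form with prescribed residues. -/
noncomputable def form [Infinite K] (c : M.Place →₀ K) (D : Derivation K Ω Ω) : Ω :=
  c.sum fun P a => a • theta M.F (M.pt f) (f M.gen) (M.datum P) D

variable {f} {Γ : Type*} [LinearOrderedCommGroupWithZero Γ] {v : Valuation Ω Γ}

theorem form_residue [Infinite K] [CharZero K] [IsAlgClosed Ω] (hf : Function.Injective f)
    (hv : ∀ t, v (f t) ≤ 1) (P : M.Place)
    (hP : ∀ t, v (f t) < 1 ↔ t ∈ P.1) {D : Derivation K Ω Ω} {ϖ : Ω} (hD : Tame v D ϖ)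
    (c : M.Place →₀ K) :
    v (ϖ * M.form f c D -
      c P • (ϖ * dlog D (MvPolynomial.aeval (M.pt f) (M.datum P).h))) < 1 := by
  classical
  have hK : ∀ a : K, v (algebraMap K Ω a) ≤ 1 := fun a => by
    rw [← f.commutes a]; exact hv _
  have hx : ∀ i, v (M.pt f i) ≤ 1 := fun i => hv _
  have hy : v (f M.gen) ≤ 1 := hv _
  have hroot : evalPoint (M.pt f) (f M.gen) M.F = 0 := by
    rw [← M.map_ev, ev_apply, M.root, map_zero]
  have hdisc : v (f M.disc) = 1 := le_antisymm (hv _) (not_lt.mp fun h => P.2.2 ((hP _).mp h))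
  have hFy : v (evalPoint (M.pt f) (f M.gen) (derivative M.F)) = 1 := by
    refine le_antisymm (evalPoint_le_one hK hx hy _) ?_
    obtain ⟨b, hb⟩ := M.dvd_disc
    rw [hb, map_mul, map_mul, ← ev_apply, map_ev] at hdisc
    rw [← hdisc]
    exact mul_le_of_le_one_right' (hv b)
  have hcenter : center v (M.pt f) (f M.gen) hK hx hy = P.1.comap M.ev := by
    ext G
    rw [mem_center, Ideal.mem_comap, ← hP, map_ev]
  have h0 : MvPolynomial.aeval (M.pt f) (M.datum P).h ≠ 0 := by
    rw [← M.map_g]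
    intro h
    have h1 := (map_eq_zero_iff f hf).mp h
    exact (M.datum_valid P).prime.ne_zero ((map_eq_zero_iff M.g M.inj).mp h1)
  have hterm : ∀ P', v (ϖ * theta M.F (M.pt f) (f M.gen) (M.datum P') D -
      if P' = P then ϖ * dlog D (MvPolynomial.aeval (M.pt f) (M.datum P).h) else 0) < 1 := by
    intro P'
    split_ifs with h
    · subst h
      exact theta_residue_one hK M.monic hx hy hroot hFy (M.datum_valid P') hD
        (by rw [datum_I, hcenter]) h0
    · rw [sub_zero]
      refine theta_residue_zero hK M.monic hx hy hroot hFy (M.datum_valid P') hD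
        (M.datum_valid P).prime ?_ ?_
      · rw [hcenter, ← M.datum_I, (M.datum_valid P).comap_eq]
      · rw [hcenter, datum_I]
        exact fun he => h (M.comap_ev_injective _ _ he)
  have hsum : ϖ * M.form f c D - c P • (ϖ * dlog D (MvPolynomial.aeval (M.pt f) (M.datum P).h)) =
      ∑ P' ∈ c.support, algebraMap K Ω (c P') *
        (ϖ * theta M.F (M.pt f) (f M.gen) (M.datum P') D -
          if P' = P then ϖ * dlog D (MvPolynomial.aeval (M.pt f) (M.datum P).h) else 0) := by
    simp only [mul_sub, Finset.sum_sub_distrib, mul_ite, mul_zero, form, Finsupp.sum,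
      Algebra.smul_def, Finset.mul_sum, Finset.sum_ite_eq']
    congr 1
    · exact Finset.sum_congr rfl fun _ _ => mul_left_comm _ _ _
    · split_ifs with h
      · rfl
      · simp [Finsupp.notMem_support_iff.mp h]
  rw [hsum]
  refine v.map_sum_lt one_ne_zero fun P' _ => ?_
  rw [map_mul, mul_comm]
  exact mul_lt_one_of_lt_of_le (hterm P') (hK _)

end Point

end Model

end Model

section Existence

theorem exists_generator_fractionRing (A R : Type*) [CommRing A] [IsDomain A] [CharZero A]
    [CommRing R] [IsDomain R] [Algebra A R] [FaithfulSMul A R] [Module.Finite A R] :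
    ∃ y : R, ∀ t : R, ∃ b : A, b ≠ 0 ∧ ∃ G : A[X], aeval y G = b • t := by
  let := FractionRing.liftAlgebra A (FractionRing R)
  let k := FractionRing A
  let L := FractionRing R
  have : CharZero k :=
    charZero_of_injective_algebraMap (IsFractionRing.injective A (FractionRing A))
  obtain ⟨α, hα⟩ := Field.exists_primitive_element k L
  obtain ⟨r, s, hs, rfl⟩ := IsFractionRing.div_surjective (A := R) α
  have hs0 := nonZeroDivisors.ne_zero hs
  obtain ⟨a, ha, ha0⟩ := Submodule.exists_mem_ne_zero_of_ne_bot
    (Ideal.comap_ne_bot_of_integral_mem (R := A) hs0 (Ideal.mem_span_singleton_self s)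
      (Algebra.IsIntegral.isIntegral s))
  obtain ⟨s', hs'⟩ := Ideal.mem_span_singleton.mp (Ideal.mem_comap.mp ha)
  have haL : algebraMap R L (algebraMap A R a) = algebraMap k L (algebraMap A k a) := by
    rw [← IsScalarTower.algebraMap_apply A R L, ← IsScalarTower.algebraMap_apply A k L]
  have hak : algebraMap A k a ≠ 0 := by simpa using ha0
  have hsL : algebraMap R L s ≠ 0 := by simpa using hs0
  have hgen : IntermediateField.adjoin k {algebraMap R L (r * s')} = ⊤ := by
    rw [eq_top_iff, ← hα, IntermediateField.adjoin_simple_le_iff]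
    have h1 : algebraMap R L r / algebraMap R L s =
        algebraMap k L (algebraMap A k a)⁻¹ * algebraMap R L (r * s') := by
      rw [map_inv₀, ← haL, hs', map_mul, map_mul]
      have h2 : algebraMap R L s' ≠ 0 := by
        rintro h2
        rw [hs', map_mul, h2, mul_zero] at haL
        exact hak ((map_eq_zero (algebraMap k L)).mp haL.symm)
      rw [mul_inv, div_eq_mul_inv, mul_comm (algebraMap R L r) (algebraMap R L s'), mul_assoc,
        inv_mul_cancel_left₀ h2, mul_comm]
    rw [h1]
    exact mul_mem (IntermediateField.algebraMap_mem _ _)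
      (IntermediateField.mem_adjoin_simple_self _ _)
  refine ⟨r * s', fun t => ?_⟩
  have halg : IsAlgebraic k (algebraMap R L (r * s')) := .of_finite _ _
  have ht : algebraMap R L t ∈ IntermediateField.adjoin k {algebraMap R L (r * s')} := by
    rw [hgen]; trivial
  rw [← IntermediateField.mem_toSubalgebra,
    IntermediateField.adjoin_simple_toSubalgebra_of_isAlgebraic halg,
    Algebra.adjoin_singleton_eq_range_aeval] at ht
  obtain ⟨Q, hQ⟩ := ht
  obtain ⟨b, hb, hbQ⟩ := IsLocalization.integerNormalization_spec (nonZeroDivisors A) Q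
  refine ⟨b, nonZeroDivisors.ne_zero hb, IsLocalization.integerNormalization (nonZeroDivisors A) Q,
    IsFractionRing.injective R L ?_⟩
  rw [← aeval_algebraMap_apply, ← aeval_map_algebraMap k, hbQ, ← algebraMap_smul k b Q, map_smul,
    algebraMap_smul, Algebra.smul_def b t, (algebraMap R L).map_mul (algebraMap A R b),
    Algebra.smul_def, ← IsScalarTower.algebraMap_apply A R L]
  exact congrArg _ hQ

theorem exists_generator (A R : Type*) [CommRing A] [IsDomain A] [CharZero A]
    [CommRing R] [IsDomain R] [Algebra A R] [FaithfulSMul A R] [Module.Finite A R] :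
    ∃ y : R, ∃ b : A, b ≠ 0 ∧ ∀ t : R, ∃ G : A[X], aeval y G = b • t := by
  classical
  obtain ⟨y, hy⟩ := exists_generator_fractionRing A R
  choose b hb G hG using hy
  obtain ⟨s, hs⟩ := Module.Finite.fg_top (R := A) (M := R)
  refine ⟨y, ∏ i ∈ s, b i, Finset.prod_ne_zero_iff.mpr fun i _ => hb i, fun t => ?_⟩
  have ht : t ∈ Submodule.span A (s : Set R) := by rw [hs]; trivial
  induction ht using Submodule.span_induction with
  | mem t ht =>
    refine ⟨C (∏ i ∈ s.erase t, b i) * G t, ?_⟩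
    rw [map_mul, aeval_C, hG, ← Finset.prod_erase_mul s b ht, mul_smul, Algebra.smul_def
      (∏ i ∈ s.erase t, b i)]
  | zero => exact ⟨0, by simp⟩
  | add t t' _ _ h h' =>
    obtain ⟨P, hP⟩ := h
    obtain ⟨P', hP'⟩ := h'
    exact ⟨P + P', by rw [map_add, hP, hP', smul_add]⟩
  | smul a t _ h =>
    obtain ⟨P, hP⟩ := h
    exact ⟨C a * P, by rw [map_mul, aeval_C, hP, smul_comm, Algebra.smul_def a]⟩

theorem aeval_derivative_minpoly_ne_zero {A R : Type*} [CommRing A] [IsDomain A]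
    [IsIntegrallyClosed A] [CharZero A] [CommRing R] [IsDomain R] [Algebra A R]
    [Module.IsTorsionFree A R] {y : R} (hy : IsIntegral A y) :
    aeval y (derivative (minpoly A y)) ≠ 0 := by
  intro h
  have h0 : derivative (minpoly A y) ≠ 0 := by
    rw [Ne, derivative_eq_zero]
    exact (minpoly.natDegree_pos hy).ne'
  exact absurd (minpoly.IsIntegrallyClosed.degree_le_of_ne_zero h0 h)
    (not_le.mpr (degree_derivative_lt (minpoly.ne_zero hy)))

theorem exists_model (K R : Type*) [Field K] [CharZero K] [CommRing R] [IsDomain R] [Algebra K R]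
    [Algebra.FiniteType K R] : ∃ n, Nonempty (Model K R n) := by
  obtain ⟨n, g, hg, hint⟩ := exists_integral_inj_algHom_of_fg K R
  let := (g : MvPolynomial (Fin n) K →+* R).toAlgebra
  have : IsScalarTower K (MvPolynomial (Fin n) K) R :=
    .of_algebraMap_eq fun c => (g.commutes c).symm
  have : FaithfulSMul (MvPolynomial (Fin n) K) R :=
    (faithfulSMul_iff_algebraMap_injective _ _).mpr hg
  have : Algebra.IsIntegral (MvPolynomial (Fin n) K) R := ⟨hint⟩
  have : Algebra.FiniteType (MvPolynomial (Fin n) K) R := .of_restrictScalars_finiteType K _ _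
  have : Module.Finite (MvPolynomial (Fin n) K) R := Algebra.IsIntegral.finite
  obtain ⟨y, b, hb, hG⟩ := exists_generator (MvPolynomial (Fin n) K) R
  have hy : IsIntegral (MvPolynomial (Fin n) K) y := Algebra.IsIntegral.isIntegral y
  refine ⟨n, ⟨{
    g := g
    gen := y
    F := minpoly _ y
    disc := g b * aeval y (derivative (minpoly (MvPolynomial (Fin n) K) y))
    inj := hg
    integral := hint
    monic := minpoly.monic hy
    root := minpoly.aeval _ y
    disc_ne_zero := mul_ne_zero (fun h => hb ((map_eq_zero_iff g hg).mp h))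
      (aeval_derivative_minpoly_ne_zero hy)
    exists_eval := fun t => ?_
    dvd_disc := Dvd.intro_left _ rfl }⟩⟩
  obtain ⟨G, h⟩ := hG t
  refine ⟨G * derivative (minpoly _ y), ?_⟩
  change aeval y _ = _
  rw [map_mul, h, Algebra.smul_def, mul_right_comm]
  rfl

end Existence

section Tame

variable {K Ω : Type*} [Field K] [CharZero K] [Field Ω] [Algebra K Ω] {n : ℕ}
  {Γ : Type*} [LinearOrderedCommGroupWithZero Γ] {v : Valuation Ω Γ}

theorem Dominates.tame {z : Fin n → Ω} (hz : IsBase (K := K) z) {π : MvPolynomial (Fin n) K}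
    (h : Dominates (chart K z) π v) {D : Derivation K Ω Ω}
    (hD : ∀ i, v (D (z i)) ≤ 1) : Tame v D (MvPolynomial.aeval z π) := by
  have hN : ∀ N : ℕ, N ≠ 0 → ¬ π ∣ (N : MvPolynomial (Fin n) K) := by
    intro N hN hdvd
    refine h.prime.not_isUnit (isUnit_of_dvd_unit hdvd ?_)
    have : (N : MvPolynomial (Fin n) K) = MvPolynomial.C (N : K) := by simp
    rw [this]
    exact (IsUnit.mk0 _ (Nat.cast_ne_zero.mpr hN)).map MvPolynomial.C
  have halg : ∀ t : Ω, ∃ p : (MvPolynomial (Fin n) K)[X], p ≠ 0 ∧ p.eval₂ (chart K z) t = 0 :=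
    hz.algebraic
  have hD' : ∀ a, v (D (chart K z a)) ≤ 1 := by
    intro a
    rw [RingHom.coe_coe, derivation_aeval]
    refine v.map_sum_le fun i _ => ?_
    rw [map_mul]
    exact mul_le_one' (h.le_one _) (hD i)
  exact ⟨fun s => h.mul_dlog_le hN halg D hD' s, fun s hs => h.mul_derivation_lt hN halg D hD' hs⟩

end Tame

namespace Model

section Bound

variable {K R Ω : Type*} [Field K] [CommRing R] [IsDomain R] [Algebra K R] {n : ℕ}
  [Field Ω] [Algebra K Ω] {Γ : Type*} [LinearOrderedCommGroupWithZero Γ] {v : Valuation Ω Γ}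

/-- A bound for the order of the poles of forms with constant residues. -/
noncomputable def order (M : Model K R n) : ℕ :=
  (M.F.support.sup (fun i => (M.F.coeff i).totalDegree) + 1) * M.F.natDegree + 1

open Classical in
/-- The functions whose poles control the poles of forms with constant residues. -/
noncomputable def poles (M : Model K R n) (f : R →ₐ[K] Ω) : Finset Ω :=
  Finset.univ.image (M.pt f) ∪
    {f M.gen, (evalPoint (M.pt f) (f M.gen) (derivative M.F))⁻¹}

variable (M : Model K R n) (f : R →ₐ[K] Ω)

theorem valuation_form_le [Infinite K] (hK : ∀ c : K, v (algebraMap K Ω c) ≤ 1) {γ : Γ}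
    (hγ : 1 ≤ γ) (h : ∀ t ∈ M.poles f, v t ≤ γ) {D : Derivation K Ω Ω} {ϖ : Ω}
    (hD : Tame v D ϖ) (c : M.Place →₀ K) : v (ϖ * M.form f c D) ≤ γ ^ M.order := by
  have he : ∀ i, (M.F.coeff i).totalDegree ≤
      M.F.support.sup fun i => (M.F.coeff i).totalDegree := by
    intro i
    by_cases hi : i ∈ M.F.support
    · exact Finset.le_sup (f := fun i => (M.F.coeff i).totalDegree) hi
    · simp [notMem_support_iff.mp hi]
  rw [form, Finsupp.sum, Finset.mul_sum]
  refine v.map_sum_le fun P _ => ?_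
  rw [Algebra.smul_def, mul_left_comm, map_mul, ← one_mul (γ ^ _)]
  refine mul_le_mul' (hK _) (valuation_theta_le hK M.monic he hγ (fun i => h _ ?_) (h _ ?_) (h _ ?_)
    (M.datum_valid P).direction hD.dlog_le)
  all_goals simp [poles]

theorem mul_form_lt_one [Infinite K] (hK : ∀ c : K, v (algebraMap K Ω c) ≤ 1) {q : Ω}
    (hq0 : q ≠ 0) (hq : v q < 1) (h : ∀ t ∈ M.poles f, v (q * t) ≤ 1)
    {D : Derivation K Ω Ω} {ϖ : Ω} (hD : Tame v D ϖ) (c : M.Place →₀ K) :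
    v (ϖ * q ^ (M.order + 1) * M.form f c D) < 1 := by
  have hq0' : 0 < v q := zero_lt_iff.mpr (v.ne_zero_iff.mpr hq0)
  have h1 : v (ϖ * M.form f c D) ≤ (v q)⁻¹ ^ M.order := by
    refine M.valuation_form_le f hK (one_le_inv₀ hq0' |>.mpr hq.le) (fun t ht => ?_) hD c
    have := h t ht
    rw [map_mul] at this
    rwa [← one_div, le_div_iff₀ hq0', mul_comm]
  calc v (ϖ * q ^ (M.order + 1) * M.form f c D)
      = v q * (v q ^ M.order * v (ϖ * M.form f c D)) := by
        rw [← map_pow, ← map_mul, ← map_mul]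
        congr 1
        ring
    _ ≤ v q * (v q ^ M.order * (v q)⁻¹ ^ M.order) := by gcongr
    _ = v q := by rw [← mul_pow, mul_inv_cancel₀ hq0'.ne', one_pow, mul_one]
    _ < 1 := hq

end Bound

end Model

section Infinity

variable {K Ω : Type*} [Field K] [CharZero K] [Field Ω] [Algebra K Ω] {n : ℕ}
  {Γ : Type*} [LinearOrderedCommGroupWithZero Γ] {v : Valuation Ω Γ}

theorem IsDual.tame {x : Fin n → Ω} {D : Fin n → Derivation K Ω Ω} (hD : IsDual x D)
    (hx : IsBase (K := K) x) {π : MvPolynomial (Fin n) K} (h : Dominates (chart K x) π v)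
    (l : Fin n) : Tame v (D l) (MvPolynomial.aeval x π) := by
  refine h.tame hx fun i => ?_
  rw [hD l i]
  split_ifs <;> simp

theorem IsDual.tame_flip {x : Fin n → Ω} {D : Fin n → Derivation K Ω Ω} (hD : IsDual x D)
    (hx : IsBase (K := K) x) {j : Fin n}
    (h : Dominates (chart K (flip x j)) (MvPolynomial.X j) v) (l : Fin n) :
    Tame v (D l) (MvPolynomial.aeval (flip x j) (MvPolynomial.X j : MvPolynomial (Fin n) K)) := by
  refine h.tame (hx.isBase_flip j) fun i => ?_
  have hD' : ∀ i, v (D l (x i)) ≤ 1 := fun i => by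
    rw [hD l i]
    split_ifs <;> simp
  rcases eq_or_ne i j with rfl | hij
  · rw [flip_self, Derivation.leibniz_inv, smul_eq_mul, map_mul, Valuation.map_neg, map_pow]
    refine mul_le_one' (pow_le_one' ?_ _) (hD' i)
    have := h.lt_one
    rw [RingHom.coe_coe, MvPolynomial.aeval_X, flip_self] at this
    exact this.le
  · rw [flip_of_ne x hij]
    exact hD' i

end Infinity

section Jacobian

variable {K : Type*} [Field K] {n : ℕ}

theorem pderiv_eq_zero_of_dvd {h : MvPolynomial (Fin n) K} {k : Fin n}
    (hd : h ∣ MvPolynomial.pderiv k h) : MvPolynomial.pderiv k h = 0 := by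
  by_contra h0
  obtain ⟨c, hc⟩ := hd
  have hh : h ≠ 0 := by rintro rfl; simp at h0
  have hc0 : c ≠ 0 := by rintro rfl; exact h0 (by rw [hc, mul_zero])
  obtain ⟨m, hm, hdeg⟩ := Finset.exists_mem_eq_sup (MvPolynomial.pderiv k h).support
    (MvPolynomial.support_nonempty.mpr h0) fun m => m.sum fun _ e => e
  have h1 : (MvPolynomial.pderiv k h).totalDegree = h.totalDegree + c.totalDegree := by
    rw [hc, MvPolynomial.totalDegree_mul_of_isDomain hh hc0]
  rw [MvPolynomial.totalDegree, hdeg] at h1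
  rw [MvPolynomial.mem_support_iff, MvPolynomial.coeff_pderiv] at hm
  have h2 := MvPolynomial.le_totalDegree (MvPolynomial.mem_support_iff.mpr (left_ne_zero_of_mul hm))
  rw [Finsupp.sum_add_index' (by simp) (by simp), Finsupp.sum_single_index rfl] at h2
  lia

theorem exists_not_dvd_pderiv [CharZero K] {h : MvPolynomial (Fin n) K} (hh : Prime h) :
    ∃ k, ¬ h ∣ MvPolynomial.pderiv k h := by
  by_contra! hd
  have hs : ∀ s : Fin n →₀ ℕ, s ≠ 0 → h.coeff s = 0 := by
    intro s hs
    obtain ⟨k, hk⟩ := Finsupp.ne_iff.mp hs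
    have h1 := congrArg (MvPolynomial.coeff (s - Finsupp.single k 1))
      (pderiv_eq_zero_of_dvd (hd k))
    rw [MvPolynomial.coeff_pderiv, MvPolynomial.coeff_zero, tsub_add_cancel_of_le
      (Finsupp.single_le_iff.mpr (Nat.one_le_iff_ne_zero.mpr hk))] at h1
    exact (mul_eq_zero.mp h1).resolve_right (Nat.cast_add_one_ne_zero _)
  have hC : h = MvPolynomial.C (h.coeff 0) := by
    ext s
    rw [MvPolynomial.coeff_C]
    split_ifs with h0
    · rw [h0]
    · exact hs s (Ne.symm h0)
  have h0 : h.coeff 0 ≠ 0 := fun h0 => hh.ne_zero (by rw [hC, h0, map_zero])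
  exact hh.not_isUnit (hC ▸ (IsUnit.mk0 _ h0).map MvPolynomial.C)

variable {Ω : Type*} [CharZero K] [Field Ω] [Algebra K Ω]
  {Γ : Type*} [LinearOrderedCommGroupWithZero Γ] {v : Valuation Ω Γ}

theorem Dominates.valuation_le {x x' : Fin n → Ω} (hx : IsBase (K := K) x)
    {D D' : Fin n → Derivation K Ω Ω}
    (hD : IsDual x D) (hD' : IsDual x' D') {π π' : MvPolynomial (Fin n) K}
    (h : Dominates (chart K x) π v) (h' : Dominates (chart K x') π' v)
    (hJ : ∀ k m, v (D' k (x m)) ≤ 1) :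
    v (MvPolynomial.aeval x π) ≤ v (MvPolynomial.aeval x' π') := by
  by_contra! hlt
  have hπ0 : MvPolynomial.aeval x π ≠ 0 := fun h0 => by simp [h0] at hlt
  obtain ⟨s, hs⟩ : ∃ s, MvPolynomial.aeval x' π' = s * MvPolynomial.aeval x π :=
    ⟨_, (div_mul_cancel₀ _ hπ0).symm⟩
  have hvs : v s < 1 := by
    rw [hs, map_mul] at hlt
    by_contra! h1
    exact absurd hlt (not_lt.mpr (le_mul_of_one_le_left' h1))
  have h1 : ∀ m, v (D m (MvPolynomial.aeval x' π')) < 1 := by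
    intro m
    rw [hs, Derivation.leibniz, smul_eq_mul, smul_eq_mul]
    refine v.map_add_lt ?_ ((hD.tame hx h m).apply_lt s hvs.le)
    rw [hD.apply_aeval, map_mul]
    exact mul_lt_one_of_lt_of_le hvs (h.le_one _)
  obtain ⟨k, hk⟩ := exists_not_dvd_pderiv h'.prime
  refine hk ((h'.lt_one_iff _).mp ?_)
  rw [RingHom.coe_coe, ← hD'.apply_aeval, hD.eq_sum hx (D' k), sum_smul_derivation_apply]
  refine v.map_sum_lt one_ne_zero fun m _ => ?_
  rw [map_mul, mul_comm]
  exact mul_lt_one_of_lt_of_le (h1 m) (hJ k m)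

end Jacobian

section Denominator

universe u

variable {K : Type*} {Ω : Type u} [Field K] [Field Ω] [Algebra K Ω] {n : ℕ}

theorem IsBase.exists_denominator {x : Fin n → Ω} (hx : IsBase (K := K) x) {T : Type*} [CommRing T]
    [Algebra K T] [Algebra.FiniteType K T] {φ : MvPolynomial (Fin n) K →ₐ[K] T} {j : T →ₐ[K] Ω}
    (hj : Function.Injective j) (hφ : ∀ a, j (φ a) = MvPolynomial.aeval x a) :
    ∃ q : MvPolynomial (Fin n) K, q ≠ 0 ∧ ∀ t : T, ∃ N : ℕ,
      (φ : MvPolynomial (Fin n) K →+* T).IsIntegralElem (φ q ^ N * t) := by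
  classical
  obtain ⟨s, hs⟩ := Algebra.FiniteType.out (R := K) (A := T)
  obtain ⟨q, hq, h⟩ := hx.exists_isIntegralElem (s.image j)
  have hmap : ∀ a, (φ : MvPolynomial (Fin n) K →+* T).IsIntegralElem (φ a) := fun a =>
    RingHom.isIntegralElem_map (φ : MvPolynomial (Fin n) K →+* T)
  refine ⟨q, hq, fun t => ?_⟩
  have ht : t ∈ Algebra.adjoin K (s : Set T) := by rw [hs]; trivial
  induction ht using Algebra.adjoin_induction with
  | mem t ht =>
    obtain ⟨p, hp, hp0⟩ := h (j t) (Finset.mem_image_of_mem j ht)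
    refine ⟨1, p, hp, hj ?_⟩
    have hc : (j : T →+* Ω).comp (φ : MvPolynomial (Fin n) K →+* T) = chart K x :=
      RingHom.ext hφ
    change (j : T →+* Ω) _ = _
    rw [hom_eval₂, hc, pow_one, RingHom.coe_coe, map_mul, hφ, map_zero]
    exact hp0
  | algebraMap c =>
    refine ⟨0, ?_⟩
    rw [pow_zero, one_mul, ← φ.commutes]
    exact hmap _
  | add t t' _ _ h h' =>
    obtain ⟨N, hN⟩ := h
    obtain ⟨N', hN'⟩ := h'
    refine ⟨N + N', ?_⟩
    rw [show φ q ^ (N + N') * (t + t') = φ (q ^ N') * (φ q ^ N * t) +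
      φ (q ^ N) * (φ q ^ N' * t') by rw [map_pow, map_pow]; ring]
    exact RingHom.IsIntegralElem.add _ (RingHom.IsIntegralElem.mul _ (hmap _) hN)
      (RingHom.IsIntegralElem.mul _ (hmap _) hN')
  | mul t t' _ _ h h' =>
    obtain ⟨N, hN⟩ := h
    obtain ⟨N', hN'⟩ := h'
    refine ⟨N + N', ?_⟩
    rw [pow_add, mul_mul_mul_comm]
    exact RingHom.IsIntegralElem.mul _ hN hN'

end Denominator

section Good

universe u

variable {K R T : Type*} {Ω : Type u} [Field K] [CommRing R] [Algebra K R]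
  [CommRing T] [Algebra K T] [Field Ω] [Algebra K Ω] {n : ℕ}
  {Γ : Type*} [LinearOrderedCommGroupWithZero Γ] {v : Valuation Ω Γ}

theorem le_one_of_range_sup_range {p₁ p₂ : R →ₐ[K] T} (h : p₁.range ⊔ p₂.range = ⊤)
    {j : T →ₐ[K] Ω} (hK : ∀ c : K, v (algebraMap K Ω c) ≤ 1) (h₁ : ∀ r, v (j (p₁ r)) ≤ 1)
    (h₂ : ∀ r, v (j (p₂ r)) ≤ 1) (t : T) : v (j t) ≤ 1 := by
  let S : Subalgebra K T :=
    { v.integer.comap (j : T →+* Ω) with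
      algebraMap_mem' := fun c => by
        change v (j (algebraMap K T c)) ≤ 1
        rw [j.commutes]
        exact hK c }
  have hS : p₁.range ⊔ p₂.range ≤ S := by
    refine sup_le ?_ ?_
    · rintro _ ⟨r, rfl⟩
      exact h₁ r
    · rintro _ ⟨r, rfl⟩
      exact h₂ r
  have ht : t ∈ p₁.range ⊔ p₂.range := by rw [h]; trivial
  exact hS ht

/-- The center on `T` of a valuation which is nonnegative on `T`. -/
def centerOn (v : Valuation Ω Γ) (j : T →ₐ[K] Ω) (h : ∀ t, v (j t) ≤ 1) : Ideal T where
  carrier := {t | v (j t) < 1}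
  zero_mem' := by simp
  add_mem' {a b} ha hb := by
    rw [Set.mem_ofPred_eq, map_add]
    exact v.map_add_lt ha hb
  smul_mem' c t ht := by
    rw [Set.mem_ofPred_eq, smul_eq_mul, map_mul, map_mul, mul_comm]
    exact mul_lt_one_of_lt_of_le ht (h c)

theorem mem_centerOn {j : T →ₐ[K] Ω} {h : ∀ t, v (j t) ≤ 1} {t : T} :
    t ∈ centerOn v j h ↔ v (j t) < 1 := Iff.rfl

theorem centerOn_isPrime (j : T →ₐ[K] Ω) (h : ∀ t, v (j t) ≤ 1) : (centerOn v j h).IsPrime := by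
  refine ⟨fun h1 => ?_, fun {a b} hab => ?_⟩
  · have := (Ideal.eq_top_iff_one _).mp h1
    simp [mem_centerOn] at this
  · by_contra! hc
    simp only [mem_centerOn, not_lt] at hab hc
    have h1 : v (j (a * b)) = 1 := by
      rw [map_mul, map_mul, le_antisymm (h a) hc.1, le_antisymm (h b) hc.2, one_mul]
    exact absurd hab (not_lt.mpr h1.ge)

theorem one_le_of_inv_le_one {t : Ω} (h : v t⁻¹ ≤ 1) (ht : t ≠ 0) : 1 ≤ v t := by
  rwa [map_inv₀, inv_le_one₀ (zero_lt_iff.mpr (v.ne_zero_iff.mpr ht))] at h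

namespace Model

variable [IsDomain R] (M : Model K R n)

omit [IsDomain R] in
theorem le_one {f : R →ₐ[K] Ω} (hK : ∀ c : K, v (algebraMap K Ω c) ≤ 1)
    (hx : ∀ i, v (M.pt f i) ≤ 1) (t : R) : v (f t) ≤ 1 := by
  obtain ⟨p, hp, hp0⟩ := M.integral t
  have h1 : ∀ a, v (((f : R →+* Ω).comp (M.g : MvPolynomial (Fin n) K →+* R)) a) ≤ 1 := by
    intro a
    change v (f (M.g a)) ≤ 1
    rw [M.map_g]
    exact aeval_le_one hK hx a
  refine le_one_of_isIntegralElem h1 ⟨p, hp, ?_⟩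
  have := congrArg (f : R →+* Ω) hp0
  rwa [hom_eval₂, map_zero] at this

theorem dominates [Infinite K] {f : R →ₐ[K] Ω} (hf : Function.Injective f) (hv : ∀ t, v (f t) ≤ 1)
    (P : M.Place) (hP : ∀ t, v (f t) < 1 ↔ t ∈ P.1) :
    Dominates (chart K (M.pt f)) (M.datum P).h v where
  inj := by
    intro a b hab
    rw [RingHom.coe_coe, ← M.map_g, ← M.map_g] at hab
    exact M.inj (hf hab)
  prime := (M.datum_valid P).prime
  le_one a := by
    rw [RingHom.coe_coe, ← M.map_g]
    exact hv _
  lt_one_iff a := by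
    rw [RingHom.coe_coe, ← M.map_g, hP, ← Ideal.mem_span_singleton, ← span_datum_h]
    rfl

/-- A valuation dominating a prime divisor of the base, where none of finitely many functions
has a pole, has prime divisors as centers on the correspondence and on its two factors, and the
difference of the two forms is regular there if their residues agree. -/
theorem exists_place_form_sub_lt_one [Infinite K] [CharZero K] [IsAlgClosed Ω] [IsDomain T]
    {p₁ p₂ : R →ₐ[K] T}
    (hclosed : p₁.range ⊔ p₂.range = ⊤) (hp₁ : Function.Injective p₁) (hp₂ : Function.Injective p₂)
    {j : T →ₐ[K] Ω} (hj : Function.Injective j)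
    (hx : IsBase (K := K) (M.pt (j.comp p₁))) (hx' : IsBase (K := K) (M.pt (j.comp p₂)))
    {D D' : Fin n → Derivation K Ω Ω} (hD : IsDual (M.pt (j.comp p₁)) D)
    (hD' : IsDual (M.pt (j.comp p₂)) D') {q₁ q₂ : MvPolynomial (Fin n) K}
    (hq₁ : ∀ t : T, ∃ N : ℕ, (p₁.comp M.g : MvPolynomial (Fin n) K →+* T).IsIntegralElem
      ((p₁.comp M.g) q₁ ^ N * t))
    (hq₂ : ∀ t : T, ∃ N : ℕ, (p₂.comp M.g : MvPolynomial (Fin n) K →+* T).IsIntegralElem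
      ((p₂.comp M.g) q₂ ^ N * t))
    (hq₁0 : q₁ ≠ 0) (hq₂0 : q₂ ≠ 0)
    {π : MvPolynomial (Fin n) K} (h : Dominates (chart K (M.pt (j.comp p₁))) π v)
    (h₁ : ∀ i, v (M.pt (j.comp p₂) i) ≤ 1)
    (h₂ : v (j (p₁ M.disc))⁻¹ ≤ 1) (h₃ : v (j (p₂ M.disc))⁻¹ ≤ 1)
    (h₄ : ∀ k m, v (D' k (M.pt (j.comp p₁) m)) ≤ 1)
    (h₅ : ∀ k m, v (D k (M.pt (j.comp p₂) m)) ≤ 1)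
    (h₆ : v (MvPolynomial.aeval (M.pt (j.comp p₁)) q₁)⁻¹ ≤ 1)
    (h₇ : v (MvPolynomial.aeval (M.pt (j.comp p₂)) q₂)⁻¹ ≤ 1) :
    ∃ Q : Ideal T, HeightOnePrime Q ∧ ∃ P₁ P₂ : M.Place,
      P₁.1 = Q.comap (p₁ : R →+* T) ∧ P₂.1 = Q.comap (p₂ : R →+* T) ∧
      ∀ c : M.Place →₀ K, c P₁ = c P₂ → ∀ l,
        v (MvPolynomial.aeval (M.pt (j.comp p₁)) π *
          (M.form (j.comp p₁) c (D l) - M.form (j.comp p₂) c (D l))) < 1 := by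
  have hK := h.algebraMap_le_one
  have hv₁ : ∀ r, v (j.comp p₁ r) ≤ 1 := M.le_one hK fun i => by
    simpa using h.le_one (MvPolynomial.X i)
  have hv₂ : ∀ r, v (j.comp p₂ r) ≤ 1 := M.le_one hK h₁
  have hf₁ : Function.Injective (j.comp p₁) := hj.comp hp₁
  have hf₂ : Function.Injective (j.comp p₂) := hj.comp hp₂
  have hv : ∀ t, v (j t) ≤ 1 := le_one_of_range_sup_range hclosed hK hv₁ hv₂
  have hQ := centerOn_isPrime j hv
  set Q := centerOn v j hv
  have hmem : ∀ t, t ∈ Q ↔ v (j t) < 1 := fun _ => Iff.rfl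
  have hnot : ∀ {t : T}, v (j t)⁻¹ ≤ 1 → t ≠ 0 → t ∉ Q := fun {t} ht ht0 htQ =>
    absurd ((hmem t).mp htQ) (not_lt.mpr (one_le_of_inv_le_one ht
      fun h0 => ht0 ((map_eq_zero_iff j hj).mp h0)))
  have hinj0 : ∀ {p : R →ₐ[K] T}, Function.Injective p → ∀ {r : R}, r ≠ 0 → p r ≠ 0 := by
    intro p hp r hr h0
    exact hr ((map_eq_zero_iff _ hp).mp h0)
  have hg0 : ∀ {q : MvPolynomial (Fin n) K}, q ≠ 0 → M.g q ≠ 0 := by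
    intro q hq h0
    exact hq ((map_eq_zero_iff _ M.inj).mp h0)
  have hcomap₁ : Q.comap (p₁.comp M.g : MvPolynomial (Fin n) K →+* T) = Ideal.span {π} := by
    ext a
    rw [Ideal.mem_span_singleton, ← h.lt_one_iff, Ideal.mem_comap, hmem, RingHom.coe_coe,
      RingHom.coe_coe, ← M.map_g]
    rfl
  have hheight : HeightOnePrime Q := by
    refine (heightOnePrime_iff_of_ringHom (f := (p₁.comp M.g : MvPolynomial (Fin n) K →+* T))
      (hp₁.comp M.inj) hq₁ (hnot ?_ (hinj0 hp₁ (hg0 hq₁0)))).mpr ⟨π, h.prime, hcomap₁⟩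
    rwa [← M.map_g] at h₆
  obtain ⟨π₂, hπ₂, hcomap₂⟩ := (heightOnePrime_iff_of_ringHom
    (f := (p₂.comp M.g : MvPolynomial (Fin n) K →+* T)) (hp₂.comp M.inj) hq₂
    (hnot (by rwa [← M.map_g] at h₇) (hinj0 hp₂ (hg0 hq₂0)))).mp hheight
  have hPp₁ : (Q.comap (p₁ : R →+* T)).IsPrime := inferInstance
  have hPp₂ : (Q.comap (p₂ : R →+* T)).IsPrime := inferInstance
  let P₁ : M.Place := ⟨Q.comap (p₁ : R →+* T), (M.heightOnePrime_iff _).mpr ⟨π, h.prime, hcomap₁⟩,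
    hnot h₂ (hinj0 hp₁ M.disc_ne_zero)⟩
  let P₂ : M.Place := ⟨Q.comap (p₂ : R →+* T), (M.heightOnePrime_iff _).mpr ⟨π₂, hπ₂, hcomap₂⟩,
    hnot h₃ (hinj0 hp₂ M.disc_ne_zero)⟩
  refine ⟨Q, hheight, P₁, P₂, rfl, rfl, fun c hc l => ?_⟩
  have hP₁ : ∀ t, v (j.comp p₁ t) < 1 ↔ t ∈ P₁.1 := fun _ => Iff.rfl
  have hP₂ : ∀ t, v (j.comp p₂ t) < 1 ↔ t ∈ P₂.1 := fun _ => Iff.rfl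
  have hd₁ := M.dominates hf₁ hv₁ P₁ hP₁
  have hd₂ := M.dominates hf₂ hv₂ P₂ hP₂
  have htame := hD.tame hx h l
  have hr₁ := M.form_residue hf₁ hv₁ P₁ hP₁ htame c
  have hr₂ := M.form_residue hf₂ hv₂ P₂ hP₂ htame c
  have hval := le_antisymm (hd₁.valuation_le hx hD hD' hd₂ h₄) (hd₂.valuation_le hx' hD' hD hd₁ h₅)
  set ϖ := MvPolynomial.aeval (M.pt (j.comp p₁)) π
  set s₁ := MvPolynomial.aeval (M.pt (j.comp p₁)) (M.datum P₁).h
  set s₂ := MvPolynomial.aeval (M.pt (j.comp p₂)) (M.datum P₂).h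
  have hs₂ : s₂ ≠ 0 := hd₂.ne_zero
  have hs₁ : s₁ ≠ 0 := hd₁.ne_zero
  obtain ⟨w, hw⟩ : ∃ w, s₁ = w * s₂ := ⟨_, (div_mul_cancel₀ _ hs₂).symm⟩
  have hw0 : w ≠ 0 := by rintro rfl; exact hs₁ (by rw [hw, zero_mul])
  have hw1 : v w = 1 := by
    rw [hw, map_mul] at hval
    exact (mul_eq_right₀ (v.ne_zero_iff.mpr hs₂)).mp hval
  have hdw : v (ϖ * dlog (D l) w) < 1 := by
    rw [dlog, mul_div_assoc', map_div₀, hw1, div_one]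
    exact htame.apply_lt w hw1.le
  have key : ϖ * (M.form (j.comp p₁) c (D l) - M.form (j.comp p₂) c (D l)) =
      ((ϖ * M.form (j.comp p₁) c (D l) - c P₁ • (ϖ * dlog (D l) s₁)) -
        (ϖ * M.form (j.comp p₂) c (D l) - c P₂ • (ϖ * dlog (D l) s₂))) +
        algebraMap K Ω (c P₁) * (ϖ * dlog (D l) w) := by
    rw [hw, dlog_mul (D l) hw0 hs₂, hc, Algebra.smul_def, Algebra.smul_def]
    ring
  rw [key]
  refine v.map_add_lt (v.map_sub_lt hr₁ hr₂) ?_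
  rw [map_mul, mul_comm]
  exact mul_lt_one_of_lt_of_le hdw (hK _)

end Model

end Good

namespace Model

universe u

variable {K R T : Type*} {Ω : Type u} [Field K] [CharZero K] [CommRing R] [IsDomain R] [Algebra K R]
  [CommRing T] [IsDomain T] [Algebra K T] [Algebra.FiniteType K T] [Field Ω] [IsAlgClosed Ω]
  [Algebra K Ω] {n : ℕ}

theorem exists_isBounded (M : Model K R n) {p₁ p₂ : R →ₐ[K] T}
    (hclosed : p₁.range ⊔ p₂.range = ⊤) (hp₁ : Function.Injective p₁) (hp₂ : Function.Injective p₂)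
    {j : T →ₐ[K] Ω} (hj : Function.Injective j)
    (hx : IsBase (K := K) (M.pt (j.comp p₁))) (hx' : IsBase (K := K) (M.pt (j.comp p₂)))
    {D : Fin n → Derivation K Ω Ω} (hD : IsDual (M.pt (j.comp p₁)) D) :
    ∃ (q : MvPolynomial (Fin n) K) (r : Fin n → MvPolynomial (Fin n) K), q ≠ 0 ∧ (∀ i, r i ≠ 0) ∧
      ∀ c : M.Place →₀ K, (∀ Q : Ideal T, HeightOnePrime Q → ∀ P₁ P₂ : M.Place,
        P₁.1 = Q.comap (p₁ : R →+* T) → P₂.1 = Q.comap (p₂ : R →+* T) → c P₁ = c P₂) → ∀ l,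
      IsBounded (M.pt (j.comp p₁)) q r
        (M.form (j.comp p₁) c (D l) - M.form (j.comp p₂) c (D l)) := by
  classical
  obtain ⟨D', hD'⟩ := hx'.exists_derivation
  obtain ⟨q₁, hq₁0, hq₁⟩ := hx.exists_denominator (φ := p₁.comp M.g) hj (M.map_g (j.comp p₁))
  obtain ⟨q₂, hq₂0, hq₂⟩ := hx'.exists_denominator (φ := p₂.comp M.g) hj (M.map_g (j.comp p₂))
  set x := M.pt (j.comp p₁) with hxdef
  set x' := M.pt (j.comp p₂) with hx'def
  let B := M.poles (j.comp p₁) ∪ M.poles (j.comp p₂)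
  let G : Finset Ω := {(j (p₁ M.disc))⁻¹, (j (p₂ M.disc))⁻¹, (MvPolynomial.aeval x q₁)⁻¹,
    (MvPolynomial.aeval x' q₂)⁻¹} ∪
      (Finset.image₂ (fun k m => D' k (x m)) Finset.univ Finset.univ ∪
      Finset.image₂ (fun k m => D k (x' m)) Finset.univ Finset.univ)
  obtain ⟨q, hq, hint⟩ := hx.exists_isIntegralElem (B ∪ G)
  choose r hr hintr using fun i => (hx.isBase_flip i).exists_isIntegralElem B
  have hbad : ∀ {Γ : Type u} [LinearOrderedCommGroupWithZero Γ] {v : Valuation Ω Γ} {t ϖ : Ω},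
      (∀ c : K, v (algebraMap K Ω c) ≤ 1) → t ≠ 0 → v t < 1 → (∀ s ∈ B, v (t * s) ≤ 1) →
      ∀ l, Tame v (D l) ϖ → ∀ c, v (ϖ * t ^ (M.order + 1) *
        (M.form (j.comp p₁) c (D l) - M.form (j.comp p₂) c (D l))) < 1 := by
    intro Γ _ v t ϖ hK ht0 ht h l htame c
    rw [mul_sub]
    exact v.map_sub_lt
      (M.mul_form_lt_one _ hK ht0 ht (fun s hs => h s (Finset.mem_union_left _ hs)) htame c)
      (M.mul_form_lt_one _ hK ht0 ht (fun s hs => h s (Finset.mem_union_right _ hs)) htame c)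
  refine ⟨q ^ (M.order + 1), fun i => (r i * MvPolynomial.X i) ^ (M.order + 1), pow_ne_zero _ hq,
    fun i => pow_ne_zero _ (mul_ne_zero (hr i) (MvPolynomial.X_ne_zero i)), fun c hc l => ⟨?_, ?_⟩⟩
  · intro π Γ _ v h
    have hle : ∀ t ∈ B ∪ G, v (MvPolynomial.aeval x q * t) ≤ 1 := fun t ht =>
      le_one_of_isIntegralElem h.le_one (hint t ht)
    by_cases hπ : π ∣ q
    · rw [map_mul (MvPolynomial.aeval x), map_pow (MvPolynomial.aeval x)]
      exact hbad h.algebraMap_le_one (fun h0 => hq (hx.inj (h0.trans (map_zero _).symm)))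
        ((h.lt_one_iff q).mpr hπ) (fun s hs => hle s (Finset.mem_union_left _ hs)) l
        (hD.tame hx h l) c
    · have h1 : v (MvPolynomial.aeval x q) = 1 := h.eq_one hπ
      have hB : ∀ t ∈ B, v t ≤ 1 := fun t ht => by
        simpa [h1] using hle t (Finset.mem_union_left _ ht)
      have hG : ∀ t ∈ G, v t ≤ 1 := fun t ht => by
        simpa [h1] using hle t (Finset.mem_union_right _ ht)
      obtain ⟨Q, hQ, P₁, P₂, hP₁, hP₂, hform⟩ := M.exists_place_form_sub_lt_one hclosed hp₁ hp₂ hj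
        hx hx' hD hD' hq₁ hq₂ hq₁0 hq₂0 h
        (fun i => hB _ (Finset.mem_union_right _ (Finset.mem_union_left _
          (Finset.mem_image_of_mem _ (Finset.mem_univ i)))))
        (hG _ (by simp [G])) (hG _ (by simp [G]))
        (fun k m => hG _ (Finset.mem_union_right _ (Finset.mem_union_left _
          (Finset.mem_image₂_of_mem (Finset.mem_univ k) (Finset.mem_univ m)))))
        (fun k m => hG _ (Finset.mem_union_right _ (Finset.mem_union_right _
          (Finset.mem_image₂_of_mem (Finset.mem_univ k) (Finset.mem_univ m)))))
        (hG _ (by simp [G, hxdef])) (hG _ (by simp [G, hx'def]))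
      rw [map_mul (MvPolynomial.aeval x), map_pow (MvPolynomial.aeval x), mul_right_comm, map_mul,
        map_pow, h1, one_pow, mul_one]
      exact hform c (hc Q hQ P₁ P₂ hP₁ hP₂) l
  · intro i Γ _ v h
    have hz := hx.isBase_flip i
    rw [map_mul (MvPolynomial.aeval (flip x i)), map_pow (MvPolynomial.aeval (flip x i))]
    have hinj : ∀ p : MvPolynomial (Fin n) K, p ≠ 0 → MvPolynomial.aeval (flip x i) p ≠ 0 :=
      fun p hp h0 => hp (hz.inj (h0.trans (map_zero _).symm))
    refine hbad h.algebraMap_le_one (hinj _ (mul_ne_zero (hr i) (MvPolynomial.X_ne_zero i)))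
      ((h.lt_one_iff _).mpr (Dvd.intro_left _ rfl)) (fun s hs => ?_) l (hD.tame_flip hx h l) c
    rw [map_mul (MvPolynomial.aeval (flip x i)), mul_right_comm, map_mul]
    exact mul_le_one' (le_one_of_isIntegralElem h.le_one (hintr i s hs)) (h.le_one _)

end Model

theorem exists_algebraMap_eq_of_fixed {k Ω : Type*} [Field k] [CharZero k] [Field Ω] [Algebra k Ω]
    [IsAlgClosed Ω] [Algebra.IsAlgebraic k Ω] {t : Ω} (h : ∀ σ : Ω ≃ₐ[k] Ω, σ t = t) :
    ∃ a, algebraMap k Ω a = t := by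
  have : IsAlgClosure k Ω := ⟨inferInstance, inferInstance⟩
  have : Normal k Ω := IsAlgClosure.normal k Ω
  have : IsGalois k Ω := {}
  exact IntermediateField.mem_bot.mp ((InfiniteGalois.mem_bot_iff_fixed t).mpr h)

theorem IsBase.conj_eq_self {K Ω : Type*} [Field K] [CharZero K] [Field Ω] [Algebra K Ω] {n : ℕ}
    {x : Fin n → Ω} {D : Fin n → Derivation K Ω Ω} (hx : IsBase (K := K) x) (hD : IsDual x D)
    {σ : Ω ≃ₐ[K] Ω} (h : ∀ i, σ (x i) = x i) (l : Fin n) : conj σ (D l) = D l := by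
  refine hx.derivation_ext fun i => ?_
  rw [conj_apply, σ.symm_apply_eq.mpr (h i).symm, hD l i]
  split_ifs <;> simp

namespace Model

section Linear

variable {K R Ω : Type*} [Field K] [CharZero K] [CommRing R] [IsDomain R] [Algebra K R] [Field Ω]
  [Algebra K Ω] {n : ℕ} (M : Model K R n)

/-- The form, as a linear function of its residues. -/
noncomputable def formHom (f : R →ₐ[K] Ω) (D : Derivation K Ω Ω) : (M.Place →₀ K) →ₗ[K] Ω :=
  Finsupp.linearCombination K fun P => theta M.F (M.pt f) (f M.gen) (M.datum P) D

theorem form_sum_smul {ι : Type*} (f : R →ₐ[K] Ω) (c : M.Place →₀ K) (s : Finset ι) (a : ι → Ω)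
    (D : ι → Derivation K Ω Ω) :
    M.form f c (∑ i ∈ s, a i • D i) = ∑ i ∈ s, a i * M.form f c (D i) := by
  simp only [form, theta_sum_smul, Finsupp.sum, Finset.smul_sum, Finset.mul_sum, mul_smul_comm]
  exact Finset.sum_comm

variable [IsAlgClosed Ω]

theorem map_form {f f' : R →ₐ[K] Ω} {σ : Ω ≃ₐ[K] Ω} (hx : ∀ i, σ (M.pt f i) = M.pt f' i)
    (hy : σ (f M.gen) = f' M.gen) (c : M.Place →₀ K) (D : Derivation K Ω Ω) :
    σ (M.form f c D) = M.form f' c (conj σ D) := by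
  simp only [form, Finsupp.sum, map_sum, map_smul, map_theta, hx, hy]

/-- Conjugation by an automorphism transports the form along a change of point. -/
theorem form_eq_sum_map {f f' : R →ₐ[K] Ω} {σ : Ω ≃ₐ[K] Ω} (h : ∀ r, σ (f r) = f' r)
    (hx' : IsBase (K := K) (M.pt f')) {D : Fin n → Derivation K Ω Ω} (hD : IsDual (M.pt f) D)
    (c : M.Place →₀ K) (E : Derivation K Ω Ω) :
    M.form f' c E = ∑ k, E (M.pt f' k) * σ (M.form f c (D k)) := by
  have hpt : (fun i => σ (M.pt f i)) = M.pt f' := funext fun i => h _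
  have hdual := hD.conj σ
  rw [hpt] at hdual
  conv_lhs => rw [hdual.eq_sum hx' E]
  rw [form_sum_smul]
  refine Finset.sum_congr rfl fun k _ => ?_
  rw [M.map_form (f' := f') (fun i => h _) (h _)]

theorem eq_zero_of_form_eq_zero {f : R →ₐ[K] Ω} (hf : Function.Injective f)
    (hx : IsBase (K := K) (M.pt f)) {D : Fin n → Derivation K Ω Ω} (hD : IsDual (M.pt f) D)
    {c : M.Place →₀ K} (h : ∀ l, M.form f c (D l) = 0) : c = 0 := by
  ext P
  by_contra hP
  have := P.isPrime
  obtain ⟨Γ, _, v, hv, hvP⟩ := exists_valuation (f : R →+* Ω) hf P.1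
  have hdom := M.dominates hf hv P hvP
  obtain ⟨l, hl⟩ := exists_not_dvd_pderiv hdom.prime
  have hres := M.form_residue hf hv P hvP (hD.tame hx hdom l) c
  have h0 : MvPolynomial.aeval (M.pt f) (M.datum P).h ≠ 0 := hdom.ne_zero
  rw [h l, mul_zero, zero_sub, Valuation.map_neg, dlog, mul_div_cancel₀ _ h0,
    hD.apply_aeval, Algebra.smul_def, map_mul] at hres
  have h1 : v (algebraMap K Ω (c P)) = 1 := by
    have hK := hdom.algebraMap_le_one
    refine le_antisymm (hK _) ?_
    have := hK (c P)⁻¹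
    rw [map_inv₀] at this
    exact one_le_of_inv_le_one this (by simpa using hP)
  rw [h1, one_mul] at hres
  exact hl ((hdom.lt_one_iff _).mp hres)

end Linear

section Finite

universe u

variable {K R T : Type*} {Ω : Type u} [Field K] [CharZero K] [CommRing R] [IsDomain R] [Algebra K R]
  [CommRing T] [IsDomain T] [Algebra K T] [Algebra.FiniteType K T] [Field Ω] [IsAlgClosed Ω]
  [Algebra K Ω] {n : ℕ}

/-- The forms which have equal residues along both projections differ by elements of a finite
dimensional space. -/
theorem finiteDimensional_map_sub (M : Model K R n) {p₁ p₂ : R →ₐ[K] T}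
    (hclosed : p₁.range ⊔ p₂.range = ⊤) (hp₁ : Function.Injective p₁) (hp₂ : Function.Injective p₂)
    {j : T →ₐ[K] Ω} (hj : Function.Injective j)
    (hx : IsBase (K := K) (M.pt (j.comp p₁))) (hx' : IsBase (K := K) (M.pt (j.comp p₂)))
    {D : Fin n → Derivation K Ω Ω} (hD : IsDual (M.pt (j.comp p₁)) D)
    (H : Submodule K (M.Place →₀ K))
    (hH : ∀ c ∈ H, ∀ Q : Ideal T, HeightOnePrime Q → ∀ P₁ P₂ : M.Place,
        P₁.1 = Q.comap (p₁ : R →+* T) → P₂.1 = Q.comap (p₂ : R →+* T) → c P₁ = c P₂) (l : Fin n) :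
    FiniteDimensional K
      (H.map (M.formHom (j.comp p₁) (D l) - M.formHom (j.comp p₂) (D l))) := by
  obtain ⟨q, r, hq, hr, hbound⟩ := M.exists_isBounded hclosed hp₁ hp₂ hj hx hx' hD
  set x := M.pt (j.comp p₁) with hxdef
  set x' := M.pt (j.comp p₂) with hx'def
  have halg : Algebra.IsAlgebraic (IntermediateField.adjoin K (Set.range x)) Ω := hx.isAlgebraic
  let s : Set Ω := insert (j.comp p₁ M.gen) (insert (j.comp p₂ M.gen) (Set.range x'))
  have hs : s.Finite := ((Set.finite_range x').insert _).insert _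
  let L := IntermediateField.adjoin (IntermediateField.adjoin K (Set.range x)) s
  have hfin : FiniteDimensional (IntermediateField.adjoin K (Set.range x)) L := by
    have := hs.to_subtype
    exact IntermediateField.finiteDimensional_adjoin fun t _ => halg.isIntegral.isIntegral t
  have : Algebra.IsAlgebraic L Ω :=
    Algebra.IsAlgebraic.tower_top (K := IntermediateField.adjoin K (Set.range x)) L
  have hL : ∀ t ∈ s, t ∈ L := fun t ht => IntermediateField.subset_adjoin _ _ ht
  refine finiteDimensional_of_isBounded hx L hq hr _ ?_ ?_
  · rintro _ ⟨c, hc, rfl⟩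
    obtain ⟨a, ha⟩ := exists_algebraMap_eq_of_fixed (k := L)
      (t := (M.formHom (j.comp p₁) (D l) - M.formHom (j.comp p₂) (D l)) c) fun ρ => by
        let σ : Ω ≃ₐ[K] Ω :=
          (ρ.restrictScalars (IntermediateField.adjoin K (Set.range x))).restrictScalars K
        have hfix : ∀ t ∈ L, σ t = t := fun t ht => ρ.commutes ⟨t, ht⟩
        have hx1 : ∀ i, σ (x i) = x i := fun i => hfix _ <|
          L.algebraMap_mem ⟨x i, mem_adjoin_range x i⟩
        have hx2 : ∀ i, σ (x' i) = x' i := fun i => hfix _ <| hL _ (by simp [s])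
        have hDl : conj σ (D l) = D l := hx.conj_eq_self hD hx1 l
        change σ (M.form (j.comp p₁) c (D l) - M.form (j.comp p₂) c (D l)) = _
        rw [map_sub, M.map_form hx1 (hfix _ (hL _ (by simp [s]))),
          M.map_form hx2 (hfix _ (hL _ (by simp [s]))), hDl]
        rfl
    rw [← ha]
    exact a.2
  · rintro _ ⟨c, hc, rfl⟩
    exact hbound c (hH c hc) l

end Finite

end Model

theorem exists_supported_of_finiteDimensional {ι K : Type*} [Field K] (W : Submodule K (ι →₀ K))
    [FiniteDimensional K W] : ∃ s : Set ι, s.Finite ∧ W ≤ Finsupp.supported K K s := by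
  classical
  obtain ⟨t, ht⟩ := (Submodule.fg_iff_finiteDimensional W).mpr ‹_›
  refine ⟨⋃ c ∈ t, ↑c.support, t.finite_toSet.biUnion fun c _ => c.support.finite_toSet, ?_⟩
  rw [← ht, Submodule.span_le]
  intro c hc
  exact (Finsupp.mem_supported _ _).mpr (Set.subset_biUnion_of_mem (u := fun c : ι →₀ K =>
    (c.support : Set ι)) hc)

theorem finite_heightOnePrime_mem {R : Type*} [CommRing R] [IsDomain R] [IsNoetherianRing R]
    {a : R} (ha : a ≠ 0) : {P : Ideal R | HeightOnePrime P ∧ a ∈ P}.Finite := by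
  refine (Ideal.finite_minimalPrimes_of_isNoetherianRing R (Ideal.span {a})).subset ?_
  rintro P ⟨hP, haP⟩
  refine ⟨⟨hP.1, (Ideal.span_singleton_le_iff_mem _).mpr haP⟩, fun Q ⟨hQ, haQ⟩ hle => ?_⟩
  by_contra hne
  have := hP.2.2 Q hQ (lt_of_le_not_ge hle hne)
  rw [this, Ideal.span_singleton_le_iff_mem] at haQ
  exact ha haQ

namespace Model

variable {K R : Type*} [Field K] [CommRing R] [IsNoetherianRing R] [Algebra K R]
  {n : ℕ} (M : Model K R n)

open Classical in
/-- The reduced divisor of an ideal, away from the zeros of `M.disc`. -/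
noncomputable def divisor (I : Ideal R) : M.Place →₀ K :=
  Finsupp.ofSupportFinite (fun P => if P.1 ∈ I.minimalPrimes then 1 else 0) <|
    ((Ideal.finite_minimalPrimes_of_isNoetherianRing R I).preimage
      Subtype.val_injective.injOn).subset fun P hP => by
        by_contra h
        exact hP (if_neg h)

open Classical in
theorem divisor_apply (I : Ideal R) (P : M.Place) :
    M.divisor I P = if P.1 ∈ I.minimalPrimes then 1 else 0 := rfl

theorem not_finiteDimensional_span_divisor [IsDomain R] {S : Set (Ideal R)} (hS : S.Infinite)
    (h : ∀ I ∈ S, IsHypersurfaceIdeal I) :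
    ¬ FiniteDimensional K (Submodule.span K (M.divisor '' S)) := by
  classical
  intro hfin
  obtain ⟨s, hs, hle⟩ := exists_supported_of_finiteDimensional (Submodule.span K (M.divisor '' S))
  refine hS (Set.Finite.of_finite_image (f := Ideal.minimalPrimes)
    (((hs.image Subtype.val).union (finite_heightOnePrime_mem M.disc_ne_zero)).finite_subsets.subset
      ?_) fun I hI J hJ hIJ => ?_)
  · rintro _ ⟨I, hI, rfl⟩ P hP
    have hP1 := (h I hI).2.2 P hP
    by_cases hd : M.disc ∈ P
    · exact Or.inr ⟨hP1, hd⟩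
    · let P' : M.Place := ⟨P, hP1, hd⟩
      have hP' : M.divisor I P' ≠ 0 := by
        rw [divisor_apply, if_pos hP]
        exact one_ne_zero
      exact Or.inl ⟨P', (Finsupp.mem_supported _ _).mp (hle (Submodule.subset_span ⟨I, hI, rfl⟩))
        (Finset.mem_coe.mpr (Finsupp.mem_support_iff.mpr hP')), rfl⟩
  · rw [← (h I hI).1.radical, ← (h J hJ).1.radical, ← Ideal.sInf_minimalPrimes,
      ← Ideal.sInf_minimalPrimes, hIJ]

end Model

theorem exists_eval₂_comp_eq_zero {A B C : Type*} [CommRing A] [IsDomain A] [CommRing B]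
    [IsDomain B] [CommRing C] [IsDomain C] {f : A →+* B} {g : B →+* C}
    (hf : ∀ b, ∃ p : A[X], p ≠ 0 ∧ p.eval₂ f b = 0)
    (hg : ∀ c, ∃ p : B[X], p ≠ 0 ∧ p.eval₂ g c = 0) (c : C) :
    ∃ p : A[X], p ≠ 0 ∧ p.eval₂ (g.comp f) c = 0 := by
  let := f.toAlgebra
  let := g.toAlgebra
  let := (g.comp f).toAlgebra
  have : IsScalarTower A B C := .of_algebraMap_eq' rfl
  have h₁ : Algebra.IsAlgebraic A B := ⟨hf⟩
  have h₂ : Algebra.IsAlgebraic B C := ⟨hg⟩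
  exact (Algebra.IsAlgebraic.trans A B C).isAlgebraic c

theorem isAlgebraic_adjoin_range {K R Ω : Type*} [Field K] [CommRing R] [Algebra K R] [Field Ω]
    [Algebra K Ω] {f : R →ₐ[K] Ω} (hf : Function.Injective f)
    (h : ∀ t, ∃ p : R[X], p ≠ 0 ∧ p.eval₂ (f : R →+* Ω) t = 0) :
    Algebra.IsAlgebraic (IntermediateField.adjoin K (f.range : Set Ω)) Ω := by
  refine ⟨fun t => ?_⟩
  obtain ⟨p, hp, h0⟩ := h t
  let φ : R →+* IntermediateField.adjoin K (f.range : Set Ω) :=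
    (f : R →+* Ω).codRestrict _ fun r => IntermediateField.subset_adjoin _ _ ⟨r, rfl⟩
  have hφ : Function.Injective φ := fun a b hab => hf (congrArg Subtype.val hab)
  refine ⟨p.map φ, (Polynomial.map_ne_zero_iff hφ).mpr hp, ?_⟩
  rw [aeval_def, eval₂_map]
  exact h0

theorem mem_adjoin_range_iff_div {K R Ω : Type*} [Field K] [CommRing R] [Algebra K R] [Field Ω]
    [Algebra K Ω] {f : R →ₐ[K] Ω} {t : Ω} :
    t ∈ IntermediateField.adjoin K (f.range : Set Ω) ↔ ∃ a b, t = f a / f b := by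
  rw [IntermediateField.mem_adjoin_iff_div, Algebra.adjoin_eq]
  constructor
  · rintro ⟨_, ⟨a, rfl⟩, _, ⟨b, rfl⟩, h⟩
    exact ⟨a, b, h⟩
  · rintro ⟨a, b, h⟩
    exact ⟨_, ⟨a, rfl⟩, _, ⟨b, rfl⟩, h⟩

namespace Model

theorem isBase_pt {K R Ω : Type*} [Field K] [CommRing R] [IsDomain R] [Algebra K R] [Field Ω]
    [Algebra K Ω] {n : ℕ} (M : Model K R n) {f : R →ₐ[K] Ω} (hf : Function.Injective f)
    (h : ∀ t, ∃ p : R[X], p ≠ 0 ∧ p.eval₂ (f : R →+* Ω) t = 0) : IsBase (K := K) (M.pt f) where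
  inj p q hpq := by
    rw [← M.map_g, ← M.map_g] at hpq
    exact M.inj (hf hpq)
  algebraic t := by
    obtain ⟨p, hp, h0⟩ := exists_eval₂_comp_eq_zero
      (f := (M.g : MvPolynomial (Fin n) K →+* R)) (fun b => by
        obtain ⟨p, hp, h0⟩ := M.integral b
        exact ⟨p, hp.ne_zero, h0⟩) h t
    refine ⟨p, hp, Eq.trans ?_ h0⟩
    exact congrArg (fun φ => p.eval₂ φ t) (RingHom.ext fun q => (M.map_g f q).symm)

universe u

variable {K R T : Type*} {Ω : Type u} [Field K] [CharZero K] [CommRing R] [IsDomain R] [Algebra K R]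
  [CommRing T] [IsDomain T] [Algebra K T] [Algebra.FiniteType K T] [Field Ω] [IsAlgClosed Ω]
  [Algebra K Ω] {n : ℕ}

theorem exists_fixed (M : Model K R n) {p₁ p₂ : R →ₐ[K] T}
    (hclosed : p₁.range ⊔ p₂.range = ⊤) (hp₁ : Function.Injective p₁) (hp₂ : Function.Injective p₂)
    {j : T →ₐ[K] Ω} (hj : Function.Injective j)
    (hx : IsBase (K := K) (M.pt (j.comp p₁))) (hx' : IsBase (K := K) (M.pt (j.comp p₂)))
    {σ : Ω ≃ₐ[K] Ω} (hσ : ∀ r, σ (j.comp p₁ r) = j.comp p₂ r) {G : Set (Ω ≃ₐ[K] Ω)}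
    (hG : ∀ ρ ∈ G, ∀ r, ρ (j.comp p₁ r) = j.comp p₁ r)
    {H : Submodule K (M.Place →₀ K)} (hHinf : ¬ FiniteDimensional K H)
    (hH : ∀ c ∈ H, ∀ Q : Ideal T, HeightOnePrime Q → ∀ P₁ P₂ : M.Place,
        P₁.1 = Q.comap (p₁ : R →+* T) → P₂.1 = Q.comap (p₂ : R →+* T) → c P₁ = c P₂) :
    ∃ t : Ω, σ t = t ∧ (∀ ρ ∈ G, ρ t = t) ∧ ∀ a : K, algebraMap K Ω a ≠ t := by
  by_contra! hfix
  refine hHinf ?_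
  obtain ⟨D, hD⟩ := hx.exists_derivation
  have hfin := M.finiteDimensional_map_sub hclosed hp₁ hp₂ hj hx hx' hD H hH
  let α : (M.Place →₀ K) →ₗ[K] (Fin n → Ω) :=
    LinearMap.pi fun l => M.formHom (j.comp p₁) (D l)
  let δ : (M.Place →₀ K) →ₗ[K] (Fin n → Ω) :=
    LinearMap.pi fun l => M.formHom (j.comp p₁) (D l) - M.formHom (j.comp p₂) (D l)
  have hα : Function.Injective α := by
    rw [injective_iff_map_eq_zero]
    exact fun c hc => M.eq_zero_of_form_eq_zero (hj.comp hp₁) hx hD fun l => congrFun hc l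
  have hU : FiniteDimensional K ((H ⊓ LinearMap.ker δ).map α) := by
    refine finiteDimensional_of_fixed (Ω := Ω) _
      (insert (σ : Ω → Ω) ((fun ρ : Ω ≃ₐ[K] Ω => (ρ : Ω → Ω)) '' G))
      ?_ fun t ht => ?_
    · rintro _ (rfl | ⟨ρ, hρ, rfl⟩)
      · refine ⟨AddMonoidHom.mk' (fun u l => ∑ k, D l (M.pt (j.comp p₂) k) * σ (u k))
          fun u w => funext fun l => ?_, fun t w => funext fun l => ?_, ?_⟩
        · simp [mul_add, Finset.sum_add_distrib]
        · simp [Finset.mul_sum, mul_left_comm]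
        · rintro _ ⟨c, ⟨-, hc⟩, rfl⟩
          ext l
          have hl : M.form (j.comp p₁) c (D l) - M.form (j.comp p₂) c (D l) = 0 := congrFun hc l
          change ∑ k, _ * σ (M.form (j.comp p₁) c (D k)) = M.form (j.comp p₁) c (D l)
          rw [sub_eq_zero.mp hl, M.form_eq_sum_map hσ hx' hD]
      · refine ⟨AddMonoidHom.mk' (fun u l => ρ (u l)) fun u w => funext fun l => ?_,
          fun t w => funext fun l => ?_, ?_⟩
        · simp
        · simp
        · rintro _ ⟨c, -, rfl⟩
          ext l
          have hρx : ∀ i, ρ (M.pt (j.comp p₁) i) = M.pt (j.comp p₁) i := fun i => hG ρ hρ _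
          change ρ (M.form (j.comp p₁) c (D l)) = M.form (j.comp p₁) c (D l)
          rw [M.map_form hρx (hG ρ hρ _), hx.conj_eq_self hD hρx]
    · exact hfix t (ht _ (Set.mem_insert _ _)) fun ρ hρ =>
        ht _ (Set.mem_insert_of_mem _ (Set.mem_image_of_mem _ hρ))
  have hker : FiniteDimensional K (H ⊓ LinearMap.ker δ : Submodule K _) :=
    .of_injective (α.submoduleMap _) fun a b hab =>
      Subtype.ext (hα (congrArg Subtype.val hab))
  have hmap : FiniteDimensional K (H.map δ) := by
    let W := fun l => H.map (M.formHom (j.comp p₁) (D l) - M.formHom (j.comp p₂) (D l))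
    have : ∀ l, FiniteDimensional K (W l) := hfin
    let Φ : (∀ l, W l) →ₗ[K] (Fin n → Ω) :=
      LinearMap.pi fun l => (W l).subtype ∘ₗ LinearMap.proj l
    refine Submodule.finiteDimensional_of_le (S₂ := LinearMap.range Φ) ?_
    rintro _ ⟨c, hc, rfl⟩
    exact ⟨fun l => ⟨_, c, hc, rfl⟩, rfl⟩
  rw [← Submodule.fg_iff_finiteDimensional] at hker hmap ⊢
  exact Submodule.fg_of_fg_map_of_fg_inf_ker δ hmap hker

end Model

end Correspondence

/-- **Corollary 6.2.** A rational finite self-correspondence `(X, Γ)` over an algebraically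
closed field of characteristic zero with infinitely many totally invariant hypersurfaces
preserves a nonconstant rational function on `X`. -/
theorem cantat_correspondence
    (K : Type*) [Field K] [IsAlgClosed K] [CharZero K]
    (R : Type*) [CommRing R] [IsDomain R] [Algebra K R] [Algebra.FiniteType K R]
    (T : Type*) [CommRing T] [IsDomain T] [Algebra K T] [Algebra.FiniteType K T]
    (p₁ p₂ : R →ₐ[K] T)
    -- Γ is a closed subvariety of X × X: the two pullbacks generate its coordinate ring
    (hclosed : p₁.range ⊔ p₂.range = ⊤)
    -- both coordinate projections are dominant ...
    (hdom₁ : Function.Injective p₁) (hdom₂ : Function.Injective p₂)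
    -- ... and generically finite-to-one
    (hfin₁ : ∀ t : T, ∃ q : Polynomial R, q ≠ 0 ∧ Polynomial.eval₂ (p₁ : R →+* T) t q = 0)
    (hfin₂ : ∀ t : T, ∃ q : Polynomial R, q ≠ 0 ∧ Polynomial.eval₂ (p₂ : R →+* T) t q = 0)
    (hinv : {I : Ideal R | IsHypersurfaceIdeal I ∧
        properTransform (p₁ : R →+* T) I = properTransform (p₂ : R →+* T) I}.Infinite) :
    ∃ a b : R, b ≠ 0 ∧ (∀ c : K, a ≠ algebraMap K R c * b) ∧
      p₁ a * p₂ b = p₂ a * p₁ b := by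
  obtain ⟨n, ⟨M⟩⟩ := Correspondence.exists_model K R
  have : IsNoetherianRing R := Algebra.FiniteType.isNoetherianRing K R
  have : IsNoetherianRing T := Algebra.FiniteType.isNoetherianRing K T
  let Ω := AlgebraicClosure (FractionRing T)
  let j : T →ₐ[K] Ω := IsScalarTower.toAlgHom K T Ω
  have hj : Function.Injective j := by
    change Function.Injective (algebraMap T Ω)
    rw [IsScalarTower.algebraMap_eq T (FractionRing T) Ω]
    exact (algebraMap (FractionRing T) Ω).injective.comp (IsFractionRing.injective T _)
  have halg : ∀ t : Ω, ∃ p : Polynomial T, p ≠ 0 ∧ p.eval₂ (j : T →+* Ω) t = 0 :=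
    ((IsFractionRing.comap_isAlgebraic_iff (A := T) (K := FractionRing T) (C := Ω)).mpr
      inferInstance).isAlgebraic
  have h₁ := Correspondence.exists_eval₂_comp_eq_zero hfin₁ halg
  have h₂ := Correspondence.exists_eval₂_comp_eq_zero hfin₂ halg
  have hf₁ : Function.Injective (j.comp p₁) := hj.comp hdom₁
  have hf₂ : Function.Injective (j.comp p₂) := hj.comp hdom₂
  obtain ⟨τ, hτ⟩ := Correspondence.exists_algEquiv ((j : T →+* Ω).comp (p₁ : R →+* T))
    ((j : T →+* Ω).comp (p₂ : R →+* T)) hf₁ hf₂ h₁ h₂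
  let σ : Ω ≃ₐ[K] Ω := AlgEquiv.ofRingEquiv (f := τ) fun c => by
    simpa using hτ (algebraMap K R c)
  let L := IntermediateField.adjoin K ((j.comp p₁).range : Set Ω)
  have hL : Algebra.IsAlgebraic L Ω := Correspondence.isAlgebraic_adjoin_range hf₁ h₁
  have hHinf := M.not_finiteDimensional_span_divisor hinv fun I hI => hI.1
  obtain ⟨t, hσt, hGt, ht⟩ := M.exists_fixed hclosed hdom₁ hdom₂ hj (M.isBase_pt hf₁ h₁)
    (M.isBase_pt hf₂ h₂) (σ := σ) hτ
    (G := Set.range fun ρ : Ω ≃ₐ[L] Ω => ρ.restrictScalars K)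
    (by
      rintro _ ⟨ρ, rfl⟩ r
      exact ρ.commutes ⟨_, IntermediateField.subset_adjoin _ _ ⟨r, rfl⟩⟩) hHinf (by
      classical
      intro c hc Q hQ P₁ P₂ hP₁ hP₂
      induction hc using Submodule.span_induction with
      | mem c hc =>
        obtain ⟨I, ⟨hI, hinvI⟩, rfl⟩ := hc
        rw [M.divisor_apply, M.divisor_apply, hP₁, hP₂]
        refine if_congr ⟨fun h => ?_, fun h => ?_⟩ rfl rfl
        · exact Correspondence.comap_mem_minimalPrimes hdom₁ hdom₂ hI hinvI hQ h
        · exact Correspondence.comap_mem_minimalPrimes hdom₂ hdom₁ hI hinvI.symm hQ h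
      | zero => rfl
      | add c c' _ _ hc hc' => rw [Finsupp.add_apply, Finsupp.add_apply, hc, hc']
      | smul a c _ hc => rw [Finsupp.smul_apply, Finsupp.smul_apply, hc])
  obtain ⟨s, rfl⟩ := Correspondence.exists_algebraMap_eq_of_fixed (k := L) fun ρ =>
    hGt _ ⟨ρ, rfl⟩
  obtain ⟨a, b, hab⟩ := Correspondence.mem_adjoin_range_iff_div.mp s.2
  change algebraMap L Ω s = _ at hab
  rw [hab] at hσt ht
  have hb : b ≠ 0 := by
    rintro rfl
    exact ht 0 (by simp)
  have hb₁ := (map_ne_zero_iff _ hf₁).mpr hb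
  have hb₂ := (map_ne_zero_iff _ hf₂).mpr hb
  refine ⟨a, b, hb, fun c hc => ht c ?_, hj ?_⟩
  · rw [hc, map_mul, AlgHom.commutes, mul_div_cancel_right₀ _ hb₁]
  · have h : (j.comp p₂) a / (j.comp p₂) b = (j.comp p₁) a / (j.comp p₁) b := by
      rw [← hσt, map_div₀]
      exact (congrArg₂ (· / ·) (hτ a) (hτ b)).symm
    rw [map_mul, map_mul]
    exact ((div_eq_div_iff hb₂ hb₁).mp h).symm
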